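/- For every integer p ≥ 2 and every integer k with 0 ≤ k ≤ ⌊(p+1)/2⌋ − 1, one has 𝔖_k^p = kπ, the value σ_k^N(𝔻_½)·L(∂_S𝔻_½) for the upper unit half-disk 𝔻_½ (with Steklov conditions on the semicircle and Neumann conditions on the diameter). (Corollary 4.6 of the paper.) -/

import Mathlib

open Set MeasureTheory Metric Filter Asymptotics
open scoped ENNReal Topology NNReal

noncomputable section

abbrev E2 : Type := EuclideanSpace ℝ (Fin 2)

def IsLipschitzDomain (Ω : Set E2) : Prop :=
  IsOpen Ω ∧ IsConnected Ω ∧ Bornology.IsBounded Ω ∧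
    ∀ p ∈ frontier Ω, ∃ (e : E2 ≃ₗᵢ[ℝ] E2) (K : ℝ≥0) (φ : ℝ → ℝ) (U : Set E2),
      LipschitzWith K φ ∧ IsOpen U ∧ p ∈ U ∧
      ∀ x ∈ U, (x ∈ Ω ↔ φ (e x 0) < e x 1)

def dirEnergy (Ω : Set E2) (f : E2 → ℝ) : ℝ≥0∞ :=
  ∫⁻ x in Ω, (‖fderiv ℝ f x‖₊ : ℝ≥0∞) ^ 2

def bdryInt (Γ : Set E2) (ρ f : E2 → ℝ) : ℝ≥0∞ :=
  ∫⁻ x in Γ, ENNReal.ofReal (ρ x * (f x) ^ 2) ∂μH[1]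

def rayleigh (Ω Γ : Set E2) (ρ f : E2 → ℝ) : ℝ≥0∞ :=
  dirEnergy Ω f / bdryInt Γ ρ f

def steklovMixed (Ω ΓS ΓD : Set E2) (ρ : E2 → ℝ) (k : ℕ) : ℝ≥0∞ :=
  ⨅ (V : Submodule ℝ (E2 → ℝ))
    (_ : Module.finrank ℝ V = k + 1)
    (_ : ∀ f ∈ V, ContDiff ℝ (⊤ : ℕ∞) f)
    (_ : ∀ f ∈ V, ∀ᶠ x in nhdsSet ΓD, f x = 0)
    (_ : ∀ f ∈ V, Set.EqOn f 0 (closure Ω) → f = 0),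
    ⨆ f ∈ V, ⨆ (_ : ¬ Set.EqOn f 0 (closure Ω)), rayleigh Ω ΓS ρ f

def steklovN (Ω ΓS : Set E2) (k : ℕ) : ℝ≥0∞ :=
  steklovMixed Ω ΓS ∅ (fun _ => 1) k

def steklovD (Ω ΓS ΓD : Set E2) (k : ℕ) : ℝ≥0∞ :=
  steklovMixed Ω ΓS ΓD (fun _ => 1) k

def steklovW (Ω : Set E2) (ρ : E2 → ℝ) (k : ℕ) : ℝ≥0∞ :=
  steklovMixed Ω (frontier Ω) ∅ ρ k

def steklov (Ω : Set E2) (k : ℕ) : ℝ≥0∞ := steklovW Ω (fun _ => 1) k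

def IsArc (A : Set E2) : Prop :=
  ∃ γ : ℝ → E2, ContinuousOn γ (Icc 0 1) ∧ InjOn γ (Icc 0 1) ∧ A = γ '' Icc 0 1

def IsLoop (A : Set E2) : Prop :=
  ∃ γ : ℝ → E2, ContinuousOn γ (Icc 0 1) ∧ InjOn γ (Ico 0 1) ∧ γ 0 = γ 1 ∧ A = γ '' Icc 0 1

def IsBoundaryPart (Γ : Set E2) : Prop :=
  ∃ F : Finset (Set E2), (∀ A ∈ F, IsArc A ∨ IsLoop A) ∧ Γ = ⋃₀ ↑F

structure SteklovDecomp (Ω ΓS Γstar : Set E2) : Prop where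
  partS : IsBoundaryPart ΓS
  partStar : IsBoundaryPart Γstar
  union_eq : ΓS ∪ Γstar = frontier Ω
  inter_finite : (ΓS ∩ Γstar).Finite
  nonemptyS : ΓS.Nonempty

/-- Rotation of the plane by angle θ about the origin. -/
def rotBy (θ : ℝ) : E2 → E2 := fun x =>
  (WithLp.equiv 2 (Fin 2 → ℝ)).symm
    ![Real.cos θ * x 0 - Real.sin θ * x 1, Real.sin θ * x 0 + Real.cos θ * x 1]

/-- The reflection τ(x,y) = (x,−y). -/
def reflX : E2 → E2 := fun x => (WithLp.equiv 2 (Fin 2 → ℝ)).symm ![x 0, -(x 1)]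

/-- The class 𝔇_p of half-domains Ω = Ω̃ ∩ {y > 0}, encoded by the ambient domain Ω̃:
Ω̃ is a simply connected bounded Lipschitz planar domain invariant under rotation by
2π/p about the origin and under the reflection (x,y) ↦ (x,−y), and Ω̃ ∩ {y = 0} is an
open interval symmetric about the origin. -/
def MemFrakDp (p : ℕ) (Ωt : Set E2) : Prop :=
  IsLipschitzDomain Ωt ∧ SimplyConnectedSpace Ωt ∧
  rotBy (2 * Real.pi / p) '' Ωt = Ωt ∧ reflX '' Ωt = Ωt ∧
  ∃ r : ℝ, 0 < r ∧ Ωt ∩ {x : E2 | x 1 = 0} = {x : E2 | x 1 = 0 ∧ -r < x 0 ∧ x 0 < r}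

/-- 𝔖_k^p: the supremum over Ω ∈ 𝔇_p of σ_k^N(Ω)·L(∂_SΩ), where Ω = Ω̃ ∩ {y>0},
∂_SΩ = ∂Ω̃ ∩ {y>0} and Neumann conditions are imposed on the diameter. -/
def SfrakP (p k : ℕ) : ℝ≥0∞ :=
  ⨆ (Ωt : Set E2) (_ : MemFrakDp p Ωt),
    steklovN (Ωt ∩ {x : E2 | 0 < x 1}) (frontier Ωt ∩ {x : E2 | 0 < x 1}) k
      * μH[1] (frontier Ωt ∩ {x : E2 | 0 < x 1})

def upperHalfDisk : Set E2 := {x : E2 | x 0 ^ 2 + x 1 ^ 2 < 1 ∧ 0 < x 1}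

def upperSemicircle : Set E2 := {x : E2 | x 0 ^ 2 + x 1 ^ 2 = 1 ∧ 0 ≤ x 1}

/-! ### The Riemann mapping theorem for bounded simply connected domains -/

/-- Pointwise convergence of a uniformly bounded family of holomorphic functions is locally
uniform. -/
theorem tendstoLocallyUniformlyOn_of_bounded {U : Set ℂ} (hU : IsOpen U) {l : Filter ℕ} [l.NeBot]
    {F : ℕ → ℂ → ℂ} {f : ℂ → ℂ} (hd : ∀ n, DifferentiableOn ℂ (F n) U)
    (hb : ∀ n, ∀ z ∈ U, ‖F n z‖ ≤ 1) (hp : ∀ z ∈ U, Tendsto (fun n => F n z) l (𝓝 (f z))) :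
    TendstoLocallyUniformlyOn F f l U := by
  rw [Metric.tendstoLocallyUniformlyOn_iff]
  intro ε hε x hx
  obtain ⟨R, hR, hRU⟩ := Metric.isOpen_iff.1 hU x hx
  have key : ∀ n, ∀ y ∈ ball x R, dist (F n y) (F n x) ≤ 2 / R * dist y x := by
    intro n y hy
    refine Complex.dist_le_div_mul_dist_of_mapsTo_ball ((hd n).mono hRU) ?_ hy
    intro z hz
    rw [mem_closedBall, dist_eq_norm]
    calc ‖F n z - F n x‖ ≤ ‖F n z‖ + ‖F n x‖ := norm_sub_le _ _
      _ ≤ 1 + 1 := add_le_add (hb n z (hRU hz)) (hb n x hx)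
      _ = 2 := by norm_num
  have keyf : ∀ y ∈ ball x R, dist (f y) (f x) ≤ 2 / R * dist y x := fun y hy =>
    le_of_tendsto ((hp y (hRU hy)).dist (hp x hx)) (Eventually.of_forall fun n => key n y hy)
  set r := min R (ε * R / 8) with hr
  have hr0 : 0 < r := lt_min hR (by positivity)
  refine ⟨ball x r, mem_nhdsWithin_of_mem_nhds (ball_mem_nhds x hr0), ?_⟩
  have h1 : ∀ᶠ n in l, dist (F n x) (f x) < ε / 4 :=
    (Metric.tendsto_nhds.1 (hp x hx)) (ε / 4) (by positivity)
  filter_upwards [h1] with n hn y hy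
  have hyR : y ∈ ball x R := ball_subset_ball (min_le_left _ _) hy
  have hb2 : 2 / R * dist y x ≤ ε / 4 := by
    have : dist y x ≤ ε * R / 8 := (le_of_lt hy).trans (min_le_right _ _)
    calc 2 / R * dist y x ≤ 2 / R * (ε * R / 8) := by gcongr
      _ = ε / 4 := by field_simp; norm_num
  have t1 := key n y hyR
  have t2 := keyf y hyR
  have := dist_triangle4 (f y) (f x) (F n x) (F n y)
  rw [dist_comm (f x), dist_comm (F n x) (F n y)] at this
  linarith

/-- Values of a nonconstant locally uniform limit are eventually attained nearby
(Hurwitz's theorem). -/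
theorem eventually_exists_eq_of_tendstoLocallyUniformlyOn {U : Set ℂ} (hU : IsOpen U)
    (hUc : IsPreconnected U) {l : Filter ℕ} [l.NeBot] {F : ℕ → ℂ → ℂ} {f : ℂ → ℂ}
    (hd : ∀ n, DifferentiableOn ℂ (F n) U) (hl : TendstoLocallyUniformlyOn F f l U)
    {a b : ℂ} (ha : a ∈ U) (hb : b ∈ U) (hne : f b ≠ f a) {r : ℝ} (hr : 0 < r) :
    ∃ ε > 0, ∀ᶠ n in l, ∀ c, dist c (f a) < ε → ∃ z ∈ U, dist z a < r ∧ F n z = c := by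
  have hfd : DifferentiableOn ℂ f U := hl.differentiableOn (Eventually.of_forall hd) hU
  have hfa : AnalyticOnNhd ℂ f U := hfd.analyticOnNhd hU
  have hev : ∀ᶠ z in 𝓝[≠] a, f z ≠ f a := by
    rcases (hfa a ha).eventually_eq_or_eventually_ne (analyticAt_const (v := f a)) with h | h
    · exact absurd (hfa.eqOn_of_preconnected_of_eventuallyEq (analyticOnNhd_const) hUc ha h hb) hne
    · exact h
  rw [eventually_nhdsWithin_iff, Metric.eventually_nhds_iff] at hev
  obtain ⟨r1, hr1, hev⟩ := hev
  obtain ⟨R, hR, hRU⟩ := Metric.isOpen_iff.1 hU a ha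
  set s := min r (min r1 R) / 2 with hs
  have hs0 : 0 < s := by positivity
  have hsr : s < r := by have := min_le_left r (min r1 R); linarith [hs, half_lt_self (show 0 < min r (min r1 R) by positivity)]
  have hm : min r (min r1 R) ≤ min r1 R := min_le_right _ _
  have hsm : s < min r (min r1 R) := half_lt_self (by positivity)
  have hsr1 : s < r1 := hsm.trans_le (hm.trans (min_le_left _ _))
  have hsR : s < R := hsm.trans_le (hm.trans (min_le_right _ _))
  have hsub : closedBall a s ⊆ U := (closedBall_subset_ball hsR).trans hRU
  have hcont : ContinuousOn (fun z => ‖f z - f a‖) (sphere a s) :=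
    ((hfd.continuousOn.mono (sphere_subset_closedBall.trans hsub)).sub continuousOn_const).norm
  obtain ⟨z0, hz0, hmin⟩ := (isCompact_sphere a s).exists_isMinOn
    (NormedSpace.sphere_nonempty.2 hs0.le) hcont
  set m := ‖f z0 - f a‖ with hmdef
  have hm0 : 0 < m := by
    rw [hmdef, norm_pos_iff, sub_ne_zero]
    refine hev ?_ ?_
    · rw [mem_sphere.1 hz0]; exact hsr1
    · rintro rfl; simp at hz0; linarith
  have hmm : ∀ z ∈ sphere a s, m ≤ ‖f z - f a‖ := fun z hz => hmin hz
  have hunif : TendstoUniformlyOn F f l (closedBall a s) :=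
    (tendstoLocallyUniformlyOn_iff_forall_isCompact hU).1 hl _ hsub (isCompact_closedBall a s)
  have := (Metric.tendstoUniformlyOn_iff.1 hunif) (m / 16) (by positivity)
  refine ⟨m / 16, by positivity, ?_⟩
  filter_upwards [this] with n hn c hc
  have hna := hn a (mem_closedBall_self hs0.le)
  have hsph : ∀ z ∈ sphere a s, m / 2 ≤ ‖F n z - F n a‖ := by
    intro z hz
    have h1 := hn z (sphere_subset_closedBall hz)
    have h2 := hmm z hz
    rw [← dist_eq_norm] at h2 ⊢
    have h3 := dist_triangle4 (f z) (F n z) (F n a) (f a)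
    rw [dist_comm (F n a) (f a)] at h3
    linarith
  have hfr : ∃ᶠ z in 𝓝 a, F n z ≠ F n a := by
    by_contra hcon
    rw [not_frequently] at hcon
    simp only [not_not] at hcon
    have hF := ((hd n).analyticOnNhd hU)
    have heq := hF.mono hsub |>.eqOn_of_preconnected_of_eventuallyEq
      (analyticOnNhd_const (v := F n a)) (convex_closedBall a s).isPreconnected
      (mem_closedBall_self hs0.le) hcon
    have h1 := hsph z0 hz0
    rw [heq (sphere_subset_closedBall hz0)] at h1
    simp at h1
    linarith
  have himg := DiffContOnCl.ball_subset_image_closedBall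
    (f := F n) (((hd n).mono hsub).diffContOnCl_ball subset_rfl) hs0 hsph hfr
  have hcm : c ∈ ball (F n a) (m / 2 / 2) := by
    rw [mem_ball]
    have := dist_triangle c (f a) (F n a)
    linarith
  obtain ⟨z, hz, hzc⟩ := himg hcm
  exact ⟨z, hsub hz, (mem_closedBall.1 hz).trans_lt hsr, hzc⟩

/-- Admissible functions in the extremal problem of the Riemann mapping theorem. -/
def IsUnivalentInto (U : Set ℂ) (f : ℂ → ℂ) : Prop :=
  DifferentiableOn ℂ f U ∧ InjOn f U ∧ (∀ z ∈ U, deriv f z ≠ 0) ∧ MapsTo f U (ball 0 1) ∧ f 0 = 0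

theorem isUnivalentInto_mobius {w : ℂ} (hw : ‖w‖ < 1) :
    (∀ z ∈ ball (0 : ℂ) 1, HasDerivAt (fun z => (z - w) / (1 - (starRingEnd ℂ) w * z))
      ((1 - (starRingEnd ℂ) w * w) / (1 - (starRingEnd ℂ) w * z) ^ 2) z) ∧
    (∀ z ∈ ball (0 : ℂ) 1, 1 - (starRingEnd ℂ) w * z ≠ 0) ∧
    InjOn (fun z => (z - w) / (1 - (starRingEnd ℂ) w * z)) (ball 0 1) ∧
    MapsTo (fun z => (z - w) / (1 - (starRingEnd ℂ) w * z)) (ball 0 1) (ball 0 1) ∧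
    1 - (starRingEnd ℂ) w * w ≠ 0 := by
  have hne : ∀ z ∈ ball (0 : ℂ) 1, 1 - (starRingEnd ℂ) w * z ≠ 0 := by
    intro z hz h
    have h1 : (starRingEnd ℂ) w * z = 1 := by linear_combination -h
    have h2 : ‖w‖ * ‖z‖ = 1 := by
      have := congrArg norm h1
      simpa using this
    have hz' : ‖z‖ < 1 := by simpa using hz
    nlinarith [norm_nonneg w, norm_nonneg z]
  have hww : 1 - (starRingEnd ℂ) w * w ≠ 0 := hne w (by simpa using hw)
  refine ⟨?_, hne, ?_, ?_, hww⟩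
  · intro z hz
    have hd := (((hasDerivAt_id z).sub_const w).div
      (((hasDerivAt_id z).const_mul ((starRingEnd ℂ) w)).const_sub 1) (hne z hz))
    refine hd.congr_deriv ?_
    simp only [id]
    congr 1
    ring
  · intro x hx y hy hxy
    have h1 := hne x hx
    have h2 := hne y hy
    simp only at hxy
    rw [div_eq_div_iff h1 h2] at hxy
    have : (1 - (starRingEnd ℂ) w * w) * (x - y) = 0 := by linear_combination hxy
    rcases mul_eq_zero.1 this with h | h
    · exact absurd h hww
    · exact sub_eq_zero.1 h
  · intro z hz
    have h1 := hne z hz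
    have hz' : ‖z‖ < 1 := by simpa using hz
    rw [mem_ball_zero_iff, norm_div, div_lt_one (norm_pos_iff.2 h1)]
    rw [← sq_lt_sq₀ (norm_nonneg _) (norm_nonneg _), Complex.sq_norm, Complex.sq_norm]
    have e : Complex.normSq (1 - (starRingEnd ℂ) w * z) - Complex.normSq (z - w)
        = (1 - Complex.normSq w) * (1 - Complex.normSq z) := by
      simp [Complex.normSq_apply]; ring
    have a1 : Complex.normSq w < 1 := by rw [← Complex.sq_norm]; nlinarith [norm_nonneg w]
    have a2 : Complex.normSq z < 1 := by rw [← Complex.sq_norm]; nlinarith [norm_nonneg z]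
    nlinarith

/-- Koebe's square root construction: a non-surjective admissible map is not extremal. -/
theorem IsUnivalentInto.exists_larger {U : Set ℂ} (hU : IsOpen U) (hs : IsSimplyConnected U)
    (h0 : (0 : ℂ) ∈ U) {f : ℂ → ℂ} (hf : IsUnivalentInto U f) {w : ℂ} (hw : ‖w‖ < 1)
    (hwf : w ∉ f '' U) : ∃ g, IsUnivalentInto U g ∧ ‖deriv f 0‖ < ‖deriv g 0‖ := by
  obtain ⟨hfd, hfi, hf', hfm, hf0⟩ := hf
  obtain ⟨hψd, hψne, hψi, hψm, hww⟩ := isUnivalentInto_mobius hw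
  set ψ : ℂ → ℂ := fun z => (z - w) / (1 - (starRingEnd ℂ) w * z) with hψ
  have hw0 : w ≠ 0 := by rintro rfl; exact hwf ⟨0, h0, hf0⟩
  have hcd : ∀ z ∈ U, HasDerivAt (ψ ∘ f)
      ((1 - (starRingEnd ℂ) w * w) / (1 - (starRingEnd ℂ) w * f z) ^ 2 * deriv f z) z := by
    intro z hz
    exact (hψd (f z) (hfm hz)).comp z (hfd.differentiableAt (hU.mem_nhds hz)).hasDerivAt
  have hc : ContinuousOn (ψ ∘ f) U := fun z hz => (hcd z hz).continuousAt.continuousWithinAt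
  have hc0 : (0 : ℂ) ∉ (ψ ∘ f) '' U := by
    rintro ⟨z, hz, h⟩
    simp only [Function.comp, hψ, div_eq_zero_iff] at h
    rcases h with h | h
    · exact hwf ⟨z, hz, sub_eq_zero.1 h⟩
    · exact hψne _ (hfm hz) h
  obtain ⟨g, hgc, hg2⟩ := Complex.exists_continuousOn_pow_eq hs hU hc hc0 two_ne_zero
  have hgne : ∀ z ∈ U, g z ≠ 0 := by
    intro z hz h
    apply hc0
    refine ⟨z, hz, ?_⟩
    rw [← hg2 z, h]; norm_num
  have hgd : ∀ z ∈ U, HasDerivAt g ((2 * g z)⁻¹ *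
      ((1 - (starRingEnd ℂ) w * w) / (1 - (starRingEnd ℂ) w * f z) ^ 2 * deriv f z)) z := by
    intro z hz
    have h2 : (2 * g z) ≠ 0 := mul_ne_zero two_ne_zero (hgne z hz)
    have hga : ContinuousAt g z := hgc.continuousAt (hU.mem_nhds hz)
    have hsq : HasStrictDerivAt (fun x : ℂ => x ^ 2) (2 * g z) (g z) := by
      simpa using hasStrictDerivAt_pow 2 (g z)
    have hloc := hsq.to_localInverse h2
    have hli := (hsq.hasStrictFDerivAt_equiv h2).eventually_left_inverse
    have hev : ∀ᶠ x in 𝓝 z, g x = (hsq.localInverse _ _ _ h2) (g x ^ 2) := by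
      have := hga.eventually hli
      filter_upwards [this] with x hx
      exact hx.symm
    have hcomp : HasDerivAt (fun x => (hsq.localInverse _ _ _ h2) ((ψ ∘ f) x)) ((2 * g z)⁻¹ *
      ((1 - (starRingEnd ℂ) w * w) / (1 - (starRingEnd ℂ) w * f z) ^ 2 * deriv f z)) z := by
      have hl := hloc.hasDerivAt
      simp only [hg2] at hl
      exact hl.comp z (hcd z hz)
    refine hcomp.congr_of_eventuallyEq ?_
    filter_upwards [hev] with x hx
    rw [hx, hg2]
  have hg0 : ∀ z ∈ U, ‖g z‖ < 1 := by
    intro z hz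
    have h1 : ‖(ψ ∘ f) z‖ < 1 := by simpa using hψm (hfm hz)
    rw [← hg2 z, norm_pow] at h1
    by_contra hcon
    push Not at hcon
    nlinarith
  obtain ⟨hχd, hχne, hχi, hχm, hvv⟩ := isUnivalentInto_mobius (hg0 0 h0)
  set v := g 0 with hv
  set χ : ℂ → ℂ := fun z => (z - v) / (1 - (starRingEnd ℂ) v * z) with hχ
  have hgm : ∀ z ∈ U, g z ∈ ball (0 : ℂ) 1 := fun z hz => by simpa using hg0 z hz
  have hfin : ∀ z ∈ U, HasDerivAt (χ ∘ g) ((1 - (starRingEnd ℂ) v * v) /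
      (1 - (starRingEnd ℂ) v * g z) ^ 2 * ((2 * g z)⁻¹ *
      ((1 - (starRingEnd ℂ) w * w) / (1 - (starRingEnd ℂ) w * f z) ^ 2 * deriv f z))) z :=
    fun z hz => (hχd _ (hgm z hz)).comp z (hgd z hz)
  refine ⟨χ ∘ g, ⟨fun z hz => (hfin z hz).differentiableAt.differentiableWithinAt, ?_, ?_, ?_, ?_⟩, ?_⟩
  · intro x hx y hy hxy
    have h1 := hχi (hgm x hx) (hgm y hy) hxy
    refine hfi hx hy (hψi (hfm hx) (hfm hy) ?_)
    have := congrArg (· ^ 2) h1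
    simpa [hg2] using this
  · intro z hz
    rw [(hfin z hz).deriv]
    have a1 := hχne _ (hgm z hz)
    have a2 := hψne _ (hfm hz)
    have a3 := hgne z hz
    have a4 := hf' z hz
    exact mul_ne_zero (div_ne_zero hvv (pow_ne_zero 2 a1)) (mul_ne_zero
      (inv_ne_zero (mul_ne_zero two_ne_zero a3))
      (mul_ne_zero (div_ne_zero hww (pow_ne_zero 2 a2)) a4))
  · exact fun z hz => hχm (hgm z hz)
  · simp [hχ, hv]
  · rw [(hfin 0 h0).deriv, hf0, ← hv]
    have hv2 : ‖v‖ ^ 2 = ‖w‖ := by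
      have := hg2 0
      simp only [Function.comp, hf0, hψ] at this
      rw [← norm_pow, hv, this]; simp
    have hv0 : 0 < ‖v‖ := norm_pos_iff.2 (hgne 0 h0)
    have hv1 : ‖v‖ < 1 := hg0 0 h0
    have e1 : ∀ u : ℂ, 1 - (starRingEnd ℂ) u * u = ((1 - ‖u‖ ^ 2 : ℝ) : ℂ) := by
      intro u
      rw [Complex.sq_norm, mul_comm, Complex.mul_conj]; push_cast; ring
    have e2 : ∀ u : ℂ, ‖u‖ < 1 → ‖1 - (starRingEnd ℂ) u * u‖ = 1 - ‖u‖ ^ 2 := by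
      intro u hu
      rw [e1, Complex.norm_real, Real.norm_of_nonneg]
      nlinarith [norm_nonneg u]
    have hD : 0 < ‖deriv f 0‖ := norm_pos_iff.2 (hf' 0 h0)
    simp only [norm_mul, norm_div, norm_pow, norm_inv, e2 v hv1, e2 w hw, mul_zero, sub_zero,
      norm_one, Complex.norm_ofNat]
    rw [← hv2]
    have hpos : 0 < 1 - ‖v‖ ^ 2 := by nlinarith
    have : (1 - ‖v‖ ^ 2) / (1 - ‖v‖ ^ 2) ^ 2 * ((2 * ‖v‖)⁻¹ * ((1 - (‖v‖ ^ 2) ^ 2) / 1 ^ 2 * ‖deriv f 0‖))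
        = (1 + ‖v‖ ^ 2) / (2 * ‖v‖) * ‖deriv f 0‖ := by
      field_simp
      ring
    rw [this]
    have hgt : 1 < (1 + ‖v‖ ^ 2) / (2 * ‖v‖) := by
      rw [one_lt_div (by positivity)]
      nlinarith [sq_nonneg (1 - ‖v‖), mul_pos (sub_pos.2 hv1) (sub_pos.2 hv1)]
    nlinarith

theorem exists_extremal_isUnivalentInto {U : Set ℂ} (hU : IsOpen U) (hUc : IsPreconnected U)
    (hb : Bornology.IsBounded U) (h0 : (0 : ℂ) ∈ U) :
    ∃ f, IsUnivalentInto U f ∧ ∀ g, IsUnivalentInto U g → ‖deriv g 0‖ ≤ ‖deriv f 0‖ := by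
  obtain ⟨R, hR, hRU⟩ := Metric.isOpen_iff.1 hU 0 h0
  set S : Set ℝ := {x | ∃ g, IsUnivalentInto U g ∧ ‖deriv g 0‖ = x} with hS
  have hbd : BddAbove S := by
    refine ⟨1 / R, ?_⟩
    rintro _ ⟨g, hg, rfl⟩
    refine Complex.norm_deriv_le_div_of_mapsTo_ball (hg.1.mono hRU) ?_ hR
    rw [hg.2.2.2.2]
    exact (hg.2.2.2.1.mono_left hRU).mono_right ball_subset_closedBall
  obtain ⟨B, hB0, hB⟩ := hb.exists_pos_norm_lt
  have hlin : IsUnivalentInto U (fun z => ((B⁻¹ : ℝ) : ℂ) * z) := by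
    have hd : ∀ z : ℂ, HasDerivAt (fun z => ((B⁻¹ : ℝ) : ℂ) * z) ((B⁻¹ : ℝ) : ℂ) z := fun z => by
      simpa using (hasDerivAt_id z).const_mul ((B⁻¹ : ℝ) : ℂ)
    have hBne : ((B⁻¹ : ℝ) : ℂ) ≠ 0 := by
      rw [Complex.ofReal_ne_zero]; positivity
    refine ⟨fun z _ => (hd z).differentiableAt.differentiableWithinAt, ?_, ?_, ?_, by simp⟩
    · intro x _ y _ h
      exact mul_left_cancel₀ hBne h
    · intro z _
      rw [(hd z).deriv]; exact hBne
    · intro z hz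
      rw [mem_ball_zero_iff, norm_mul, Complex.norm_real, Real.norm_of_nonneg (by positivity),
        inv_mul_lt_iff₀ hB0, mul_one]
      exact hB z hz
  have hpos : ∃ x ∈ S, 0 < x :=
    ⟨_, ⟨_, hlin, rfl⟩, norm_pos_iff.2 (hlin.2.2.1 0 h0)⟩
  have hne : S.Nonempty := by obtain ⟨x, hx, _⟩ := hpos; exact ⟨x, hx⟩
  obtain ⟨u, -, hu, huS⟩ := exists_seq_tendsto_sSup hne hbd
  choose F hF hFu using huS
  set l : Ultrafilter ℕ := Filter.hyperfilter ℕ with hl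
  have hlle : (l : Filter ℕ) ≤ atTop := by
    have := Filter.hyperfilter_le_cofinite (α := ℕ)
    rwa [Nat.cofinite_eq_atTop] at this
  have hFb : ∀ n, ∀ z ∈ U, ‖F n z‖ ≤ 1 := fun n z hz => by
    have := (hF n).2.2.2.1 hz
    rw [mem_ball_zero_iff] at this
    exact this.le
  have hlim : ∀ z : ℂ, ∃ y : ℂ, z ∈ U → Tendsto (fun n => F n z) l (𝓝 y) := by
    intro z
    by_cases hz : z ∈ U
    · have hc : IsCompact (closedBall (0 : ℂ) 1) := isCompact_closedBall 0 1
      obtain ⟨y, -, hy⟩ := hc.ultrafilter_le_nhds (l.map fun n => F n z) (by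
        rw [le_principal_iff]
        exact Filter.mem_map.2 (Filter.univ_mem' fun n => by
          simpa using hFb n z hz))
      exact ⟨y, fun _ => hy⟩
    · exact ⟨0, fun h => absurd h hz⟩
  choose f hf using hlim
  have hFd : ∀ n, DifferentiableOn ℂ (F n) U := fun n => (hF n).1
  have htl : TendstoLocallyUniformlyOn F f (l : Filter ℕ) U :=
    tendstoLocallyUniformlyOn_of_bounded hU hFd hFb fun z hz => hf z hz
  have hfd : DifferentiableOn ℂ f U := htl.differentiableOn (Eventually.of_forall hFd) hU
  have hder : TendstoLocallyUniformlyOn (deriv ∘ F) (deriv f) (l : Filter ℕ) U :=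
    htl.deriv (Eventually.of_forall hFd) hU
  have hder0 : ‖deriv f 0‖ = sSup S := by
    have h1 : Tendsto (fun n => ‖(deriv ∘ F) n 0‖) l (𝓝 ‖deriv f 0‖) :=
      (hder.tendsto_at h0).norm
    have h2 : Tendsto (fun n => ‖(deriv ∘ F) n 0‖) l (𝓝 (sSup S)) := by
      simp only [Function.comp, hFu]
      exact hu.mono_left hlle
    exact tendsto_nhds_unique h1 h2
  have hder_pos : 0 < ‖deriv f 0‖ := by
    obtain ⟨x, hx, hx0⟩ := hpos
    rw [hder0]
    exact hx0.trans_le (le_csSup hbd hx)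
  have hf00 : f 0 = 0 := by
    have h1 := hf 0 h0
    simp only [(hF _).2.2.2.2] at h1
    exact tendsto_nhds_unique h1 tendsto_const_nhds
  have hfa : AnalyticOnNhd ℂ f U := hfd.analyticOnNhd hU
  have hnc : ∃ b ∈ U, f b ≠ f 0 := by
    by_contra hcon
    push Not at hcon
    have : f =ᶠ[𝓝 0] fun _ => f 0 := by
      filter_upwards [hU.mem_nhds h0] with z hz using hcon z hz
    rw [this.deriv_eq] at hder_pos
    simp at hder_pos
  have hnc' : ∀ a ∈ U, ∃ b ∈ U, f b ≠ f a := by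
    intro a _
    obtain ⟨b, hb, hbne⟩ := hnc
    by_cases h : f 0 = f a
    · exact ⟨b, hb, h ▸ hbne⟩
    · exact ⟨0, h0, h⟩
  refine ⟨f, ⟨hfd, ?_, ?_, ?_, hf00⟩, ?_⟩
  · intro a ha b hb hab
    by_contra hne
    have hr : 0 < dist a b / 2 := by have := dist_pos.2 hne; linarith
    obtain ⟨a', ha', hane⟩ := hnc' a ha
    obtain ⟨b', hb', hbne⟩ := hnc' b hb
    obtain ⟨ε, hε, h1⟩ := eventually_exists_eq_of_tendstoLocallyUniformlyOn hU hUc hFd htl ha ha'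
      hane hr
    obtain ⟨ε', hε', h2⟩ := eventually_exists_eq_of_tendstoLocallyUniformlyOn hU hUc hFd htl hb hb'
      hbne hr
    obtain ⟨n, hn1, hn2⟩ := (h1.and h2).exists
    obtain ⟨x, hx, hxa, hxc⟩ := hn1 (f a) (by simpa using hε)
    obtain ⟨y, hy, hyb, hyc⟩ := hn2 (f a) (by simpa [hab] using hε')
    have hxy : x = y := (hF n).2.1 hx hy (hxc.trans hyc.symm)
    subst hxy
    have := dist_triangle_left a b x
    linarith
  · intro z hz hz0
    have hd2 : ∀ n, DifferentiableOn ℂ ((deriv ∘ F) n) U := fun n => (hFd n).deriv hU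
    obtain ⟨ε, hε, h1⟩ := eventually_exists_eq_of_tendstoLocallyUniformlyOn hU hUc hd2 hder hz h0
      (by rw [hz0]; exact norm_pos_iff.1 hder_pos) one_pos
    obtain ⟨n, hn⟩ := h1.exists
    obtain ⟨x, hx, -, hxc⟩ := hn 0 (by simpa [hz0] using hε)
    exact (hF n).2.2.1 x hx hxc
  · intro z hz
    have hle : ∀ z ∈ U, ‖f z‖ ≤ 1 := fun z hz =>
      le_of_tendsto (hf z hz).norm (Eventually.of_forall fun n => hFb n z hz)
    rw [mem_ball_zero_iff]
    refine lt_of_le_of_ne (hle z hz) fun heq => ?_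
    have hmax : IsMaxOn (norm ∘ f) U z := fun y hy => by
      simpa [heq] using hle y hy
    have := Complex.norm_eqOn_of_isPreconnected_of_isMaxOn hUc hU hfd hz hmax h0
    simp [hf00, heq] at this
  · intro g hg
    rw [hder0]
    exact le_csSup hbd ⟨g, hg, rfl⟩

/-- The **Riemann mapping theorem** for bounded simply connected open sets. -/
theorem exists_riemannMap {U : Set ℂ} (hU : IsOpen U) (hs : IsSimplyConnected U)
    (hb : Bornology.IsBounded U) (h0 : (0 : ℂ) ∈ U) :
    ∃ f, IsUnivalentInto U f ∧ f '' U = ball 0 1 := by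
  obtain ⟨f, hf, hmax⟩ := exists_extremal_isUnivalentInto hU
    hs.isPathConnected.isConnected.isPreconnected hb h0
  refine ⟨f, hf, Subset.antisymm hf.2.2.2.1.image_subset ?_⟩
  intro w hw
  by_contra hcon
  obtain ⟨g, hg, hlt⟩ := hf.exists_larger hU hs h0 (by simpa using hw) hcon
  exact absurd (hmax g hg) (not_le.2 hlt)

theorem IsUnivalentInto.hasDerivAt_invFunOn {U : Set ℂ} (hU : IsOpen U) {f : ℂ → ℂ}
    (hf : IsUnivalentInto U f) (hsurj : f '' U = ball 0 1) {w : ℂ} (hw : w ∈ ball (0 : ℂ) 1) :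
    HasDerivAt (Function.invFunOn f U) (deriv f (Function.invFunOn f U w))⁻¹ w := by
  set g := Function.invFunOn f U with hg
  have hgU : ∀ w ∈ ball (0 : ℂ) 1, g w ∈ U := fun w hw =>
    Function.invFunOn_mem (by rw [← hsurj] at hw; exact hw)
  have hfg : ∀ w ∈ ball (0 : ℂ) 1, f (g w) = w := fun w hw =>
    Function.invFunOn_eq (by rw [← hsurj] at hw; exact hw)
  have hgf : ∀ z ∈ U, g (f z) = z := fun z hz => hf.2.1.leftInvOn_invFunOn hz
  have hz := hgU w hw
  have hst : HasStrictDerivAt f (deriv f (g w)) (g w) :=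
    ((hf.1.analyticOnNhd hU) _ hz).hasStrictDerivAt
  have hne := hf.2.2.1 _ hz
  have h1 := hst.to_localInverse hne
  rw [hfg w hw] at h1
  refine h1.hasDerivAt.congr_of_eventuallyEq ?_
  have hli : ∀ᶠ x in 𝓝 (f (g w)), f (hst.localInverse f _ _ hne x) = x :=
    (hst.hasStrictFDerivAt_equiv hne).eventually_right_inverse
  have hlc : Tendsto (hst.localInverse f _ _ hne) (𝓝 w) (𝓝 (g w)) := by
    have := h1.hasDerivAt.continuousAt.tendsto
    have e : hst.localInverse f _ _ hne w = g w := by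
      have := (hst.hasStrictFDerivAt_equiv hne).localInverse_apply_image
      rw [hfg w hw] at this
      exact this
    rwa [e] at this
  rw [hfg w hw] at hli
  filter_upwards [hli, hlc.eventually (hU.mem_nhds hz)] with x hx1 hx2
  rw [← hgf _ hx2, hx1]

/-- A holomorphic self-map competing with a Riemann map and having the same derivative at the
origin equals it. -/
theorem IsUnivalentInto.eqOn_of_deriv_eq {U : Set ℂ} (hU : IsOpen U) (h0 : (0 : ℂ) ∈ U)
    {f : ℂ → ℂ} (hf : IsUnivalentInto U f) (hsurj : f '' U = ball 0 1) {h : ℂ → ℂ}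
    (hd : DifferentiableOn ℂ h U) (hm : MapsTo h U (ball 0 1)) (hh0 : h 0 = 0)
    (hder : deriv h 0 = deriv f 0) : EqOn h f U := by
  set g := Function.invFunOn f U with hg
  have hgU : ∀ w ∈ ball (0 : ℂ) 1, g w ∈ U := fun w hw =>
    Function.invFunOn_mem (by rw [← hsurj] at hw; exact hw)
  have hgf : ∀ z ∈ U, g (f z) = z := fun z hz => hf.2.1.leftInvOn_invFunOn hz
  have hg0 : g 0 = 0 := by have := hgf 0 h0; rwa [hf.2.2.2.2] at this
  have hgd : ∀ w ∈ ball (0 : ℂ) 1, HasDerivAt g (deriv f (g w))⁻¹ w := fun w hw =>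
    hf.hasDerivAt_invFunOn hU hsurj hw
  have hcd : ∀ w ∈ ball (0 : ℂ) 1, HasDerivAt (h ∘ g) (deriv h (g w) * (deriv f (g w))⁻¹) w :=
    fun w hw => ((hd.differentiableAt (hU.mem_nhds (hgU w hw))).hasDerivAt).comp w (hgd w hw)
  have hzero : (0 : ℂ) ∈ ball (0 : ℂ) 1 := by simp
  have hc0 : (h ∘ g) 0 = 0 := by simp [hg0, hh0]
  have hslope : dslope (h ∘ g) 0 0 = 1 := by
    rw [dslope_same, (hcd 0 hzero).deriv, hg0, hder, mul_inv_cancel₀ (hf.2.2.1 0 h0)]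
  have haff := Complex.affine_of_mapsTo_ball_of_norm_dslope_eq_div (f := h ∘ g) (c := 0) (R₁ := 1)
    (R₂ := 1) (z₀ := 0) (fun w hw => (hcd w hw).differentiableAt.differentiableWithinAt)
    (by rw [hc0]; exact fun w hw => ball_subset_closedBall (hm (hgU w hw))) hzero
    (by rw [hslope]; simp)
  intro z hz
  have := haff (hf.2.2.2.1 hz)
  simp only [Function.comp, hgf z hz, hg0, hh0, hslope] at this
  simpa using this

/-- A Riemann map of a symmetric domain, chosen to be equivariant under the rotation `ω` and under
complex conjugation. -/
theorem exists_equivariant_riemannMap {U : Set ℂ} (hU : IsOpen U) (hs : IsSimplyConnected U)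
    (hb : Bornology.IsBounded U) (h0 : (0 : ℂ) ∈ U) {ω : ℂ} (hω : ‖ω‖ = 1)
    (hrot : ∀ z ∈ U, ω * z ∈ U) (hconj : ∀ z ∈ U, (starRingEnd ℂ) z ∈ U) :
    ∃ f, IsUnivalentInto U f ∧ f '' U = ball 0 1 ∧ (∀ z ∈ U, f (ω * z) = ω * f z) ∧
      ∀ z ∈ U, f ((starRingEnd ℂ) z) = (starRingEnd ℂ) (f z) := by
  obtain ⟨f₀, hf₀, hs₀⟩ := exists_riemannMap hU hs hb h0
  have hD := hf₀.2.2.1 0 h0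
  set D := deriv f₀ 0 with hDdef
  set c : ℂ := (‖D‖ : ℂ) / D with hc
  have hnD : (‖D‖ : ℂ) ≠ 0 := by simpa using hD
  have hc1 : ‖c‖ = 1 := by
    rw [hc, norm_div, Complex.norm_real, norm_norm, div_self (norm_ne_zero_iff.2 hD)]
  have hcne : c ≠ 0 := div_ne_zero hnD hD
  set f : ℂ → ℂ := fun z => c * f₀ z with hfdef
  have hfd : ∀ z ∈ U, HasDerivAt f (c * deriv f₀ z) z := fun z hz =>
    ((hf₀.1.differentiableAt (hU.mem_nhds hz)).hasDerivAt).const_mul c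
  have hder : deriv f 0 = (‖D‖ : ℂ) := by
    rw [(hfd 0 h0).deriv, ← hDdef, hc, div_mul_cancel₀ _ hD]
  have hf : IsUnivalentInto U f := by
    refine ⟨fun z hz => (hfd z hz).differentiableAt.differentiableWithinAt, ?_, ?_, ?_, ?_⟩
    · intro x hx y hy h
      exact hf₀.2.1 hx hy (mul_left_cancel₀ hcne h)
    · intro z hz
      rw [(hfd z hz).deriv]
      exact mul_ne_zero hcne (hf₀.2.2.1 z hz)
    · intro z hz
      have := hf₀.2.2.2.1 hz
      rw [mem_ball_zero_iff] at this ⊢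
      simpa [hfdef, hc1] using this
    · simp [hfdef, hf₀.2.2.2.2]
  have hsurj : f '' U = ball 0 1 := by
    refine Subset.antisymm hf.2.2.2.1.image_subset ?_
    intro w hw
    have : c⁻¹ * w ∈ ball (0 : ℂ) 1 := by
      rw [mem_ball_zero_iff] at hw ⊢
      simpa [hc1] using hw
    rw [← hs₀] at this
    obtain ⟨z, hz, hzw⟩ := this
    exact ⟨z, hz, by simp only [hfdef, hzw]; rw [mul_inv_cancel_left₀ hcne]⟩
  have hωne : ω ≠ 0 := by rintro rfl; simp at hω
  refine ⟨f, hf, hsurj, ?_, ?_⟩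
  · have hhd : ∀ z ∈ U, HasDerivAt (fun z => ω⁻¹ * f (ω * z)) (ω⁻¹ * (deriv f (ω * z) * ω)) z := by
      intro z hz
      have h1 := (hf.1.differentiableAt (hU.mem_nhds (hrot z hz))).hasDerivAt
      have h2 : HasDerivAt (fun z => ω * z) ω z := by
        simpa using (hasDerivAt_id z).const_mul ω
      exact (h1.comp z h2).const_mul _
    have key := hf.eqOn_of_deriv_eq hU h0 hsurj (h := fun z => ω⁻¹ * f (ω * z))
      (fun z hz => (hhd z hz).differentiableAt.differentiableWithinAt)
      (fun z hz => by
        have := hf.2.2.2.1 (hrot z hz)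
        rw [mem_ball_zero_iff] at this ⊢
        simpa [hω] using this)
      (by simp [hf.2.2.2.2])
      (by rw [(hhd 0 h0).deriv, mul_zero]; field_simp)
    intro z hz
    have := key hz
    simp only at this
    rw [← this, mul_inv_cancel_left₀ hωne]
  · have hhd : ∀ z ∈ U, HasDerivAt (fun z => (starRingEnd ℂ) (f ((starRingEnd ℂ) z)))
        ((starRingEnd ℂ) (deriv f ((starRingEnd ℂ) z))) z := by
      intro z hz
      have h1 := (hf.1.differentiableAt (hU.mem_nhds (hconj z hz))).hasDerivAt
      have := h1.conj_conj
      simpa [Function.comp_def] using this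
    have key := hf.eqOn_of_deriv_eq hU h0 hsurj
      (h := fun z => (starRingEnd ℂ) (f ((starRingEnd ℂ) z)))
      (fun z hz => (hhd z hz).differentiableAt.differentiableWithinAt)
      (fun z hz => by
        have := hf.2.2.2.1 (hconj z hz)
        rw [mem_ball_zero_iff] at this ⊢
        simpa using this)
      (by simp [hf.2.2.2.2])
      (by rw [(hhd 0 h0).deriv, map_zero, hder, Complex.conj_ofReal])
    intro z hz
    have := key hz
    simp only at this
    rw [← this, Complex.conj_conj]

/-- `v` points uniformly from `closure U` into `U` near `z`. -/
def GoodDir (U : Set ℂ) (z v : ℂ) : Prop :=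
  ∀ᶠ q : ℂ × ℂ × ℝ in 𝓝 z ×ˢ (𝓝 v ×ˢ 𝓝[>] (0 : ℝ)),
    q.1 ∈ closure U → q.1 + q.2.2 • q.2.1 ∈ U

theorem GoodDir.add {U : Set ℂ} {z v w : ℂ} (hv : GoodDir U z v) (hw : GoodDir U z w) :
    GoodDir U z (v + w) := by
  have h1 : Tendsto (fun q : ℂ × ℂ × ℝ => (q.1, v, q.2.2))
      (𝓝 z ×ˢ (𝓝 (v + w) ×ˢ 𝓝[>] (0 : ℝ))) (𝓝 z ×ˢ (𝓝 v ×ˢ 𝓝[>] (0 : ℝ))) :=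
    tendsto_fst.prodMk (tendsto_const_nhds.prodMk (tendsto_snd.comp tendsto_snd))
  have ht : Tendsto (fun q : ℂ × ℂ × ℝ => q.2.2)
      (𝓝 z ×ˢ (𝓝 (v + w) ×ˢ 𝓝[>] (0 : ℝ))) (𝓝 0) :=
    (tendsto_snd.comp tendsto_snd).mono_right nhdsWithin_le_nhds
  have h2 : Tendsto (fun q : ℂ × ℂ × ℝ => (q.1 + q.2.2 • v, q.2.1 - v, q.2.2))
      (𝓝 z ×ˢ (𝓝 (v + w) ×ˢ 𝓝[>] (0 : ℝ))) (𝓝 z ×ˢ (𝓝 w ×ˢ 𝓝[>] (0 : ℝ))) := by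
    refine Tendsto.prodMk ?_ (Tendsto.prodMk ?_ (tendsto_snd.comp tendsto_snd))
    · have h3 : Tendsto (fun q : ℂ × ℂ × ℝ => q.1)
        (𝓝 z ×ˢ (𝓝 (v + w) ×ˢ 𝓝[>] (0 : ℝ))) (𝓝 z) := tendsto_fst
      simpa using h3.add (ht.smul_const v)
    · have h3 : Tendsto (fun q : ℂ × ℂ × ℝ => q.2.1)
        (𝓝 z ×ˢ (𝓝 (v + w) ×ˢ 𝓝[>] (0 : ℝ))) (𝓝 (v + w)) := tendsto_fst.comp tendsto_snd
      simpa using h3.sub_const v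
  filter_upwards [h1.eventually hv, h2.eventually hw] with q hq1 hq2 hq
  have := hq2 (subset_closure (hq1 hq))
  simpa only [add_assoc, ← smul_add, add_sub_cancel] using this

theorem GoodDir.smul {U : Set ℂ} {z v : ℂ} (hv : GoodDir U z v) {a : ℝ} (ha : 0 < a) :
    GoodDir U z (a • v) := by
  have h2 : Tendsto (fun q : ℂ × ℂ × ℝ => (q.1, a⁻¹ • q.2.1, a * q.2.2))
      (𝓝 z ×ˢ (𝓝 (a • v) ×ˢ 𝓝[>] (0 : ℝ))) (𝓝 z ×ˢ (𝓝 v ×ˢ 𝓝[>] (0 : ℝ))) := by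
    refine Tendsto.prodMk tendsto_fst (Tendsto.prodMk ?_ ?_)
    · have h3 : Tendsto (fun q : ℂ × ℂ × ℝ => q.2.1)
        (𝓝 z ×ˢ (𝓝 (a • v) ×ˢ 𝓝[>] (0 : ℝ))) (𝓝 (a • v)) := tendsto_fst.comp tendsto_snd
      have h4 := h3.const_smul a⁻¹
      rwa [smul_smul, inv_mul_cancel₀ ha.ne', one_smul] at h4
    · have h3 : Tendsto (fun q : ℂ × ℂ × ℝ => q.2.2)
        (𝓝 z ×ˢ (𝓝 (a • v) ×ˢ 𝓝[>] (0 : ℝ))) (𝓝[>] (0 : ℝ)) := tendsto_snd.comp tendsto_snd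
      rw [tendsto_nhdsWithin_iff] at h3 ⊢
      refine ⟨by simpa using h3.1.const_mul a, h3.2.mono fun q hq => mul_pos ha hq⟩
  filter_upwards [h2.eventually hv] with q hq1 hq
  have := hq1 hq
  rwa [smul_smul, mul_comm a, mul_assoc, mul_inv_cancel₀ ha.ne', mul_one] at this

theorem GoodDir.eventually {U : Set ℂ} {z v : ℂ} (hv : GoodDir U z v) :
    ∀ᶠ y in 𝓝 z, GoodDir U y v := by
  obtain ⟨pa, ha, pb, hb, h⟩ := eventually_prod_iff.1 hv
  filter_upwards [eventually_eventually_nhds.2 ha] with y hy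
  exact eventually_prod_iff.2 ⟨pa, hy, pb, hb, h⟩

theorem goodDir_of_mem {U : Set ℂ} (hU : IsOpen U) {z : ℂ} (hz : z ∈ U) : GoodDir U z 0 := by
  have h : Tendsto (fun q : ℂ × ℂ × ℝ => q.1 + q.2.2 • q.2.1)
      (𝓝 z ×ˢ (𝓝 0 ×ˢ 𝓝[>] (0 : ℝ))) (𝓝 z) := by
    have h1 : Tendsto (fun q : ℂ × ℂ × ℝ => q.1)
        (𝓝 z ×ˢ (𝓝 (0 : ℂ) ×ˢ 𝓝[>] (0 : ℝ))) (𝓝 z) := tendsto_fst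
    have h2 : Tendsto (fun q : ℂ × ℂ × ℝ => q.2.1)
        (𝓝 z ×ˢ (𝓝 (0 : ℂ) ×ˢ 𝓝[>] (0 : ℝ))) (𝓝 0) := tendsto_fst.comp tendsto_snd
    have h3 : Tendsto (fun q : ℂ × ℂ × ℝ => q.2.2)
        (𝓝 z ×ˢ (𝓝 (0 : ℂ) ×ˢ 𝓝[>] (0 : ℝ))) (𝓝 0) :=
      (tendsto_snd.comp tendsto_snd).mono_right nhdsWithin_le_nhds
    simpa using h1.add (h3.smul h2)
  exact (h.eventually (hU.mem_nhds hz)).mono fun q hq _ => hq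

theorem goodDir_of_notMem_closure {U : Set ℂ} {z : ℂ} (hz : z ∉ closure U) : GoodDir U z 0 := by
  have h : ∀ᶠ q : ℂ × ℂ × ℝ in 𝓝 z ×ˢ (𝓝 0 ×ˢ 𝓝[>] (0 : ℝ)), q.1 ∉ closure U :=
    tendsto_fst.eventually (isClosed_closure.isOpen_compl.mem_nhds hz)
  exact h.mono fun q hq hq' => absurd hq' hq

theorem convex_goodDir (U : Set ℂ) (z : ℂ) : Convex ℝ {v | GoodDir U z v} := by
  rw [convex_iff_forall_pos]
  intro v hv w hw a b ha hb _
  exact (GoodDir.smul hv ha).add (GoodDir.smul hw hb)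

theorem GoodDir.map {U : Set ℂ} {z v : ℂ} (hv : GoodDir U z v) (L : ℂ ≃L[ℝ] ℂ)
    (hL : ∀ x, L x ∈ U ↔ x ∈ U) : GoodDir U (L z) (L v) := by
  have hcl : ∀ x, L x ∈ closure U ↔ x ∈ closure U := by
    intro x
    have h1 : L ⁻¹' U = U := Set.ext hL
    have h2 := L.toHomeomorph.preimage_closure U
    have h3 : (⇑L.toHomeomorph) = L := rfl
    rw [h3, h1] at h2
    rw [← mem_preimage, h2]
  have h2 : Tendsto (fun q : ℂ × ℂ × ℝ => (L.symm q.1, L.symm q.2.1, q.2.2))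
      (𝓝 (L z) ×ˢ (𝓝 (L v) ×ˢ 𝓝[>] (0 : ℝ))) (𝓝 z ×ˢ (𝓝 v ×ˢ 𝓝[>] (0 : ℝ))) := by
    refine Tendsto.prodMk ?_ (Tendsto.prodMk ?_ (tendsto_snd.comp tendsto_snd))
    · have := (L.symm.continuous.tendsto (L z))
      rw [L.symm_apply_apply] at this
      exact this.comp tendsto_fst
    · have := (L.symm.continuous.tendsto (L v))
      rw [L.symm_apply_apply] at this
      exact this.comp (tendsto_fst.comp tendsto_snd)
  filter_upwards [h2.eventually hv] with q hq1 hq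
  have h3 := hq1 (by rw [← hcl]; simpa using hq)
  rw [← hL] at h3
  simpa only [map_add, map_smul, L.apply_symm_apply] using h3

theorem exists_contDiff_goodDir {U : Set ℂ} (hU : IsOpen U)
    (hg : ∀ z ∈ frontier U, ∃ v, GoodDir U z v) :
    ∃ ν : ℂ → ℂ, ContDiff ℝ (⊤ : ℕ∞) ν ∧ ∀ z, GoodDir U z (ν z) := by
  obtain ⟨g, hg'⟩ := exists_contMDiffMap_forall_mem_convex_of_local_const (n := (⊤ : ℕ∞))
    (modelWithCornersSelf ℝ ℂ) (t := fun z => {v | GoodDir U z v}) (fun z => convex_goodDir U z)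
    (by
      intro z
      have : ∃ v, GoodDir U z v := by
        by_cases h1 : z ∈ U
        · exact ⟨0, goodDir_of_mem hU h1⟩
        by_cases h2 : z ∈ closure U
        · exact hg z ⟨h2, by rwa [hU.interior_eq]⟩
        · exact ⟨0, goodDir_of_notMem_closure h2⟩
      obtain ⟨v, hv⟩ := this
      exact ⟨v, hv.eventually⟩)
  exact ⟨g, contMDiff_iff_contDiff.1 g.contMDiff, hg'⟩

theorem exists_contDiff_goodDir_equivariant {U : Set ℂ} (hU : IsOpen U)
    (hg : ∀ z ∈ frontier U, ∃ v, GoodDir U z v) {p : ℕ} (hp : 0 < p) {ω : ℂ} (hω : ω ^ p = 1)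
    (hrot : ∀ z ∈ U, ω * z ∈ U) (hconj : ∀ z ∈ U, (starRingEnd ℂ) z ∈ U) :
    ∃ ν : ℂ → ℂ, ContDiff ℝ (⊤ : ℕ∞) ν ∧ (∀ z, GoodDir U z (ν z)) ∧
      (∀ z, ν (ω * z) = ω * ν z) ∧ ∀ z, ν ((starRingEnd ℂ) z) = (starRingEnd ℂ) (ν z) := by
  obtain ⟨ν, hν, hνg⟩ := exists_contDiff_goodDir hU hg
  have hω0 : ω ≠ 0 := by rintro rfl; simp [hp.ne'] at hω
  have hrotn : ∀ n : ℕ, ∀ z ∈ U, ω ^ n * z ∈ U := by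
    intro n
    induction n with
    | zero => simp
    | succ n ih => intro z hz; rw [pow_succ', mul_assoc]; exact hrot _ (ih z hz)
  have hroti : ∀ n : ℕ, ∀ z, (ω⁻¹) ^ n * z ∈ U ↔ z ∈ U := by
    intro n z
    constructor
    · intro h
      have := hrotn n _ h
      rwa [← mul_assoc, ← mul_pow, mul_inv_cancel₀ hω0, one_pow, one_mul] at this
    · intro h
      have := hrotn (n * (p - 1)) _ h
      have h2 : ω ^ (n * (p - 1)) = (ω⁻¹) ^ n := by
        rw [mul_comm, pow_mul]
        congr 1
        rw [← mul_eq_one_iff_eq_inv₀ hω0, ← pow_succ, Nat.sub_add_cancel hp, hω]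
      rwa [h2] at this
  have hωn : ‖ω‖ = 1 := Complex.norm_eq_one_of_pow_eq_one hω hp.ne'
  have hωc : (starRingEnd ℂ) ω = ω⁻¹ := by
    rw [← mul_eq_one_iff_eq_inv₀ hω0, mul_comm, Complex.mul_conj, Complex.normSq_eq_norm_sq, hωn]
    simp
  set ν1 : ℂ → ℂ := fun z => ∑ i ∈ Finset.range p, (ω⁻¹) ^ i * ν (ω ^ i * z) with hν1
  have hν1g : ∀ z, GoodDir U z (ν1 z) := by
    intro z
    refine Finset.sum_induction_nonempty _ (GoodDir U z) (fun a b ha hb => ha.add hb)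
      (Finset.nonempty_range_iff.2 hp.ne') ?_
    intro i _
    have h1 : ∀ z : ℂ, (ω⁻¹) ^ i * (ω ^ i * z) = z := by
      intro z; rw [← mul_assoc, ← mul_pow, inv_mul_cancel₀ hω0, one_pow, one_mul]
    have := (hνg (ω ^ i * z)).map
      ((LinearEquiv.smulOfNeZero ℂ ℂ ((ω⁻¹) ^ i)
        (pow_ne_zero _ (inv_ne_zero hω0))).restrictScalars ℝ).toContinuousLinearEquiv
      (fun x => hroti i x)
    have h2 := h1 z
    simp only [LinearEquiv.coe_toContinuousLinearEquiv'] at this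
    change GoodDir U ((ω⁻¹) ^ i * (ω ^ i * z)) ((ω⁻¹) ^ i * ν (ω ^ i * z)) at this
    rwa [h2] at this
  have hν1r : ∀ z, ν1 (ω * z) = ω * ν1 z := by
    intro z
    have h1 : ∀ i, (ω⁻¹) ^ i * ν (ω ^ i * (ω * z)) =
        ω * ((ω⁻¹) ^ (i + 1) * ν (ω ^ (i + 1) * z)) := by
      intro i
      rw [← mul_assoc (ω ^ i), ← pow_succ, pow_succ (ω⁻¹) i, ← mul_assoc, mul_comm ω (_ * _),
        mul_assoc _ (ω⁻¹) ω, inv_mul_cancel₀ hω0, mul_one]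
    simp only [hν1, h1, ← Finset.mul_sum]
    congr 1
    have h2 := Finset.sum_range_succ (fun i => (ω⁻¹) ^ i * ν (ω ^ i * z)) p
    rw [Finset.sum_range_succ'] at h2
    simp only [inv_pow, hω, inv_one, pow_zero, add_left_inj] at h2
    simpa using h2
  have hν1r' : ∀ z, ν1 (ω⁻¹ * z) = ω⁻¹ * ν1 z := by
    intro z
    have := hν1r (ω⁻¹ * z)
    rw [← mul_assoc, mul_inv_cancel₀ hω0, one_mul] at this
    rw [this, ← mul_assoc, inv_mul_cancel₀ hω0, one_mul]
  have hν1s : ContDiff ℝ (⊤ : ℕ∞) ν1 := by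
    refine ContDiff.sum fun i _ => contDiff_const.mul (hν.comp (contDiff_const.mul contDiff_id))
  refine ⟨fun z => ν1 z + (starRingEnd ℂ) (ν1 ((starRingEnd ℂ) z)), ?_, ?_, ?_, ?_⟩
  · exact hν1s.add (Complex.conjCLE.contDiff.comp (hν1s.comp Complex.conjCLE.contDiff))
  · intro z
    refine (hν1g z).add ?_
    have := (hν1g ((starRingEnd ℂ) z)).map Complex.conjCLE (fun x =>
      ⟨fun h => by simpa using hconj _ h, fun h => by simpa using hconj _ h⟩)
    simpa using this
  · intro z
    simp only [hν1r, map_mul, hωc, hν1r', map_inv₀, inv_inv]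
    ring
  · intro z
    simp only [map_add, Complex.conj_conj]
    ring

theorem exists_inward_deformation {U : Set ℂ} (hU : IsOpen U) (hb : Bornology.IsBounded U)
    (hg : ∀ z ∈ frontier U, ∃ v, GoodDir U z v) {p : ℕ} (hp : 0 < p) {ω : ℂ} (hω : ω ^ p = 1)
    (hrot : ∀ z ∈ U, ω * z ∈ U) (hconj : ∀ z ∈ U, (starRingEnd ℂ) z ∈ U)
    {K : Set ℂ} (hK : IsCompact K) (hKU : K ⊆ U) {η : ℝ} (hη : 0 < η) :
    ∃ T : ℂ → ℂ, ContDiff ℝ (⊤ : ℕ∞) T ∧ MapsTo T (closure U) U ∧ (∀ z ∈ frontier U, T z ∉ K) ∧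
      InjOn T U ∧
      (∀ z ∈ U, ‖fderiv ℝ T z‖ ^ 2 ≤ (1 + η) * |(fderiv ℝ T z).det|) ∧
      (∀ z, T (ω * z) = ω * T z) ∧ ∀ z, T ((starRingEnd ℂ) z) = (starRingEnd ℂ) (T z) := by
  obtain ⟨ν, hν, hνg, hνr, hνc⟩ := exists_contDiff_goodDir_equivariant hU hg hp hω hrot hconj
  have hcpt : IsCompact (closure U) := hb.isCompact_closure
  have hνcont := hν.continuous
  have hT0 : Continuous fun q : ℝ × ℂ => q.2 + q.1 • ν q.2 := by fun_prop
  have hfd : Continuous (fderiv ℝ ν) := hν.continuous_fderiv (by simp)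
  have e1 : ∀ᶠ t in 𝓝 (0 : ℝ), ∀ z ∈ closure U, z ∈ closure U → 0 < t → z + t • ν z ∈ U := by
    refine hcpt.eventually_forall_of_forall_eventually fun y hy => ?_
    have h := hνg y
    have h1 : Tendsto (fun q : ℝ × ℂ => (q.2, ν q.2, q.1)) (𝓝[>] 0 ×ˢ 𝓝 y)
        (𝓝 y ×ˢ (𝓝 (ν y) ×ˢ 𝓝[>] (0 : ℝ))) :=
      tendsto_snd.prodMk (((hνcont.tendsto y).comp tendsto_snd).prodMk tendsto_fst)
    have h2 := h1.eventually h
    rw [eventually_prod_iff] at h2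
    obtain ⟨pa, ha, pb, hb, h2⟩ := h2
    rw [eventually_nhdsWithin_iff] at ha
    rw [nhds_prod_eq]
    filter_upwards [ha.prod_mk hb] with q hq hcl h0
    exact h2 (hq.1 h0) hq.2 hcl
  have e2 : ∀ᶠ t in 𝓝 (0 : ℝ), ∀ z ∈ frontier U, z + t • ν z ∉ K := by
    refine (hcpt.of_isClosed_subset isClosed_frontier frontier_subset_closure).eventually_forall_of_forall_eventually fun y hy => ?_
    refine hT0.continuousAt.eventually (hK.isClosed.isOpen_compl.mem_nhds ?_)
    intro h
    have := hKU (by simpa using h)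
    exact hy.2 (by rwa [hU.interior_eq])
  have e3 : ∀ᶠ t in 𝓝 (0 : ℝ), ∀ z ∈ closure U,
      ‖ContinuousLinearMap.id ℝ ℂ + t • fderiv ℝ ν z‖ ^ 2 <
        (1 + η) * |(ContinuousLinearMap.id ℝ ℂ + t • fderiv ℝ ν z).det| := by
    refine hcpt.eventually_forall_of_forall_eventually fun y hy => ?_
    have hc : Continuous fun q : ℝ × ℂ => ContinuousLinearMap.id ℝ ℂ + q.1 • fderiv ℝ ν q.2 := by
      fun_prop
    refine ContinuousAt.eventually_lt (hc.norm.pow 2).continuousAt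
      ((continuous_const.mul (ContinuousLinearMap.continuous_det.comp hc).abs)).continuousAt ?_
    have : (ContinuousLinearMap.id ℝ ℂ).det = 1 := by
      simp [ContinuousLinearMap.det]
    simp [ this, hη]
  obtain ⟨R, hR⟩ := hb.subset_ball 0
  obtain ⟨C, hC⟩ := ((isCompact_closedBall (0 : ℂ) R).image hfd).isBounded.exists_norm_le
  have hLip : ∀ x ∈ U, ∀ y ∈ U, ‖ν x - ν y‖ ≤ C * ‖x - y‖ := by
    intro x hx y hy
    exact (convex_closedBall (0 : ℂ) R).norm_image_sub_le_of_norm_fderiv_le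
      (fun z _ => (hν.differentiable (by simp)) z)
      (fun z hz => hC _ (mem_image_of_mem _ hz)) (ball_subset_closedBall (hR hy))
      (ball_subset_closedBall (hR hx))
  have e4 : ∀ᶠ t in 𝓝 (0 : ℝ), t * C < 1 := by
    have : Tendsto (fun t : ℝ => t * C) (𝓝 0) (𝓝 (0 * C)) := tendsto_id.mul_const C
    rw [zero_mul] at this
    exact this.eventually_lt_const zero_lt_one
  obtain ⟨t, ⟨⟨⟨ht1, ht2⟩, ht3⟩, ht4⟩, ht0⟩ :=
    ((((e1.and e2).and e3).and e4).filter_mono nhdsWithin_le_nhds |>.and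
      (self_mem_nhdsWithin : Ioi (0 : ℝ) ∈ 𝓝[>] 0)).exists
  have ht0 : 0 < t := ht0
  have hfT : ∀ z, fderiv ℝ (fun z => z + t • ν z) z =
      ContinuousLinearMap.id ℝ ℂ + t • fderiv ℝ ν z := by
    intro z
    have h1 : DifferentiableAt ℝ ν z := hν.differentiable (by simp) z
    exact ((hasFDerivAt_id z).add (h1.hasFDerivAt.const_smul t)).fderiv
  refine ⟨fun z => z + t • ν z, contDiff_id.add (hν.const_smul t), fun z hz => ht1 z hz hz ht0,
    ht2, ?_, ?_, ?_, ?_⟩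
  · intro x hx y hy hxy
    simp only at hxy
    have h1 : x - y = - (t • (ν x - ν y)) := by
      rw [smul_sub]; linear_combination hxy
    have h2 : ‖x - y‖ ≤ t * (C * ‖x - y‖) := by
      calc ‖x - y‖ = t * ‖ν x - ν y‖ := by
            conv_lhs => rw [h1]
            rw [norm_neg, norm_smul, Real.norm_of_nonneg ht0.le]
        _ ≤ _ := mul_le_mul_of_nonneg_left (hLip x hx y hy) ht0.le
    have h3 : ‖x - y‖ ≤ 0 := by nlinarith [norm_nonneg (x - y)]
    exact sub_eq_zero.1 (norm_le_zero_iff.1 h3)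
  · intro z hz
    rw [hfT]
    exact (ht3 z (subset_closure hz)).le
  · intro z
    simp only [hνr, Complex.real_smul]
    ring
  · intro z
    simp [hνc]

theorem det_smul_one_comp (c : ℂ) (B : ℂ →L[ℝ] ℂ) :
    ((c • (1 : ℂ →L[ℝ] ℂ)).comp B).det = ‖c‖ ^ 2 * B.det := by
  have h : ((c • (1 : ℂ →L[ℝ] ℂ) : ℂ →L[ℝ] ℂ) : ℂ →ₗ[ℝ] ℂ) = Algebra.lmul ℝ ℂ c := by
    ext <;> simp
  simp only [ContinuousLinearMap.det, ContinuousLinearMap.toLinearMap_comp, LinearMap.det_comp, h]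
  rw [← Complex.normSq_eq_norm_sq, ← Algebra.norm_complex_apply, Algebra.norm_apply]

theorem exists_almost_conformal_map {U : Set ℂ} (hU : IsOpen U) (hs : IsSimplyConnected U)
    (hb : Bornology.IsBounded U) (h0 : (0 : ℂ) ∈ U)
    (hg : ∀ z ∈ frontier U, ∃ v, GoodDir U z v) {p : ℕ} (hp : 0 < p) {ω : ℂ} (hω : ω ^ p = 1)
    (hrot : ∀ z ∈ U, ω * z ∈ U) (hconj : ∀ z ∈ U, (starRingEnd ℂ) z ∈ U)
    {η : ℝ} (hη : 0 < η) :
    ∃ f : ℂ → ℂ, ContDiff ℝ (⊤ : ℕ∞) f ∧ (∀ z ∈ closure U, f (ω * z) = ω * f z) ∧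
      (∀ z ∈ closure U, f ((starRingEnd ℂ) z) = (starRingEnd ℂ) (f z)) ∧
      MapsTo f U (ball 0 1) ∧ InjOn f U ∧
      (∀ z ∈ U, ‖fderiv ℝ f z‖ ^ 2 ≤ (1 + η) * |(fderiv ℝ f z).det|) ∧
      ∀ z ∈ frontier U, 1 - η ≤ ‖f z‖ := by
  have hωn : ‖ω‖ = 1 := Complex.norm_eq_one_of_pow_eq_one hω hp.ne'
  obtain ⟨φ, hφ, hsurj, hφr, hφc⟩ := exists_equivariant_riemannMap hU hs hb h0 hωn hrot hconj
  set g := Function.invFunOn φ U with hgdef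
  have hgc : ContinuousOn g (ball 0 1) := fun w hw =>
    (hφ.hasDerivAt_invFunOn hU hsurj hw).continuousAt.continuousWithinAt
  have hgU : ∀ w ∈ ball (0 : ℂ) 1, g w ∈ U := fun w hw =>
    Function.invFunOn_mem (by rw [← hsurj] at hw; exact hw)
  have hgφ : ∀ z ∈ U, g (φ z) = z := fun z hz => hφ.2.1.leftInvOn_invFunOn hz
  have hsub : closedBall (0 : ℂ) (1 - η) ⊆ ball 0 1 := closedBall_subset_ball (by linarith)
  obtain ⟨T, hT, hTm, hTK, hTi, hTd, hTr, hTc⟩ := exists_inward_deformation hU hb hg hp hω hrot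
    hconj ((isCompact_closedBall (0 : ℂ) (1 - η)).image_of_continuousOn (hgc.mono hsub))
    (image_subset_iff.2 fun w hw => hgU w (hsub hw)) hη
  have hTo : IsOpen (T ⁻¹' U) := hU.preimage hT.continuous
  obtain ⟨V, hVo, hUV, hVT⟩ := normal_exists_closure_subset isClosed_closure hTo hTm
  obtain ⟨χ, hχ, -, hχs, hχ1⟩ := exists_contMDiff_support_eq_eq_one_iff (modelWithCornersSelf ℝ ℂ)
    (n := (⊤ : ℕ∞)) hVo isClosed_closure hUV
  have hχ := contMDiff_iff_contDiff.1 hχ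
  have hφs : ContDiffOn ℝ (⊤ : ℕ∞) φ U := (hφ.1.contDiffOn hU).restrict_scalars ℝ
  set f : ℂ → ℂ := fun z => χ z • φ (T z) with hf
  have hfeq : ∀ z ∈ closure U, f z = φ (T z) := fun z hz => by simp [hf, (hχ1 z).1 hz]
  have hclr : ∀ z ∈ closure U, ω * z ∈ closure U := fun z hz =>
    map_mem_closure (continuous_const.mul continuous_id) hz hrot
  have hclc : ∀ z ∈ closure U, (starRingEnd ℂ) z ∈ closure U := fun z hz =>
    map_mem_closure Complex.continuous_conj hz hconj
  refine ⟨f, ?_, ?_, ?_, ?_, ?_, ?_, ?_⟩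
  · rw [contDiff_iff_contDiffAt]
    intro z
    by_cases hz : z ∈ closure V
    · have h1 : ContDiffAt ℝ (⊤ : ℕ∞) φ (T z) := hφs.contDiffAt (hU.mem_nhds (hVT hz))
      exact hχ.contDiffAt.smul (h1.comp z hT.contDiffAt)
    · have h1 : f =ᶠ[𝓝 z] fun _ => 0 := by
        filter_upwards [isClosed_closure.isOpen_compl.mem_nhds hz] with y hy
        have : χ y = 0 := by
          rw [← Function.notMem_support, hχs]
          exact fun h => hy (subset_closure h)
        simp [hf, this]
      exact contDiffAt_const.congr_of_eventuallyEq h1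
  · intro z hz
    rw [hfeq _ hz, hfeq _ (hclr z hz), hTr, hφr _ (hTm hz)]
  · intro z hz
    rw [hfeq _ hz, hfeq _ (hclc z hz), hTc, hφc _ (hTm hz)]
  · intro z hz
    rw [hfeq _ (subset_closure hz)]
    exact hφ.2.2.2.1 (hTm (subset_closure hz))
  · intro x hx y hy hxy
    rw [hfeq _ (subset_closure hx), hfeq _ (subset_closure hy)] at hxy
    exact hTi hx hy (hφ.2.1 (hTm (subset_closure hx)) (hTm (subset_closure hy)) hxy)
  · intro z hz
    have h1 : f =ᶠ[𝓝 z] φ ∘ T := by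
      filter_upwards [hU.mem_nhds hz] with y hy using hfeq y (subset_closure hy)
    have hTz := hTm (subset_closure hz)
    have h2 : HasDerivAt φ (deriv φ (T z)) (T z) :=
      (hφ.1.differentiableAt (hU.mem_nhds hTz)).hasDerivAt
    have h3 : HasFDerivAt T (fderiv ℝ T z) z := (hT.differentiable (by simp) z).hasFDerivAt
    rw [h1.fderiv_eq, (h2.complexToReal_fderiv.comp z h3).fderiv, det_smul_one_comp, abs_mul,
      abs_of_nonneg (by positivity)]
    have h4 : ‖(deriv φ (T z) • (1 : ℂ →L[ℝ] ℂ)).comp (fderiv ℝ T z)‖ ≤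
        ‖deriv φ (T z)‖ * ‖fderiv ℝ T z‖ := by
      refine (ContinuousLinearMap.opNorm_comp_le _ _).trans ?_
      gcongr
      rw [norm_smul]
      simp
    calc _ ≤ (‖deriv φ (T z)‖ * ‖fderiv ℝ T z‖) ^ 2 := by gcongr
      _ = ‖deriv φ (T z)‖ ^ 2 * ‖fderiv ℝ T z‖ ^ 2 := mul_pow _ _ _
      _ ≤ ‖deriv φ (T z)‖ ^ 2 * ((1 + η) * |(fderiv ℝ T z).det|) := by gcongr; exact hTd z hz
      _ = _ := by ring
  · intro z hz
    by_contra! hlt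
    have hz' := hTm (frontier_subset_closure hz)
    rw [hfeq _ (frontier_subset_closure hz)] at hlt
    exact hTK z hz ⟨φ (T z), by simpa using hlt.le, hgφ _ hz'⟩

theorem sum_pow_eq_ite {p : ℕ} {x : ℂ} (hx : x ^ p = 1) :
    ∑ m ∈ Finset.range p, x ^ m = if x = 1 then (p : ℂ) else 0 := by
  split_ifs with h
  · simp [h]
  · rw [geom_sum_eq h, hx, sub_self, zero_div]

theorem sum_mul_conj_eq {p k : ℕ} (hk : 2 * k < p) {ω : ℂ} (hω : IsPrimitiveRoot ω p)
    (c : Fin (k + 1) → ℂ) :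
    ∑ m ∈ Finset.range p, (∑ j, c j * (ω ^ m) ^ (j : ℕ)) *
      (starRingEnd ℂ) (∑ j, c j * (ω ^ m) ^ (j : ℕ)) = p * ∑ j, c j * (starRingEnd ℂ) (c j) := by
  have hp : p ≠ 0 := by omega
  have hω0 : ω ≠ 0 := hω.ne_zero hp
  have hωn : ‖ω‖ = 1 := Complex.norm_eq_one_of_pow_eq_one hω.pow_eq_one hp
  have hωc : (starRingEnd ℂ) ω = ω⁻¹ := by
    rw [← mul_eq_one_iff_eq_inv₀ hω0, mul_comm, Complex.mul_conj, Complex.normSq_eq_norm_sq, hωn]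
    simp
  have h1 : ∀ m, (∑ j, c j * (ω ^ m) ^ (j : ℕ)) *
      (starRingEnd ℂ) (∑ j, c j * (ω ^ m) ^ (j : ℕ)) =
      ∑ i : Fin (k + 1), ∑ j : Fin (k + 1),
        c i * (starRingEnd ℂ) (c j) * (ω ^ (i : ℕ) * (ω⁻¹) ^ (j : ℕ)) ^ m := by
    intro m
    rw [map_sum, Finset.sum_mul_sum]
    refine Finset.sum_congr rfl fun i _ => Finset.sum_congr rfl fun j _ => ?_
    simp only [map_mul, map_pow, hωc]
    rw [mul_pow, ← pow_mul, ← pow_mul, ← pow_mul, ← pow_mul, mul_comm m, mul_comm m]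
    ring
  simp only [h1]
  rw [Finset.sum_comm, Finset.mul_sum]
  refine Finset.sum_congr rfl fun i _ => ?_
  rw [Finset.sum_comm, Finset.sum_eq_single i]
  · rw [← Finset.mul_sum, sum_pow_eq_ite, if_pos]
    · ring
    · rw [← mul_pow, mul_inv_cancel₀ hω0, one_pow]
    · rw [← mul_pow, mul_inv_cancel₀ hω0, one_pow, one_pow]
  · intro j _ hji
    rw [← Finset.mul_sum, sum_pow_eq_ite, if_neg, mul_zero]
    · intro h
      rw [inv_pow, mul_inv_eq_one₀ (pow_ne_zero _ hω0)] at h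
      exact hji (Fin.ext (hω.pow_inj (by omega) (by omega) h).symm)
    · rw [mul_pow, ← pow_mul, ← pow_mul, mul_comm _ p, mul_comm _ p, pow_mul, pow_mul, inv_pow,
        hω.pow_eq_one]
      simp
  · simp

theorem sum_sq_eq {p k : ℕ} (hk : 2 * k < p) {ω : ℂ} (hω : IsPrimitiveRoot ω p)
    (c : Fin (k + 1) → ℂ) :
    ∑ m ∈ Finset.range p, (∑ j, c j * (ω ^ m) ^ (j : ℕ)) ^ 2 = p * c 0 ^ 2 := by
  have h1 : ∀ m, (∑ j, c j * (ω ^ m) ^ (j : ℕ)) ^ 2 =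
      ∑ i : Fin (k + 1), ∑ j : Fin (k + 1), c i * c j * (ω ^ ((i : ℕ) + j)) ^ m := by
    intro m
    rw [sq, Finset.sum_mul_sum]
    refine Finset.sum_congr rfl fun i _ => Finset.sum_congr rfl fun j _ => ?_
    rw [← pow_mul, ← pow_mul, ← pow_mul, add_mul, pow_add, mul_comm m, mul_comm m]
    ring
  have h2 : ∀ i j : Fin (k + 1), (∑ m ∈ Finset.range p, c i * c j * (ω ^ ((i : ℕ) + j)) ^ m) =
      if (i : ℕ) + j = 0 then p * (c i * c j) else 0 := by
    intro i j
    rw [← Finset.mul_sum, sum_pow_eq_ite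
      (by rw [← pow_mul, mul_comm, pow_mul, hω.pow_eq_one, one_pow])]
    have h3 : ω ^ ((i : ℕ) + j) = 1 ↔ (i : ℕ) + j = 0 := by
      constructor
      · intro h
        exact Nat.eq_zero_of_dvd_of_lt ((hω.pow_eq_one_iff_dvd _).1 h) (by omega)
      · intro h; rw [h, pow_zero]
    simp only [h3]
    split_ifs <;> ring
  simp only [h1]
  rw [Finset.sum_comm, Finset.sum_eq_single 0]
  · rw [Finset.sum_comm, Finset.sum_eq_single 0]
    · rw [h2]; simp [sq]
    · intro j _ hj
      rw [h2, if_neg]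
      intro h
      exact hj (Fin.ext (by simpa using h))
    · simp
  · intro i _ hi
    rw [Finset.sum_comm]
    refine Finset.sum_eq_zero fun j _ => ?_
    rw [h2, if_neg]
    intro h
    exact hi (Fin.ext (by simp at h; simpa using congrArg Fin.val h.1))
  · simp

theorem le_sum_re_sq {p k : ℕ} (hk : 2 * k < p) {ω : ℂ} (hω : IsPrimitiveRoot ω p)
    (c : Fin (k + 1) → ℂ) (h0 : (c 0).im = 0) :
    p * (2⁻¹ * ∑ j, ‖c j‖ ^ 2) ≤
      ∑ m ∈ Finset.range p, (∑ j, c j * (ω ^ m) ^ (j : ℕ)).re ^ 2 := by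
  have h1 : ∀ x : ℂ, x.re ^ 2 = 2⁻¹ * (x * (starRingEnd ℂ) x).re + 2⁻¹ * (x ^ 2).re := by
    intro x
    simp [sq, Complex.mul_re]; ring
  simp only [h1, Finset.sum_add_distrib, ← Finset.mul_sum]
  rw [← Complex.re_sum, ← Complex.re_sum, sum_mul_conj_eq hk hω, sum_sq_eq hk hω]
  have h2 : ∀ x : ℂ, (x * (starRingEnd ℂ) x).re = ‖x‖ ^ 2 := by
    intro x; rw [Complex.mul_conj, Complex.normSq_eq_norm_sq, Complex.ofReal_re]
  have h3 : ((p : ℂ) * ∑ j, c j * (starRingEnd ℂ) (c j)).re = p * ∑ j, ‖c j‖ ^ 2 := by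
    rw [← Complex.ofReal_natCast, Complex.re_ofReal_mul, Complex.re_sum]
    simp only [h2]
  have h4 : ((p : ℂ) * c 0 ^ 2).re = p * (c 0).re ^ 2 := by
    rw [← Complex.ofReal_natCast, Complex.re_ofReal_mul, sq, Complex.mul_re, h0]; ring
  rw [h3, h4]
  have : 0 ≤ (p : ℝ) * (c 0).re ^ 2 := by positivity
  linarith

theorem sum_norm_sq_eq {p k : ℕ} (hk : 2 * k < p) {ω : ℂ} (hω : IsPrimitiveRoot ω p)
    (c : Fin (k + 1) → ℂ) :
    ∑ m ∈ Finset.range p, ‖∑ j, c j * (ω ^ m) ^ (j : ℕ)‖ ^ 2 = p * ∑ j, ‖c j‖ ^ 2 := by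
  have h2 : ∀ x : ℂ, ‖x‖ ^ 2 = (x * (starRingEnd ℂ) x).re := by
    intro x; rw [Complex.mul_conj, Complex.normSq_eq_norm_sq, Complex.ofReal_re]
  simp only [h2]
  rw [← Complex.re_sum, sum_mul_conj_eq hk hω, ← Complex.ofReal_natCast, Complex.re_ofReal_mul,
    Complex.re_sum]

theorem lintegral_ball_norm_pow (n : ℕ) :
    ∫⁻ w in ball (0 : ℂ) 1, ENNReal.ofReal (‖w‖ ^ (2 * n)) = ENNReal.ofReal (Real.pi / (n + 1)) := by
  rw [← lintegral_indicator measurableSet_ball, ← Complex.lintegral_comp_polarCoord_symm,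
    show polarCoord.target = Ioi (0 : ℝ) ×ˢ Ioo (-Real.pi) Real.pi from rfl]
  set F : ℝ → ℝ≥0∞ := (Ioo (0 : ℝ) 1).indicator fun r => ENNReal.ofReal (r ^ (2 * n + 1)) with hF
  have hFm : Measurable F := by
    refine Measurable.indicator ?_ measurableSet_Ioo
    fun_prop
  have h1 : ∀ q ∈ Ioi (0 : ℝ) ×ˢ Ioo (-Real.pi) Real.pi, ENNReal.ofReal q.1 •
      (ball (0 : ℂ) 1).indicator (fun w => ENNReal.ofReal (‖w‖ ^ (2 * n)))
        (Complex.polarCoord.symm q) = F q.1 := by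
    rintro ⟨r, θ⟩ ⟨hr, -⟩
    have hr : 0 < r := hr
    have hn : ‖Complex.polarCoord.symm (r, θ)‖ = r := by
      rw [Complex.norm_polarCoord_symm, abs_of_pos hr]
    simp only [hF, indicator, mem_ball_zero_iff, hn, mem_Ioo, hr, true_and, smul_eq_mul]
    split_ifs
    · rw [← ENNReal.ofReal_mul hr.le, pow_succ']
    · simp
  rw [setLIntegral_congr_fun (measurableSet_Ioi.prod measurableSet_Ioo) h1, Measure.volume_eq_prod,
    ← Measure.prod_restrict, lintegral_prod (fun q : ℝ × ℝ => F q.1) (hFm.comp measurable_fst).aemeasurable]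
  simp only [lintegral_const, Measure.restrict_apply MeasurableSet.univ, univ_inter,
    Real.volume_Ioo]
  rw [lintegral_mul_const _ hFm, hF, lintegral_indicator measurableSet_Ioo,
    Measure.restrict_restrict measurableSet_Ioo,
    inter_eq_left.2 (Ioo_subset_Ioi_self : Ioo (0 : ℝ) 1 ⊆ Ioi 0)]
  rw [← ofReal_integral_eq_lintegral_ofReal, ← integral_Ioc_eq_integral_Ioo,
    ← intervalIntegral.integral_of_le zero_le_one, integral_pow, ← ENNReal.ofReal_mul' (by linarith [Real.pi_pos])]
  · congr 1
    push_cast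
    field_simp
    ring
  · exact (continuous_pow _).integrableOn_Icc.mono_set Ioo_subset_Icc_self
  · filter_upwards [ae_restrict_mem measurableSet_Ioo] with r hr
    have := hr.1.le
    simp only [Pi.zero_apply]
    positivity

theorem setLIntegral_comp_linearIsometryEquiv (L : ℂ ≃ₗᵢ[ℝ] ℂ) {s : Set ℂ} (hs : ∀ x, L x ∈ s ↔ x ∈ s)
    (h : ℂ → ℝ≥0∞) : ∫⁻ z in s, h (L z) ∂μH[1] = ∫⁻ z in s, h z ∂μH[1] := by
  have := (L.toIsometryEquiv.measurePreserving_hausdorffMeasure 1).setLIntegral_comp_preimage_emb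
    L.toIsometryEquiv.toHomeomorph.measurableEmbedding h s
  have h2 : L.toIsometryEquiv ⁻¹' s = s := Set.ext hs
  rw [h2] at this
  exact this

theorem setLIntegral_image_linearIsometryEquiv (L : ℂ ≃ₗᵢ[ℝ] ℂ) {s t : Set ℂ}
    (hs : ∀ x, L x ∈ t ↔ x ∈ s) (h : ℂ → ℝ≥0∞) : ∫⁻ z in s, h (L z) = ∫⁻ z in t, h z := by
  have := L.measurePreserving.setLIntegral_comp_preimage_emb
    L.toHomeomorph.measurableEmbedding h t
  have h2 : L ⁻¹' t = s := Set.ext hs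
  rw [h2] at this
  exact this

/-- The polynomial `∑ a j w ^ j` with real coefficients, as a function on `ℂ`. -/
def realPoly {k : ℕ} (a : Fin (k + 1) → ℝ) (w : ℂ) : ℂ := ∑ j, (a j : ℂ) * w ^ (j : ℕ)

def realPolyDeriv {k : ℕ} (a : Fin (k + 1) → ℝ) (w : ℂ) : ℂ :=
  ∑ j : Fin (k + 1), (a j : ℂ) * ((j : ℕ) * w ^ ((j : ℕ) - 1))

theorem hasDerivAt_realPoly {k : ℕ} (a : Fin (k + 1) → ℝ) (w : ℂ) :
    HasDerivAt (realPoly a) (realPolyDeriv a w) w := by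
  unfold realPoly realPolyDeriv
  exact HasDerivAt.fun_sum fun j _ => (hasDerivAt_pow _ _).const_mul _

theorem realPoly_conj {k : ℕ} (a : Fin (k + 1) → ℝ) (w : ℂ) :
    realPoly a ((starRingEnd ℂ) w) = (starRingEnd ℂ) (realPoly a w) := by
  simp [realPoly]

theorem norm_realPolyDeriv_conj {k : ℕ} (a : Fin (k + 1) → ℝ) (w : ℂ) :
    ‖realPolyDeriv a ((starRingEnd ℂ) w)‖ = ‖realPolyDeriv a w‖ := by
  rw [← Complex.norm_conj (realPolyDeriv a w)]
  simp [realPolyDeriv]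

theorem continuous_realPolyDeriv {k : ℕ} (a : Fin (k + 1) → ℝ) : Continuous (realPolyDeriv a) := by
  unfold realPolyDeriv; fun_prop

theorem lintegral_ball_realPolyDeriv_le {k : ℕ} (a : Fin (k + 1) → ℝ) :
    ∫⁻ w in ball (0 : ℂ) 1, ENNReal.ofReal (‖realPolyDeriv a w‖ ^ 2) ≤
      ENNReal.ofReal (Real.pi * k * ∑ j, a j ^ 2) := by
  set p := 2 * k + 1 with hp
  have hk : 2 * k < p := by omega
  have hp0 : p ≠ 0 := by omega
  obtain ⟨ω, hω⟩ : ∃ ω : ℂ, IsPrimitiveRoot ω p := ⟨_, Complex.isPrimitiveRoot_exp p hp0⟩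
  have hωn : ‖ω‖ = 1 := Complex.norm_eq_one_of_pow_eq_one hω.pow_eq_one hp0
  have h1 : ∀ m : ℕ, ∫⁻ w in ball (0 : ℂ) 1, ENNReal.ofReal (‖realPolyDeriv a (ω ^ m * w)‖ ^ 2) =
      ∫⁻ w in ball (0 : ℂ) 1, ENNReal.ofReal (‖realPolyDeriv a w‖ ^ 2) := by
    intro m
    have hu : ω ^ m ∈ Submonoid.unitSphere ℂ := by simp [Submonoid.unitSphere, hωn]
    exact setLIntegral_image_linearIsometryEquiv (rotation ⟨ω ^ m, hu⟩)
      (s := ball (0 : ℂ) 1) (t := ball (0 : ℂ) 1) (fun x => by simp)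
      (fun w => ENNReal.ofReal (‖realPolyDeriv a w‖ ^ 2))
  have h2 : ∀ w : ℂ, ∑ m ∈ Finset.range p, ENNReal.ofReal (‖realPolyDeriv a (ω ^ m * w)‖ ^ 2) =
      ∑ j : Fin (k + 1), ENNReal.ofReal (p * ((j : ℕ) * a j) ^ 2) *
        ENNReal.ofReal (‖w‖ ^ (2 * ((j : ℕ) - 1))) := by
    intro w
    rw [← ENNReal.ofReal_sum_of_nonneg (fun _ _ => by positivity)]
    have h3 := sum_norm_sq_eq hk hω (fun j : Fin (k + 1) => (a j : ℂ) * ((j : ℕ) * w ^ ((j : ℕ) - 1)))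
    have h4 : ∀ m : ℕ, ‖realPolyDeriv a (ω ^ m * w)‖ =
        ‖∑ j : Fin (k + 1), (a j : ℂ) * ((j : ℕ) * w ^ ((j : ℕ) - 1)) * (ω ^ m) ^ (j : ℕ)‖ := by
      intro m
      have h5 : ω ^ m * realPolyDeriv a (ω ^ m * w) =
          ∑ j : Fin (k + 1), (a j : ℂ) * ((j : ℕ) * w ^ ((j : ℕ) - 1)) * (ω ^ m) ^ (j : ℕ) := by
        unfold realPolyDeriv
        rw [Finset.mul_sum]
        refine Finset.sum_congr rfl fun j _ => ?_
        rcases Nat.eq_zero_or_pos (j : ℕ) with hj | hj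
        · simp [hj]
        · obtain ⟨n, hn⟩ := Nat.exists_eq_succ_of_ne_zero hj.ne'
          rw [hn]
          simp only [Nat.succ_eq_add_one, Nat.add_sub_cancel, mul_pow]
          ring
      rw [← h5, norm_mul, norm_pow, hωn, one_pow, one_mul]
    simp only [h4]
    rw [h3, Finset.mul_sum, ENNReal.ofReal_sum_of_nonneg (fun _ _ => by positivity)]
    refine Finset.sum_congr rfl fun j _ => ?_
    rw [← ENNReal.ofReal_mul (by positivity)]
    congr 1
    simp only [norm_mul, norm_pow, Complex.norm_real, Complex.norm_natCast, mul_pow, Real.norm_eq_abs,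
      sq_abs]
    ring
  have h3 : (p : ℝ≥0∞) * ∫⁻ w in ball (0 : ℂ) 1, ENNReal.ofReal (‖realPolyDeriv a w‖ ^ 2) =
      ∑ j : Fin (k + 1), ENNReal.ofReal (p * ((j : ℕ) * a j) ^ 2) *
        ENNReal.ofReal (Real.pi / (((j : ℕ) - 1 : ℕ) + 1)) := by
    calc _ = ∑ m ∈ Finset.range p,
          ∫⁻ w in ball (0 : ℂ) 1, ENNReal.ofReal (‖realPolyDeriv a (ω ^ m * w)‖ ^ 2) := by
          simp only [h1]; simp
      _ = ∫⁻ w in ball (0 : ℂ) 1, ∑ m ∈ Finset.range p,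
          ENNReal.ofReal (‖realPolyDeriv a (ω ^ m * w)‖ ^ 2) := by
          rw [lintegral_finsetSum]
          intro m _
          have := continuous_realPolyDeriv a
          fun_prop
      _ = _ := by
          simp only [h2]
          rw [lintegral_finsetSum _ (fun j _ => by fun_prop)]
          refine Finset.sum_congr rfl fun j _ => ?_
          rw [lintegral_const_mul _ (by fun_prop), lintegral_ball_norm_pow]
  have h4 : (p : ℝ≥0∞) * ∫⁻ w in ball (0 : ℂ) 1, ENNReal.ofReal (‖realPolyDeriv a w‖ ^ 2) ≤
      p * ENNReal.ofReal (Real.pi * k * ∑ j, a j ^ 2) := by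
    rw [h3, Finset.mul_sum, ENNReal.ofReal_sum_of_nonneg (fun _ _ => by positivity), Finset.mul_sum]
    refine Finset.sum_le_sum fun j _ => ?_
    rw [← ENNReal.ofReal_natCast p, ← ENNReal.ofReal_mul (by positivity),
      ← ENNReal.ofReal_mul (by positivity)]
    refine ENNReal.ofReal_le_ofReal ?_
    rcases Nat.eq_zero_or_pos (j : ℕ) with hj | hj
    · simp only [hj, Nat.cast_zero, zero_mul]
      simp only [zero_pow two_ne_zero, mul_zero, zero_mul]
      positivity
    · have h5 : (((j : ℕ) - 1 : ℕ) : ℝ) + 1 = (j : ℕ) := by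
        rw [Nat.cast_sub hj]; simp
      have hj' : (0 : ℝ) < (j : ℕ) := by exact_mod_cast hj
      have hjk : ((j : ℕ) : ℝ) ≤ k := by exact_mod_cast Nat.lt_succ_iff.1 j.2
      rw [h5, mul_pow]
      have h6 : (p : ℝ) * (((j : ℕ) : ℝ) ^ 2 * a j ^ 2) * (Real.pi / (j : ℕ)) =
          p * (Real.pi * (j : ℕ) * a j ^ 2) := by
        field_simp
      rw [h6]
      gcongr
  exact (ENNReal.mul_le_mul_iff_right (by simp [hp]) (ENNReal.natCast_ne_top p)).1 h4

theorem lintegral_upper_energy_le {U : Set ℂ} (hU : IsOpen U) (hconj : ∀ z ∈ U, (starRingEnd ℂ) z ∈ U)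
    {f : ℂ → ℂ} (hf : ContDiff ℝ (⊤ : ℕ∞) f)
    (hfc : ∀ z ∈ U, f ((starRingEnd ℂ) z) = (starRingEnd ℂ) (f z))
    (hfm : MapsTo f U (ball 0 1)) (hfi : InjOn f U) {η : ℝ} (hη : 0 < η)
    (hfd : ∀ z ∈ U, ‖fderiv ℝ f z‖ ^ 2 ≤ (1 + η) * |(fderiv ℝ f z).det|)
    {k : ℕ} (a : Fin (k + 1) → ℝ) :
    2 * ∫⁻ z in U ∩ {z | 0 < z.im}, ‖fderiv ℝ (fun z => (realPoly a (f z)).re) z‖ₑ ^ 2 ≤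
      ENNReal.ofReal ((1 + η) * (Real.pi * k * ∑ j, a j ^ 2)) := by
  set Up := U ∩ {z : ℂ | 0 < z.im} with hUp
  set Um := U ∩ {z : ℂ | z.im < 0} with hUm
  have hUpm : MeasurableSet Up :=
    (hU.inter (isOpen_lt continuous_const Complex.continuous_im)).measurableSet
  have hUmm : MeasurableSet Um :=
    (hU.inter (isOpen_lt Complex.continuous_im continuous_const)).measurableSet
  set ψ : ℂ → ℝ≥0∞ := fun w => ENNReal.ofReal (‖realPolyDeriv a w‖ ^ 2) with hψ
  have h1 : ∀ z ∈ U, ‖fderiv ℝ (fun z => (realPoly a (f z)).re) z‖ₑ ^ 2 ≤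
      ENNReal.ofReal (1 + η) * (ENNReal.ofReal |(fderiv ℝ f z).det| * ψ (f z)) := by
    intro z hz
    have h2 : HasFDerivAt f (fderiv ℝ f z) z := (hf.differentiable (by simp) z).hasFDerivAt
    have h3 := Complex.reCLM.hasFDerivAt.comp z
      ((hasDerivAt_realPoly a (f z)).complexToReal_fderiv.comp z h2)
    have h4 : ‖fderiv ℝ (fun z => (realPoly a (f z)).re) z‖ ≤
        ‖realPolyDeriv a (f z)‖ * ‖fderiv ℝ f z‖ := by
      have h5 : fderiv ℝ (fun z => (realPoly a (f z)).re) z = _ := h3.fderiv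
      rw [h5]
      refine (ContinuousLinearMap.opNorm_comp_le _ _).trans ?_
      rw [Complex.reCLM_norm, one_mul]
      refine (ContinuousLinearMap.opNorm_comp_le _ _).trans ?_
      gcongr
      rw [norm_smul]
      simp
    rw [← ofReal_norm, ← ENNReal.ofReal_pow (norm_nonneg _), hψ,
      ← ENNReal.ofReal_mul (abs_nonneg _), ← ENNReal.ofReal_mul (by positivity)]
    refine ENNReal.ofReal_le_ofReal ?_
    calc _ ≤ (‖realPolyDeriv a (f z)‖ * ‖fderiv ℝ f z‖) ^ 2 := by gcongr
      _ = ‖realPolyDeriv a (f z)‖ ^ 2 * ‖fderiv ℝ f z‖ ^ 2 := mul_pow _ _ _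
      _ ≤ ‖realPolyDeriv a (f z)‖ ^ 2 * ((1 + η) * |(fderiv ℝ f z).det|) := by
        gcongr; exact hfd z hz
      _ = _ := by ring
  have hψm : Measurable ψ := by
    have := (continuous_realPolyDeriv a).measurable
    fun_prop
  have h2 : ∫⁻ z in Up, ‖fderiv ℝ (fun z => (realPoly a (f z)).re) z‖ₑ ^ 2 ≤
      ENNReal.ofReal (1 + η) * ∫⁻ w in f '' Up, ψ w := by
    rw [lintegral_image_eq_lintegral_abs_det_fderiv_mul volume hUpm
      (fun z _ => (hf.differentiable (by simp) z).hasFDerivAt.hasFDerivWithinAt)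
      (hfi.mono inter_subset_left), ← lintegral_const_mul']
    · exact setLIntegral_mono' hUpm fun z hz => h1 z hz.1
    · exact ENNReal.ofReal_ne_top
  have h3 : ∫⁻ w in f '' Up, ψ w = ∫⁻ w in f '' Um, ψ w := by
    rw [← setLIntegral_image_linearIsometryEquiv Complex.conjLIE (s := f '' Up) (t := f '' Um)]
    · simp only [hψ, Complex.conjLIE_apply, norm_realPolyDeriv_conj]
    · have key : ∀ s t : Set ℂ, s ⊆ U → (∀ z ∈ s, (starRingEnd ℂ) z ∈ t) → ∀ x ∈ f '' s,
          (starRingEnd ℂ) x ∈ f '' t := by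
        rintro s t hsU hst _ ⟨z, hz, rfl⟩
        exact ⟨_, hst z hz, hfc z (hsU hz)⟩
      intro x
      simp only [Complex.conjLIE_apply]
      constructor
      · intro h
        simpa using key Um Up inter_subset_left
          (fun z hz => ⟨hconj z hz.1, by simpa using hz.2⟩) _ h
      · exact key Up Um inter_subset_left (fun z hz => ⟨hconj z hz.1, by simpa using hz.2⟩) x
  have hdisj : Disjoint (f '' Up) (f '' Um) := by
    rw [Set.disjoint_left]
    rintro _ ⟨x, hx, rfl⟩ ⟨y, hy, hxy⟩
    have := hfi hy.1 hx.1 hxy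
    subst this
    exact lt_asymm (show 0 < y.im from hx.2) hy.2
  have h4 : 2 * ∫⁻ w in f '' Up, ψ w ≤ ∫⁻ w in ball (0 : ℂ) 1, ψ w := by
    rw [two_mul]
    nth_rewrite 2 [h3]
    rw [← lintegral_union (hUmm.image_of_continuousOn_injOn hf.continuous.continuousOn
      (hfi.mono inter_subset_left)) hdisj]
    refine lintegral_mono_set (union_subset ?_ ?_)
    · exact image_subset_iff.2 fun z hz => hfm hz.1
    · exact image_subset_iff.2 fun z hz => hfm hz.1
  calc _ ≤ 2 * (ENNReal.ofReal (1 + η) * ∫⁻ w in f '' Up, ψ w) := by gcongr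
    _ = ENNReal.ofReal (1 + η) * (2 * ∫⁻ w in f '' Up, ψ w) := by ring
    _ ≤ ENNReal.ofReal (1 + η) * ENNReal.ofReal (Real.pi * k * ∑ j, a j ^ 2) := by
      gcongr
      exact h4.trans (lintegral_ball_realPolyDeriv_le a)
    _ = _ := by rw [← ENNReal.ofReal_mul (by positivity)]

theorem le_lintegral_upper_boundary {Γ : Set ℂ} (hΓ : MeasurableSet Γ)
    {p k : ℕ} (hk : 2 * k < p) {ω : ℂ} (hω : IsPrimitiveRoot ω p)
    (hrot : ∀ z, ω * z ∈ Γ ↔ z ∈ Γ) (hconj : ∀ z ∈ Γ, (starRingEnd ℂ) z ∈ Γ)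
    (haxis : μH[1] (Γ ∩ {z | z.im = 0}) = 0)
    {f : ℂ → ℂ} (hf : Continuous f) (hfr : ∀ z ∈ Γ, f (ω * z) = ω * f z)
    (hfc : ∀ z ∈ Γ, f ((starRingEnd ℂ) z) = (starRingEnd ℂ) (f z))
    {c : ℝ} (hc0 : 0 ≤ c) (hc1 : c ≤ 1) (hfn : ∀ z ∈ Γ, c ≤ ‖f z‖) (a : Fin (k + 1) → ℝ) :
    ENNReal.ofReal (2⁻¹ * (c ^ (2 * k) * ∑ j, a j ^ 2)) * μH[1] (Γ ∩ {z | 0 < z.im}) ≤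
      ∫⁻ z in Γ ∩ {z | 0 < z.im}, ENNReal.ofReal ((realPoly a (f z)).re ^ 2) ∂μH[1] := by
  have hp0 : p ≠ 0 := by omega
  have hωn : ‖ω‖ = 1 := Complex.norm_eq_one_of_pow_eq_one hω.pow_eq_one hp0
  set h : ℂ → ℝ≥0∞ := fun z => ENNReal.ofReal ((realPoly a (f z)).re ^ 2) with hh
  have hP : Continuous (realPoly a) := by unfold realPoly; fun_prop
  have hm : Measurable h := by
    have : Continuous fun z => (realPoly a (f z)).re ^ 2 := by fun_prop
    exact ENNReal.measurable_ofReal.comp this.measurable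
  have hrotn : ∀ m : ℕ, ∀ z, ω ^ m * z ∈ Γ ↔ z ∈ Γ := by
    intro m
    induction m with
    | zero => simp
    | succ n ih => intro z; rw [pow_succ', mul_assoc, hrot, ih]
  have hfrn : ∀ m : ℕ, ∀ z ∈ Γ, f (ω ^ m * z) = ω ^ m * f z := by
    intro m
    induction m with
    | zero => simp
    | succ n ih =>
      intro z hz
      rw [pow_succ', mul_assoc, hfr _ ((hrotn n z).2 hz), ih z hz, mul_assoc]
  have h1 : ∀ m : ℕ, ∫⁻ z in Γ, h (ω ^ m * z) ∂μH[1] = ∫⁻ z in Γ, h z ∂μH[1] := by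
    intro m
    have hu : ω ^ m ∈ Submonoid.unitSphere ℂ := by simp [Submonoid.unitSphere, hωn]
    exact setLIntegral_comp_linearIsometryEquiv (rotation ⟨ω ^ m, hu⟩) (hrotn m) h
  have h2 : ∀ z ∈ Γ, (p : ℝ≥0∞) * ENNReal.ofReal (2⁻¹ * (c ^ (2 * k) * ∑ j, a j ^ 2)) ≤
      ∑ m ∈ Finset.range p, h (ω ^ m * z) := by
    intro z hz
    rw [hh, ← ENNReal.ofReal_sum_of_nonneg (fun _ _ => by positivity), ← ENNReal.ofReal_natCast p,
      ← ENNReal.ofReal_mul (by positivity)]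
    refine ENNReal.ofReal_le_ofReal ?_
    have h3 := le_sum_re_sq hk hω (fun j : Fin (k + 1) => (a j : ℂ) * f z ^ (j : ℕ)) (by simp)
    have h4 : ∀ m : ℕ, realPoly a (f (ω ^ m * z)) =
        ∑ j : Fin (k + 1), (a j : ℂ) * f z ^ (j : ℕ) * (ω ^ m) ^ (j : ℕ) := by
      intro m
      rw [hfrn m z hz, realPoly]
      refine Finset.sum_congr rfl fun j _ => ?_
      rw [mul_pow]; ring
    simp only [h4]
    refine le_trans ?_ h3
    gcongr
    rw [Finset.mul_sum]
    refine Finset.sum_le_sum fun j _ => ?_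
    rw [norm_mul, mul_pow, Complex.norm_real, Real.norm_eq_abs, sq_abs, mul_comm, norm_pow]
    gcongr
    rw [← pow_mul, mul_comm (j : ℕ)]
    calc c ^ (2 * k) ≤ c ^ (2 * (j : ℕ)) :=
          pow_le_pow_of_le_one hc0 hc1 (by have := j.2; omega)
      _ ≤ _ := by gcongr; exact hfn z hz
  have h3 : ENNReal.ofReal (2⁻¹ * (c ^ (2 * k) * ∑ j, a j ^ 2)) * μH[1] Γ ≤
      ∫⁻ z in Γ, h z ∂μH[1] := by
    have h4 : (p : ℝ≥0∞) * (ENNReal.ofReal (2⁻¹ * (c ^ (2 * k) * ∑ j, a j ^ 2)) * μH[1] Γ) ≤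
        p * ∫⁻ z in Γ, h z ∂μH[1] := by
      calc _ = ∫⁻ z in Γ, p * ENNReal.ofReal (2⁻¹ * (c ^ (2 * k) * ∑ j, a j ^ 2)) ∂μH[1] := by
            rw [setLIntegral_const, mul_assoc]
        _ ≤ ∫⁻ z in Γ, ∑ m ∈ Finset.range p, h (ω ^ m * z) ∂μH[1] := setLIntegral_mono' hΓ h2
        _ = ∑ m ∈ Finset.range p, ∫⁻ z in Γ, h (ω ^ m * z) ∂μH[1] := by
            rw [lintegral_finsetSum]
            intro m _
            exact hm.comp (measurable_const.mul measurable_id)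
        _ = _ := by simp only [h1]; simp
    exact (ENNReal.mul_le_mul_iff_right (by simpa using hp0) (ENNReal.natCast_ne_top p)).1 h4
  have hims : MeasurableSet {z : ℂ | 0 < z.im} :=
    (isOpen_lt continuous_const Complex.continuous_im).measurableSet
  have himl : MeasurableSet {z : ℂ | z.im < 0} :=
    (isOpen_lt Complex.continuous_im continuous_const).measurableSet
  have hsym : ∀ g : ℂ → ℝ≥0∞, (∀ z ∈ Γ, g ((starRingEnd ℂ) z) = g z) →
      ∫⁻ z in Γ, g z ∂μH[1] = 2 * ∫⁻ z in Γ ∩ {z | 0 < z.im}, g z ∂μH[1] := by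
    intro g hg
    have h5 : Γ = (Γ ∩ {z | z.im = 0}) ∪ ((Γ ∩ {z | 0 < z.im}) ∪ (Γ ∩ {z | z.im < 0})) := by
      ext z
      have := lt_trichotomy z.im 0
      simp only [mem_union, mem_inter_iff, mem_ofPred_eq]
      tauto
    have h6 : ∫⁻ z in Γ ∩ {z | z.im < 0}, g z ∂μH[1] = ∫⁻ z in Γ ∩ {z | 0 < z.im}, g z ∂μH[1] := by
      have h7 := (Complex.conjLIE.toIsometryEquiv.measurePreserving_hausdorffMeasure
        1).setLIntegral_comp_preimage_emb
        Complex.conjLIE.toHomeomorph.measurableEmbedding g (Γ ∩ {z | 0 < z.im})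
      have h8 : Complex.conjLIE.toIsometryEquiv ⁻¹' (Γ ∩ {z | 0 < z.im}) = Γ ∩ {z | z.im < 0} := by
        ext z
        have : (starRingEnd ℂ) z ∈ Γ ↔ z ∈ Γ :=
          ⟨fun h => by simpa using hconj _ h, hconj z⟩
        simp [this]
      rw [h8] at h7
      rw [← h7]
      refine setLIntegral_congr_fun (hΓ.inter himl) fun z hz => (hg z hz.1).symm
    have h9 : ∫⁻ z in Γ ∩ {z | z.im = 0}, g z ∂μH[1] = 0 := setLIntegral_measure_zero _ _ haxis
    conv_lhs => rw [h5]
    rw [lintegral_union ((hΓ.inter hims).union (hΓ.inter himl)), h9, zero_add,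
      lintegral_union (hΓ.inter himl), h6, two_mul]
    · rw [Set.disjoint_left]; rintro z ⟨_, h⟩ ⟨_, h'⟩; exact lt_asymm (show 0 < z.im from h) h'
    · rw [Set.disjoint_left]; rintro z ⟨_, h⟩ (⟨_, h'⟩ | ⟨_, h'⟩)
      · exact (show 0 < z.im from h').ne' h
      · exact (show z.im < 0 from h').ne h
  have h4 : μH[1] Γ = 2 * μH[1] (Γ ∩ {z | 0 < z.im}) := by
    simpa using hsym (fun _ => 1) (fun _ _ => rfl)
  have h5 : ∫⁻ z in Γ, h z ∂μH[1] = 2 * ∫⁻ z in Γ ∩ {z | 0 < z.im}, h z ∂μH[1] := by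
    refine hsym h fun z hz => ?_
    simp only [hh, hfc z hz, realPoly_conj, Complex.conj_re]
  rw [h4, h5, mul_left_comm] at h3
  exact (ENNReal.mul_le_mul_iff_right two_ne_zero ENNReal.ofNat_ne_top).1 h3

/-- The standard identification of the Euclidean plane with `ℂ`. -/
def toC : E2 ≃ₗᵢ[ℝ] ℂ := Complex.orthonormalBasisOneI.repr.symm

theorem toC_symm_zero (z : ℂ) : toC.symm z 0 = z.re := by
  simp [toC]

theorem toC_symm_one (z : ℂ) : toC.symm z 1 = z.im := by
  simp [toC]

theorem toC_re (x : E2) : (toC x).re = x 0 := by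
  rw [← toC_symm_zero, toC.symm_apply_apply]

theorem toC_im (x : E2) : (toC x).im = x 1 := by
  rw [← toC_symm_one, toC.symm_apply_apply]

theorem dirEnergy_comp_toC (s : Set ℂ) (G : ℂ → ℝ) :
    dirEnergy (toC ⁻¹' s) (G ∘ toC) = ∫⁻ z in s, ‖fderiv ℝ G z‖ₑ ^ 2 := by
  rw [← toC.measurePreserving.setLIntegral_comp_preimage_emb
    toC.toHomeomorph.measurableEmbedding, dirEnergy]
  refine lintegral_congr fun x => ?_
  have h1 : fderiv ℝ (G ∘ toC) x =
      (fderiv ℝ G (toC x)).comp (toC.toContinuousLinearEquiv : E2 →L[ℝ] ℂ) :=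
    toC.toContinuousLinearEquiv.comp_right_fderiv
  have h2 : ‖fderiv ℝ (G ∘ toC) x‖ = ‖fderiv ℝ G (toC x)‖ := by
    rw [h1]
    exact ContinuousLinearMap.opNorm_comp_linearIsometryEquiv _ toC
  congr 1
  change ‖fderiv ℝ (G ∘ toC) x‖ₑ = ‖fderiv ℝ G (toC x)‖ₑ
  rw [← ofReal_norm, ← ofReal_norm, h2]

theorem bdryInt_comp_toC (s : Set ℂ) (G : ℂ → ℝ) :
    bdryInt (toC ⁻¹' s) (fun _ => 1) (G ∘ toC) = ∫⁻ z in s, ENNReal.ofReal (G z ^ 2) ∂μH[1] := by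
  have := (toC.toIsometryEquiv.measurePreserving_hausdorffMeasure 1).setLIntegral_comp_preimage_emb
    toC.toHomeomorph.measurableEmbedding (fun z => ENNReal.ofReal (G z ^ 2)) s
  rw [← this, bdryInt]
  simp

theorem hausdorffMeasure_preimage_toC (s : Set ℂ) : μH[1] (toC ⁻¹' s) = μH[1] s :=
  toC.toIsometryEquiv.hausdorffMeasure_preimage 1 s

/-- The trial functions: real parts of real polynomials in `f`. -/
def trialMap (f : ℂ → ℂ) (k : ℕ) : (Fin (k + 1) → ℝ) →ₗ[ℝ] (E2 → ℝ) where
  toFun a := (fun z => (realPoly a (f z)).re) ∘ toC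
  map_add' a b := by
    ext x; simp [realPoly, add_mul, Finset.sum_add_distrib]
  map_smul' c a := by
    ext x
    simp [realPoly, Finset.mul_sum, mul_assoc]

theorem steklovN_mul_le_of_map {U : Set ℂ} (hU : IsOpen U) {p k : ℕ} (hk : 2 * k < p) {ω : ℂ}
    (hω : IsPrimitiveRoot ω p) (hrot : ∀ z, ω * z ∈ U ↔ z ∈ U)
    (hconj : ∀ z ∈ U, (starRingEnd ℂ) z ∈ U)
    (haxis : μH[1] (frontier U ∩ {z | z.im = 0}) = 0) (hfin : μH[1] (frontier U) ≠ ⊤)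
    {f : ℂ → ℂ} (hf : ContDiff ℝ (⊤ : ℕ∞) f) (hfr : ∀ z ∈ closure U, f (ω * z) = ω * f z)
    (hfc : ∀ z ∈ closure U, f ((starRingEnd ℂ) z) = (starRingEnd ℂ) (f z))
    (hfm : MapsTo f U (ball 0 1)) (hfi : InjOn f U) {η : ℝ} (hη : 0 < η) (hη1 : η < 1)
    (hfd : ∀ z ∈ U, ‖fderiv ℝ f z‖ ^ 2 ≤ (1 + η) * |(fderiv ℝ f z).det|)
    (hfn : ∀ z ∈ frontier U, 1 - η ≤ ‖f z‖) :
    steklovN (toC ⁻¹' (U ∩ {z | 0 < z.im})) (toC ⁻¹' (frontier U ∩ {z | 0 < z.im})) k *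
      μH[1] (toC ⁻¹' (frontier U ∩ {z | 0 < z.im})) ≤
      ENNReal.ofReal ((1 + η) * (Real.pi * k) / (1 - η) ^ (2 * k)) := by
  rw [hausdorffMeasure_preimage_toC]
  set L := μH[1] (frontier U ∩ {z : ℂ | 0 < z.im}) with hL
  have hLfin : L ≠ ⊤ := ne_top_of_le_ne_top hfin (measure_mono inter_subset_left)
  rcases eq_or_ne L 0 with hL0 | hL0
  · rw [hL0, mul_zero]; exact zero_le
  have hp0 : p ≠ 0 := by omega
  have hω0 : ω ≠ 0 := hω.ne_zero hp0
  have hrotF : ∀ z, ω * z ∈ frontier U ↔ z ∈ frontier U := by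
    intro z
    have h1 := (Homeomorph.mulLeft₀ ω hω0).preimage_frontier U
    have h2 : (Homeomorph.mulLeft₀ ω hω0) ⁻¹' U = U := Set.ext hrot
    rw [h2] at h1
    exact Set.ext_iff.1 h1 z
  have hconjF : ∀ z ∈ frontier U, (starRingEnd ℂ) z ∈ frontier U := by
    intro z hz
    have h1 := Complex.conjLIE.toHomeomorph.preimage_frontier U
    have h2 : Complex.conjLIE.toHomeomorph ⁻¹' U = U :=
      Set.ext fun x => ⟨fun h => by simpa using hconj _ h, hconj x⟩
    rw [h2] at h1
    exact (Set.ext_iff.1 h1 z).2 hz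
  set X := (1 + η) * (Real.pi * k) with hX
  set Y := (1 - η) ^ (2 * k) with hY
  have hX0 : 0 ≤ X := by positivity
  have hY0 : 0 < Y := pow_pos (by linarith) _
  have hB : ∀ a : Fin (k + 1) → ℝ, ENNReal.ofReal (2⁻¹ * (Y * ∑ j, a j ^ 2)) * L ≤
      bdryInt (toC ⁻¹' (frontier U ∩ {z | 0 < z.im})) (fun _ => 1) (trialMap f k a) := by
    intro a
    refine (le_lintegral_upper_boundary isClosed_frontier.measurableSet hk hω hrotF hconjF haxis
      hf.continuous (fun z hz => hfr z (frontier_subset_closure hz))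
      (fun z hz => hfc z (frontier_subset_closure hz)) (by linarith) (by linarith) hfn a).trans ?_
    exact (bdryInt_comp_toC _ (fun z => (realPoly a (f z)).re)).ge
  have hE : ∀ a : Fin (k + 1) → ℝ, 2 * dirEnergy (toC ⁻¹' (U ∩ {z | 0 < z.im})) (trialMap f k a) ≤
      ENNReal.ofReal (X * ∑ j, a j ^ 2) := by
    intro a
    have h1 := lintegral_upper_energy_le hU hconj hf (fun z hz => hfc z (subset_closure hz)) hfm hfi
      hη hfd a
    rw [← dirEnergy_comp_toC] at h1
    refine h1.trans (le_of_eq ?_)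
    rw [hX]; congr 1; ring
  have hzero : ∀ a : Fin (k + 1) → ℝ,
      EqOn (trialMap f k a) 0 (closure (toC ⁻¹' (U ∩ {z | 0 < z.im}))) → a = 0 := by
    intro a ha
    have hcl : toC ⁻¹' (frontier U ∩ {z | 0 < z.im}) ⊆ closure (toC ⁻¹' (U ∩ {z | 0 < z.im})) := by
      have h0 : ⇑toC = ⇑toC.toHomeomorph := rfl
      rw [h0, ← toC.toHomeomorph.preimage_closure]
      refine preimage_mono ?_
      intro z hz
      have h1 : IsOpen {z : ℂ | 0 < z.im} := isOpen_lt continuous_const Complex.continuous_im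
      have h2 := h1.inter_closure ⟨hz.2, frontier_subset_closure hz.1⟩
      rwa [inter_comm] at h2
    have h1 := hB a
    have h2 : bdryInt (toC ⁻¹' (frontier U ∩ {z | 0 < z.im})) (fun _ => 1) (trialMap f k a) = 0 := by
      rw [bdryInt, setLIntegral_congr_fun (g := fun _ => 0)
        (((isClosed_frontier.measurableSet.inter (isOpen_lt continuous_const
          Complex.continuous_im).measurableSet)).preimage toC.continuous.measurable)]
      · simp
      · intro x hx
        have := ha (hcl hx)
        simp only [Pi.zero_apply] at this
        simp [this]
    rw [h2, nonpos_iff_eq_zero, mul_eq_zero, or_iff_left hL0, ENNReal.ofReal_eq_zero] at h1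
    have h3 : ∑ j, a j ^ 2 ≤ 0 := by
      by_contra! h
      have : 0 < 2⁻¹ * (Y * ∑ j, a j ^ 2) := by positivity
      linarith
    have h4 : ∑ j, a j ^ 2 = 0 := le_antisymm h3 (by positivity)
    rw [Finset.sum_eq_zero_iff_of_nonneg (fun _ _ => by positivity)] at h4
    ext j
    simpa using h4 j (Finset.mem_univ j)
  have hinj : Function.Injective (trialMap f k) := by
    rw [← LinearMap.ker_eq_bot, LinearMap.ker_eq_bot']
    intro a ha
    exact hzero a (by rw [ha]; exact fun _ _ => rfl)
  have hmain : steklovN (toC ⁻¹' (U ∩ {z | 0 < z.im})) (toC ⁻¹' (frontier U ∩ {z | 0 < z.im})) k ≤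
      ENNReal.ofReal (X / Y) / L := by
    refine iInf_le_of_le (LinearMap.range (trialMap f k)) (iInf_le_of_le ?_ (iInf_le_of_le ?_
      (iInf_le_of_le ?_ (iInf_le_of_le ?_ ?_))))
    · rw [LinearMap.finrank_range_of_inj hinj, Module.finrank_fin_fun]
    · rintro _ ⟨a, rfl⟩
      have h1 : ContDiff ℝ (⊤ : ℕ∞) (realPoly a) := by
        unfold realPoly; fun_prop
      exact Complex.reCLM.contDiff.comp (h1.comp (hf.comp toC.contDiff))
    · simp
    · rintro _ ⟨a, rfl⟩ ha
      rw [hzero a ha, map_zero]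
    · refine iSup₂_le ?_
      rintro _ ⟨a, rfl⟩
      refine iSup_le fun _ => ?_
      refine ENNReal.div_le_of_le_mul ?_
      set S := ∑ j, a j ^ 2
      have hS : 0 ≤ S := by positivity
      have h2 : 2 * (ENNReal.ofReal (X / Y) / L * (ENNReal.ofReal (2⁻¹ * (Y * S)) * L)) =
          ENNReal.ofReal (X * S) := by
        calc _ = 2 * ENNReal.ofReal (X / Y) * ENNReal.ofReal (2⁻¹ * (Y * S)) * (L⁻¹ * L) := by
              rw [ENNReal.div_eq_inv_mul]; ring
          _ = _ := by
            rw [ENNReal.inv_mul_cancel hL0 hLfin, mul_one, ← ENNReal.ofReal_ofNat 2,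
              ← ENNReal.ofReal_mul zero_le_two, ← ENNReal.ofReal_mul (by positivity)]
            congr 1
            field_simp
      have h3 := (hE a).trans (h2.symm.le)
      have h4 := (ENNReal.mul_le_mul_iff_right two_ne_zero ENNReal.ofNat_ne_top).1 h3
      refine h4.trans ?_
      gcongr
      exact hB a
  calc _ ≤ ENNReal.ofReal (X / Y) / L * L := by gcongr
    _ ≤ _ := (ENNReal.div_mul_cancel hL0 hLfin).le

theorem steklovN_mul_le {U : Set ℂ} (hU : IsOpen U) (hs : IsSimplyConnected U)
    (hb : Bornology.IsBounded U) (h0 : (0 : ℂ) ∈ U)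
    (hg : ∀ z ∈ frontier U, ∃ v, GoodDir U z v) {p k : ℕ} (hk : 2 * k < p) {ω : ℂ}
    (hω : IsPrimitiveRoot ω p) (hrot : ∀ z, ω * z ∈ U ↔ z ∈ U)
    (hconj : ∀ z ∈ U, (starRingEnd ℂ) z ∈ U)
    (haxis : μH[1] (frontier U ∩ {z | z.im = 0}) = 0) (hfin : μH[1] (frontier U) ≠ ⊤) :
    steklovN (toC ⁻¹' (U ∩ {z | 0 < z.im})) (toC ⁻¹' (frontier U ∩ {z | 0 < z.im})) k *
      μH[1] (toC ⁻¹' (frontier U ∩ {z | 0 < z.im})) ≤ ENNReal.ofReal (k * Real.pi) := by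
  have h1 : ∀ᶠ η in 𝓝[>] (0 : ℝ),
      steklovN (toC ⁻¹' (U ∩ {z | 0 < z.im})) (toC ⁻¹' (frontier U ∩ {z | 0 < z.im})) k *
      μH[1] (toC ⁻¹' (frontier U ∩ {z | 0 < z.im})) ≤
      ENNReal.ofReal ((1 + η) * (Real.pi * k) / (1 - η) ^ (2 * k)) := by
    filter_upwards [Ioo_mem_nhdsGT (zero_lt_one (α := ℝ))] with η hη
    obtain ⟨f, hf, hfr, hfc, hfm, hfi, hfd, hfn⟩ := exists_almost_conformal_map hU hs hb h0 hg
      (by omega : 0 < p) hω.pow_eq_one (fun z hz => (hrot z).2 hz) hconj hη.1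
    exact steklovN_mul_le_of_map hU hk hω hrot hconj haxis hfin hf hfr hfc hfm hfi hη.1 hη.2 hfd hfn
  refine ge_of_tendsto ?_ h1
  refine (ENNReal.continuous_ofReal.tendsto _).comp ?_
  have h2 : ContinuousAt (fun η : ℝ => (1 + η) * (Real.pi * k) / (1 - η) ^ (2 * k)) 0 := by
    refine ContinuousAt.div (by fun_prop) (by fun_prop) (by simp)
  have h3 := h2.tendsto.mono_left (nhdsWithin_le_nhds (s := Ioi 0))
  simpa [mul_comm] using h3

theorem exists_local_graph {U : Set ℂ} (hΩ : IsLipschitzDomain (toC ⁻¹' U)) {z : ℂ}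
    (hz : z ∈ frontier U) : ∃ (E : ℂ ≃ₗᵢ[ℝ] E2) (K : ℝ≥0) (φ : ℝ → ℝ) (V : Set ℂ),
      LipschitzWith K φ ∧ IsOpen V ∧ z ∈ V ∧ (∀ x ∈ V, (x ∈ U ↔ φ (E x 0) < E x 1)) ∧
      ∀ x ∈ V ∩ closure U, φ (E x 0) ≤ E x 1 := by
  have hz' : toC.symm z ∈ frontier (toC ⁻¹' U) := by
    have h0 : ⇑toC = ⇑toC.toHomeomorph := rfl
    rw [h0, ← toC.toHomeomorph.preimage_frontier]
    simpa using hz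
  obtain ⟨e, K, φ, W, hφ, hW, hzW, h⟩ := hΩ.2.2.2 _ hz'
  have hV : IsOpen (toC.symm ⁻¹' W) := hW.preimage toC.symm.continuous
  have h1 : ∀ x ∈ toC.symm ⁻¹' W, (x ∈ U ↔ φ ((toC.symm.trans e) x 0) < (toC.symm.trans e) x 1) := by
    intro x hx
    have := h _ hx
    simpa using this
  refine ⟨toC.symm.trans e, K, φ, toC.symm ⁻¹' W, hφ, hV, hzW, h1, ?_⟩
  intro x hx
  have hcl : IsClosed {x : ℂ | φ ((toC.symm.trans e) x 0) ≤ (toC.symm.trans e) x 1} := by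
    have := hφ.continuous
    refine isClosed_le ?_ ?_ <;> fun_prop
  refine closure_minimal ?_ hcl (hV.inter_closure hx)
  rintro y ⟨hy, hyU⟩
  exact ((h1 y hy).1 hyU).le

theorem exists_goodDir {U : Set ℂ} (hΩ : IsLipschitzDomain (toC ⁻¹' U)) {z : ℂ}
    (hz : z ∈ frontier U) : ∃ v, GoodDir U z v := by
  obtain ⟨E, K, φ, V, hφ, hV, hzV, h1, h2⟩ := exists_local_graph hΩ hz
  set v : ℂ := E.symm (EuclideanSpace.single 1 1) with hv
  refine ⟨v, ?_⟩
  have t1 : Tendsto (fun q : ℂ × ℂ × ℝ => q.1) (𝓝 z ×ˢ (𝓝 v ×ˢ 𝓝[>] (0 : ℝ))) (𝓝 z) := tendsto_fst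
  have t2 : Tendsto (fun q : ℂ × ℂ × ℝ => q.2.1) (𝓝 z ×ˢ (𝓝 v ×ˢ 𝓝[>] (0 : ℝ))) (𝓝 v) :=
    tendsto_fst.comp tendsto_snd
  have t3 : Tendsto (fun q : ℂ × ℂ × ℝ => q.2.2) (𝓝 z ×ˢ (𝓝 v ×ˢ 𝓝[>] (0 : ℝ))) (𝓝[>] 0) :=
    tendsto_snd.comp tendsto_snd
  have t4 : Tendsto (fun q : ℂ × ℂ × ℝ => q.1 + q.2.2 • q.2.1)
      (𝓝 z ×ˢ (𝓝 v ×ˢ 𝓝[>] (0 : ℝ))) (𝓝 z) := by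
    simpa using t1.add ((t3.mono_right nhdsWithin_le_nhds).smul t2)
  have c0 : ContinuousAt (fun w : ℂ => K * |E w 0|) v := by fun_prop
  have c1 : ContinuousAt (fun w : ℂ => E w 1) v := by fun_prop
  have e0 : ∀ᶠ w in 𝓝 v, K * |E w 0| < 1 / 2 := c0.eventually_lt_const (by simp [hv])
  have e1 : ∀ᶠ w in 𝓝 v, 1 / 2 < E w 1 := c1.eventually_const_lt (by simp [hv]; norm_num)
  filter_upwards [t1.eventually (hV.mem_nhds hzV), t4.eventually (hV.mem_nhds hzV),
    t2.eventually e0, t2.eventually e1, t3.eventually self_mem_nhdsWithin] with q q1 q2 q3 q4 q5 hq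
  obtain ⟨y, w, t⟩ := q
  simp only at *
  have ht : 0 < t := q5
  rw [h1 _ q2]
  have h3 := h2 y ⟨q1, hq⟩
  have h4 := hφ.dist_le_mul (E y 0 + t * E w 0) (E y 0)
  rw [Real.dist_eq, Real.dist_eq, add_sub_cancel_left, abs_mul, abs_of_pos ht] at h4
  have h5 := (abs_le.1 h4).2
  simp only [map_add, map_smul, PiLp.add_apply, PiLp.smul_apply, smul_eq_mul]
  nlinarith

theorem hausdorffMeasure_frontier_ne_top {U : Set ℂ} (hΩ : IsLipschitzDomain (toC ⁻¹' U))
    (hb : Bornology.IsBounded U) : μH[1] (frontier U) ≠ ⊤ := by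
  have hc : IsCompact (frontier U) :=
    hb.isCompact_closure.of_isClosed_subset isClosed_frontier frontier_subset_closure
  have hUo : IsOpen U := by
    have := hΩ.1.preimage toC.symm.continuous
    rwa [← preimage_comp, LinearIsometryEquiv.self_comp_symm, preimage_id] at this
  refine (hc.measure_lt_top_of_nhdsWithin fun z hz => ?_).ne
  obtain ⟨E, K, φ, V, hφ, hV, hzV, h1, h2⟩ := exists_local_graph hΩ hz
  set a := E z 0
  set g : ℝ → ℂ := fun t => t • E.symm (EuclideanSpace.single 0 1) +
    φ t • E.symm (EuclideanSpace.single 1 1) with hg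
  have hgl : LipschitzWith (1 + K) g := by
    refine LipschitzWith.of_dist_le_mul fun s t => ?_
    have h3 := hφ.dist_le_mul s t
    rw [dist_eq_norm] at h3 ⊢
    have h4 : g s - g t = (s - t) • E.symm (EuclideanSpace.single 0 1) +
        (φ s - φ t) • E.symm (EuclideanSpace.single 1 1) := by
      simp only [hg, sub_smul]; abel
    rw [h4]
    refine (norm_add_le _ _).trans ?_
    rw [norm_smul, norm_smul, E.symm.norm_map, E.symm.norm_map, PiLp.norm_single,
      PiLp.norm_single]
    push_cast
    rw [dist_eq_norm] at *
    simp only [norm_one, mul_one]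
    linarith
  refine ⟨frontier U ∩ (V ∩ {x | E x 0 ∈ Ioo (a - 1) (a + 1)}), ?_, ?_⟩
  · refine inter_mem self_mem_nhdsWithin (mem_nhdsWithin_of_mem_nhds (inter_mem (hV.mem_nhds hzV) ?_))
    have : ContinuousAt (fun w : ℂ => E w 0) z := by fun_prop
    exact this (Ioo_mem_nhds (by linarith) (by linarith))
  · have hsub : frontier U ∩ (V ∩ {x | E x 0 ∈ Ioo (a - 1) (a + 1)}) ⊆ g '' Icc (a - 1) (a + 1) := by
      rintro x ⟨hx, hxV, hxa⟩
      refine ⟨E x 0, Ioo_subset_Icc_self hxa, ?_⟩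
      have h3 := h2 x ⟨hxV, frontier_subset_closure hx⟩
      have h4 : ¬ φ (E x 0) < E x 1 := by
        rw [← h1 x hxV]
        have := hx.2
        rwa [hUo.interior_eq] at this
      have h5 : φ (E x 0) = E x 1 := le_antisymm h3 (not_lt.1 h4)
      simp only [hg, h5]
      rw [← map_smul, ← map_smul, ← map_add, LinearIsometryEquiv.symm_apply_eq]
      ext i
      fin_cases i <;> simp
    refine (measure_mono hsub).trans_lt ?_
    refine ((hgl.lipschitzOnWith (s := Icc (a - 1) (a + 1))).hausdorffMeasure_image_le
      zero_le_one).trans_lt ?_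
    rw [hausdorffMeasure_real, Real.volume_Icc]
    exact ENNReal.mul_lt_top (by simp) ENNReal.ofReal_lt_top

theorem hausdorffMeasure_frontier_axis {U : Set ℂ} (hU : IsOpen U)
    (hg : ∀ z ∈ frontier U, ∃ v, GoodDir U z v) (hconj : ∀ z ∈ U, (starRingEnd ℂ) z ∈ U) {r : ℝ}
    (hr : ∀ x : ℝ, (x : ℂ) ∈ U ↔ |x| < r) : μH[1] (frontier U ∩ {z | z.im = 0}) = 0 := by
  have hsub : frontier U ∩ {z : ℂ | z.im = 0} ⊆ {(r : ℂ), ((-r : ℝ) : ℂ)} := by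
    rintro z ⟨hz, him⟩
    obtain ⟨x, rfl⟩ : ∃ x : ℝ, (x : ℂ) = z := ⟨z.re, Complex.ext (by simp) (by simpa using him.symm)⟩
    obtain ⟨v, hv⟩ := hg _ hz
    have h1 : ¬ |x| < r := by
      rw [← hr]
      have := hz.2
      rwa [hU.interior_eq] at this
    have hv' := hv.map Complex.conjCLE (fun x =>
      ⟨fun h => by simpa using hconj _ h, fun h => by simpa using hconj _ h⟩)
    have h2 : Complex.conjCLE (x : ℂ) = x := by simp
    rw [h2] at hv'
    have hw := hv.add hv'
    have h3 : v + Complex.conjCLE v = ((2 * v.re : ℝ) : ℂ) := by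
      simp [Complex.add_conj]
    rw [h3] at hw
    set u := 2 * v.re
    have t1 : Tendsto (fun t : ℝ => ((x : ℂ), (u : ℂ), t)) (𝓝[>] 0)
        (𝓝 (x : ℂ) ×ˢ (𝓝 (u : ℂ) ×ˢ 𝓝[>] (0 : ℝ))) :=
      tendsto_const_nhds.prodMk (tendsto_const_nhds.prodMk tendsto_id)
    have h4 : ∀ᶠ t in 𝓝[>] (0 : ℝ), |x + t * u| < r := by
      filter_upwards [t1.eventually hw] with t ht
      have := ht (frontier_subset_closure hz)
      rw [← hr]
      simpa using this
    have h5 : Tendsto (fun t : ℝ => |x + t * u|) (𝓝[>] 0) (𝓝 |x|) := by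
      have : ContinuousAt (fun t : ℝ => |x + t * u|) 0 := by fun_prop
      simpa using this.tendsto.mono_left (nhdsWithin_le_nhds (s := Ioi 0))
    have h6 : |x| ≤ r := le_of_tendsto h5 (h4.mono fun t ht => ht.le)
    have h7 : |x| = r := le_antisymm h6 (not_lt.1 h1)
    rcases abs_choice x with h | h
    · left; rw [← h7, h]
    · right
      rw [mem_singleton_iff, ← h7, h]; simp
  have := Measure.nullSingletonClass_hausdorff ℂ zero_lt_one
  exact measure_mono_null hsub (((finite_singleton _).insert _).measure_zero _)

theorem toC_rotBy (θ : ℝ) (x : E2) : toC (rotBy θ x) = Complex.exp (θ * Complex.I) * toC x := by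
  apply Complex.ext <;>
    simp [rotBy, toC_re, toC_im, Complex.exp_ofReal_mul_I_re, Complex.exp_ofReal_mul_I_im] <;> ring

theorem toC_reflX (x : E2) : toC (reflX x) = (starRingEnd ℂ) (toC x) := by
  apply Complex.ext <;> simp [reflX, toC_re, toC_im]

theorem SfrakP_le {p k : ℕ} (hp : 2 ≤ p) (hk : k ≤ (p + 1) / 2 - 1) :
    SfrakP p k ≤ ENNReal.ofReal (k * Real.pi) := by
  refine iSup₂_le fun Ωt hΩ => ?_
  obtain ⟨U, rfl⟩ : ∃ U : Set ℂ, Ωt = toC ⁻¹' U := ⟨toC '' Ωt, by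
    rw [preimage_image_eq _ toC.injective]⟩
  obtain ⟨hL, hs, hrot, hrefl, r, hr0, hr⟩ := hΩ
  have hU : IsOpen U := by
    have := hL.1
    exact toC.toHomeomorph.isOpen_preimage.1 this
  have hsU : IsSimplyConnected U := toC.toHomeomorph.isSimplyConnected_preimage.1 hs
  have hb : Bornology.IsBounded U := by
    have := toC.lipschitz.isBounded_image hL.2.2.1
    rwa [image_preimage_eq _ toC.surjective] at this
  have hrU : ∀ x : ℝ, (x : ℂ) ∈ U ↔ |x| < r := by
    intro x
    have h := Set.ext_iff.1 hr (toC.symm x)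
    simpa [toC_symm_zero, toC_symm_one, abs_lt] using h
  have hrotU : ∀ z, Complex.exp (2 * Real.pi * Complex.I / p) * z ∈ U ↔ z ∈ U := by
    have key : ∀ z, Complex.exp (2 * Real.pi * Complex.I / p) * z
        = toC (rotBy (2 * Real.pi / p) (toC.symm z)) := by
      intro z
      rw [toC_rotBy]
      push_cast
      simp
      left
      ring_nf
    have hinj : Function.Injective (rotBy (2 * Real.pi / p)) := by
      intro x y h
      have := congrArg toC h
      rw [toC_rotBy, toC_rotBy] at this
      exact toC.injective (mul_left_cancel₀ (Complex.exp_ne_zero _) this)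
    intro z
    rw [key]
    have : rotBy (2 * Real.pi / p) (toC.symm z) ∈ toC ⁻¹' U ↔ toC.symm z ∈ toC ⁻¹' U := by
      conv_lhs => rw [← hrot]
      exact hinj.mem_set_image
    simpa using this
  have hconj : ∀ z ∈ U, (starRingEnd ℂ) z ∈ U := by
    intro z hz
    have : reflX (toC.symm z) ∈ toC ⁻¹' U := by
      rw [← hrefl]
      exact mem_image_of_mem _ (by simpa using hz)
    simpa [toC_reflX] using this
  have hfr : frontier (toC ⁻¹' U) = toC ⁻¹' frontier U := (toC.toHomeomorph.preimage_frontier U).symm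
  have e1 : toC ⁻¹' U ∩ {x : E2 | 0 < x 1} = toC ⁻¹' (U ∩ {z | 0 < z.im}) := by
    ext x; simp [toC_im]
  have e2 : frontier (toC ⁻¹' U) ∩ {x : E2 | 0 < x 1} = toC ⁻¹' (frontier U ∩ {z | 0 < z.im}) := by
    rw [hfr]; ext x; simp [toC_im]
  rw [e1, e2]
  have hg : ∀ z ∈ frontier U, ∃ v, GoodDir U z v := fun z hz => exists_goodDir hL hz
  exact steklovN_mul_le hU hsU hb (by simpa using (hrU 0).2 (by simpa using hr0)) hg (by omega)
    (Complex.isPrimitiveRoot_exp p (by omega)) hrotU hconj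
    (hausdorffMeasure_frontier_axis hU hg hconj hrU) (hausdorffMeasure_frontier_ne_top hL hb)

theorem steklovN_congr_ae {Ω Γ Γ' : Set E2} (h : Γ =ᵐ[μH[1]] Γ') (k : ℕ) :
    steklovN Ω Γ k = steklovN Ω Γ' k := by
  simp only [steklovN, steklovMixed, rayleigh, bdryInt, Measure.restrict_congr_set h]

theorem rotBy_image_ball (θ : ℝ) : rotBy θ '' (toC ⁻¹' ball 0 1) = toC ⁻¹' ball 0 1 := by
  have hn : ∀ θ x, ‖toC (rotBy θ x)‖ = ‖toC x‖ := fun θ x => by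
    rw [toC_rotBy, norm_mul, Complex.norm_exp_ofReal_mul_I, one_mul]
  apply subset_antisymm
  · rintro _ ⟨x, hx, rfl⟩
    simp only [mem_preimage, mem_ball_zero_iff, hn] at hx ⊢
    exact hx
  · intro x hx
    refine ⟨rotBy (-θ) x, ?_, toC.injective ?_⟩
    · simp only [mem_preimage, mem_ball_zero_iff, hn] at hx ⊢
      exact hx
    · rw [toC_rotBy, toC_rotBy, ← mul_assoc, ← Complex.exp_add]
      simp

theorem reflX_image_ball : reflX '' (toC ⁻¹' ball 0 1) = toC ⁻¹' ball 0 1 := by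
  have hn : ∀ x, ‖toC (reflX x)‖ = ‖toC x‖ := fun x => by
    rw [toC_reflX, RCLike.norm_conj]
  apply subset_antisymm
  · rintro _ ⟨x, hx, rfl⟩
    simp only [mem_preimage, mem_ball_zero_iff, hn] at hx ⊢
    exact hx
  · intro x hx
    refine ⟨reflX x, ?_, toC.injective ?_⟩
    · simp only [mem_preimage, mem_ball_zero_iff, hn] at hx ⊢
      exact hx
    · rw [toC_reflX, toC_reflX, Complex.conj_conj]

theorem lipschitzWith_neg_sqrt_clip : LipschitzWith 1
    fun t : ℝ => -√(1 - (max (-(1 / 2)) (min t (1 / 2))) ^ 2) := by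
  have hc : LipschitzWith 1 fun t : ℝ => max (-(1 / 2)) (min t (1 / 2)) :=
    (LipschitzWith.id.min_const _).const_max _
  refine LipschitzWith.of_dist_le_mul fun s t => ?_
  have h := hc.dist_le_mul s t
  simp only [NNReal.coe_one, one_mul, Real.dist_eq] at h ⊢
  refine le_trans ?_ h
  have hb : ∀ t : ℝ, |max (-(1 / 2)) (min t (1 / 2))| ≤ 1 / 2 := fun t =>
    abs_le.2 ⟨le_max_left _ _, max_le (by norm_num) (min_le_right _ _)⟩
  have h1 := hb s
  have h2 := hb t
  generalize max (-(1 / 2)) (min s (1 / 2)) = a at h1 ⊢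
  generalize max (-(1 / 2)) (min t (1 / 2)) = b at h2 ⊢
  rw [abs_le] at h1 h2
  have ha : 1 / 2 ≤ √(1 - a ^ 2) := Real.le_sqrt_of_sq_le (by nlinarith)
  have hb : 1 / 2 ≤ √(1 - b ^ 2) := Real.le_sqrt_of_sq_le (by nlinarith)
  have ea := Real.sq_sqrt (show 0 ≤ 1 - a ^ 2 by nlinarith)
  have eb := Real.sq_sqrt (show 0 ≤ 1 - b ^ 2 by nlinarith)
  have key : |(-√(1 - a ^ 2) - -√(1 - b ^ 2)) * (√(1 - a ^ 2) + √(1 - b ^ 2))| ≤ |a - b| := by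
    have : (-√(1 - a ^ 2) - -√(1 - b ^ 2)) * (√(1 - a ^ 2) + √(1 - b ^ 2))
        = (a - b) * (a + b) := by linear_combination eb - ea
    rw [this, abs_mul]
    exact mul_le_of_le_one_right (abs_nonneg _) (abs_le.2 ⟨by linarith, by linarith⟩)
  rw [abs_mul, abs_of_nonneg (by linarith : 0 ≤ √(1 - a ^ 2) + √(1 - b ^ 2))] at key
  exact le_trans (le_mul_of_one_le_right (abs_nonneg _) (by linarith)) key

theorem isLipschitzDomain_ball : IsLipschitzDomain (toC ⁻¹' ball 0 1) := by
  have hball : toC ⁻¹' ball 0 1 = ball (0 : E2) 1 := by ext x; simp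
  refine ⟨isOpen_ball.preimage toC.continuous, ?_, ?_, ?_⟩
  · rw [hball]
    exact (convex_ball _ _).isConnected ⟨0, by simp⟩
  · rw [hball]
    exact isBounded_ball
  · intro q hq
    rw [hball, frontier_ball _ one_ne_zero, mem_sphere_zero_iff_norm] at hq
    have hq' : ‖toC q‖ = 1 := by simpa using hq
    have hc : ‖-Complex.I * (starRingEnd ℂ) (toC q)‖ = 1 := by
      simp [hq]
    set c : Circle := ⟨_, mem_sphere_zero_iff_norm.2 hc⟩ with hcdef
    set e : E2 ≃ₗᵢ[ℝ] E2 := (toC.trans (rotation c)).trans toC.symm with he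
    have h0 : ∀ x, e x 0 = ((c : ℂ) * toC x).re := fun x => by
      simp [he, toC_symm_zero]
    have h1 : ∀ x, e x 1 = ((c : ℂ) * toC x).im := fun x => by
      simp [he, toC_symm_one]
    have hn : ∀ x, x ∈ toC ⁻¹' ball 0 1 ↔ (e x 0) ^ 2 + (e x 1) ^ 2 < 1 := fun x => by
      have : (e x 0) ^ 2 + (e x 1) ^ 2 = ‖toC x‖ ^ 2 := by
        rw [h0, h1, ← one_mul ‖toC x‖, ← Circle.norm_coe c, ← norm_mul, ← Complex.normSq_eq_norm_sq,
          Complex.normSq_apply]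
        ring
      rw [this, sq_lt_one_iff₀ (norm_nonneg _)]
      simp
    have hcq : (c : ℂ) * toC q = -Complex.I := by
      change -Complex.I * (starRingEnd ℂ) (toC q) * toC q = -Complex.I
      rw [mul_assoc, mul_comm ((starRingEnd ℂ) _), Complex.mul_conj, Complex.normSq_eq_norm_sq, hq']
      simp
    have hcont : ∀ i, Continuous fun x => e x i := fun i =>
      (EuclideanSpace.proj (𝕜 := ℝ) i).continuous.comp e.continuous
    refine ⟨e, 1, _, {x | |e x 0| < 1 / 2} ∩ {x | e x 1 < 0}, lipschitzWith_neg_sqrt_clip,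
      (isOpen_lt (hcont 0).abs continuous_const).inter (isOpen_lt (hcont 1) continuous_const),
      ⟨?_, ?_⟩, ?_⟩
    · show |e q 0| < 1 / 2
      rw [h0, hcq]; simp
    · show e q 1 < 0
      rw [h1, hcq]; simp
    · rintro x ⟨ha, hb⟩
      have ha : |e x 0| < 1 / 2 := ha
      have hb : e x 1 < 0 := hb
      rw [abs_lt] at ha
      rw [hn, min_eq_left ha.2.le, max_eq_right ha.1.le, neg_lt, Real.lt_sqrt (by linarith)]
      constructor <;> intro h <;> linarith [neg_sq (e x 1)]

theorem memFrakDp_ball (p : ℕ) : MemFrakDp p (toC ⁻¹' ball 0 1) := by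
  refine ⟨isLipschitzDomain_ball, ?_, rotBy_image_ball _, reflX_image_ball, 1, one_pos, ?_⟩
  · have hball : toC ⁻¹' ball 0 1 = ball (0 : E2) 1 := by ext x; simp
    rw [hball]
    have := (convex_ball (0 : E2) 1).contractibleSpace ⟨0, by simp⟩
    infer_instance
  · ext x
    have : x 1 = 0 → (‖toC x‖ < 1 ↔ -1 < x 0 ∧ x 0 < 1) := fun h => by
      have h2 : toC x = (x 0 : ℝ) := Complex.ext (by simp [toC_re]) (by simp [toC_im, h])
      rw [h2, Complex.norm_real, Real.norm_eq_abs, abs_lt]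
    simp only [mem_inter_iff, mem_preimage, mem_ball_zero_iff, Set.mem_ofPred_eq]
    tauto

theorem toC_norm_sq (x : E2) : ‖toC x‖ ^ 2 = x 0 ^ 2 + x 1 ^ 2 := by
  rw [← Complex.normSq_eq_norm_sq, Complex.normSq_apply, toC_re, toC_im]; ring

theorem upperHalfDisk_eq : upperHalfDisk = toC ⁻¹' (ball 0 1 ∩ {z | 0 < z.im}) := by
  ext x
  simp only [upperHalfDisk, mem_preimage, mem_inter_iff, mem_ball_zero_iff, Set.mem_ofPred_eq, toC_im]
  rw [← toC_norm_sq, sq_lt_one_iff₀ (norm_nonneg _)]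

theorem upperSemicircle_eq : upperSemicircle = toC ⁻¹' (sphere 0 1 ∩ {z | 0 ≤ z.im}) := by
  ext x
  simp only [upperSemicircle, mem_preimage, mem_inter_iff, mem_sphere_zero_iff_norm,
    Set.mem_ofPred_eq, toC_im]
  rw [← toC_norm_sq, pow_eq_one_iff_of_nonneg (norm_nonneg _) two_ne_zero]

theorem frontier_ball_inter_ae_eq :
    (frontier (toC ⁻¹' ball 0 1) ∩ {x : E2 | 0 < x 1} : Set E2) =ᵐ[μH[1]] upperSemicircle := by
  have h1 : frontier (toC ⁻¹' ball 0 1) = toC ⁻¹' sphere 0 1 := by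
    rw [← frontier_ball (0 : ℂ) one_ne_zero]
    exact (toC.toHomeomorph.preimage_frontier _).symm
  have h2 : upperSemicircle \ (frontier (toC ⁻¹' ball 0 1) ∩ {x : E2 | 0 < x 1})
      ⊆ {toC.symm 1, toC.symm (-1)} := by
    rw [h1]
    rintro x ⟨⟨h, him⟩, hx⟩
    have h3 : x 1 = 0 := by
      refine le_antisymm (not_lt.1 fun h4 => hx ⟨?_, h4⟩) him
      rw [mem_preimage, mem_sphere_zero_iff_norm, ← pow_eq_one_iff_of_nonneg (norm_nonneg _)
        two_ne_zero, toC_norm_sq, h]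
    have h4 : x 0 = 1 ∨ x 0 = -1 := mul_self_eq_one_iff.1 (by simpa [h3, sq] using h)
    rcases h4 with h4 | h4
    · left
      apply toC.injective
      apply Complex.ext <;> simp [toC_re, toC_im, h3, h4]
    · right
      apply toC.injective
      apply Complex.ext <;> simp [toC_re, toC_im, h3, h4]
  have := Measure.nullSingletonClass_hausdorff E2 zero_lt_one
  refine ae_eq_set.2 ⟨?_, measure_mono_null h2 (((finite_singleton _).insert _).measure_zero _)⟩
  rw [sdiff_eq_empty.2, measure_empty]
  rw [h1, upperSemicircle_eq]
  rintro x ⟨hx, h⟩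
  exact ⟨hx, by rw [Set.mem_ofPred_eq, toC_im]; exact le_of_lt h⟩

theorem le_SfrakP_halfDisk (p k : ℕ) :
    steklovN upperHalfDisk upperSemicircle k * μH[1] upperSemicircle ≤ SfrakP p k := by
  have h : toC ⁻¹' ball 0 1 ∩ {x : E2 | 0 < x 1} = upperHalfDisk := by
    rw [upperHalfDisk_eq]; ext x; simp [toC_im]
  refine le_trans (le_of_eq ?_) (le_iSup₂ (toC ⁻¹' ball 0 1) (memFrakDp_ball p))
  rw [h, steklovN_congr_ae frontier_ball_inter_ae_eq, measure_congr frontier_ball_inter_ae_eq]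

theorem circleMap_mem_upper {θ : ℝ} (h : θ ∈ Icc 0 Real.pi) :
    circleMap 0 1 θ ∈ sphere (0 : ℂ) 1 ∩ {z | 0 ≤ z.im} := by
  refine ⟨by simp, ?_⟩
  rw [Set.mem_ofPred_eq, circleMap_zero]
  simpa [Complex.exp_ofReal_mul_I_im] using Real.sin_nonneg_of_mem_Icc h

theorem circleMap_arg {z : ℂ} (hz : ‖z‖ = 1) : circleMap 0 1 z.arg = z := by
  rw [circleMap_zero]
  simpa [hz] using Complex.norm_mul_exp_arg_mul_I z

theorem setLIntegral_upper_sphere_le {h : ℂ → ℝ≥0∞} (hh : Measurable h) :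
    ∫⁻ z in sphere 0 1 ∩ {z | 0 ≤ z.im}, h z ∂μH[1]
      ≤ ∫⁻ θ in Icc 0 Real.pi, h (circleMap 0 1 θ) := by
  have hm : Measurable (circleMap 0 1) := (continuous_circleMap 0 1).measurable
  have hle : (μH[1] : Measure ℂ).restrict (sphere 0 1 ∩ {z | 0 ≤ z.im})
      ≤ (volume.restrict (Icc 0 Real.pi)).map (circleMap 0 1) := by
    refine Measure.le_iff.2 fun A hA => ?_
    rw [Measure.restrict_apply hA, Measure.map_apply hm hA, Measure.restrict_apply (hm hA)]
    have hsub : A ∩ (sphere 0 1 ∩ {z | 0 ≤ z.im})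
        ⊆ circleMap 0 1 '' (circleMap 0 1 ⁻¹' A ∩ Icc 0 Real.pi) := by
      rintro z ⟨hzA, hz, him⟩
      have hc := circleMap_arg (mem_sphere_zero_iff_norm.1 hz)
      exact ⟨z.arg, ⟨by rwa [mem_preimage, hc], Complex.arg_nonneg_iff.2 him, Complex.arg_le_pi z⟩, hc⟩
    refine (measure_mono hsub).trans ?_
    have := (lipschitzWith_circleMap 0 1).hausdorffMeasure_image_le (d := 1) zero_le_one
      (circleMap 0 1 ⁻¹' A ∩ Icc 0 Real.pi)
    simpa [hausdorffMeasure_real] using this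
  refine (lintegral_mono' hle le_rfl).trans ?_
  rw [lintegral_map hh hm]

theorem ofReal_two_mul_sin_le_hausdorffMeasure (φ : ℝ) {δ : ℝ} (hδ0 : 0 ≤ δ)
    (hδ : δ ≤ Real.pi / 2) :
    ENNReal.ofReal (2 * Real.sin δ) ≤ μH[1] (circleMap 0 1 '' Ico (φ - δ) (φ + δ)) := by
  set P : ℂ → ℝ := fun z => (Complex.exp (-φ * Complex.I) * z).im
  have hP : LipschitzWith 1 P := LipschitzWith.of_dist_le_mul fun z w => by
    simp only [P, NNReal.coe_one, one_mul, Real.dist_eq, ← Complex.sub_im, ← mul_sub]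
    refine (Complex.abs_im_le_norm _).trans ?_
    rw [norm_mul, dist_eq_norm]
    have : ‖Complex.exp (-φ * Complex.I)‖ = 1 := by
      simpa using Complex.norm_exp_ofReal_mul_I (-φ)
    rw [this, one_mul]
  have hsub : Ico (-Real.sin δ) (Real.sin δ) ⊆ P '' (circleMap 0 1 '' Ico (φ - δ) (φ + δ)) := by
    intro y hy
    have h1 : Real.sin δ ≤ 1 := Real.sin_le_one δ
    refine ⟨_, ⟨φ + Real.arcsin y, ⟨?_, ?_⟩, rfl⟩, ?_⟩
    · have : -δ ≤ Real.arcsin y := by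
        rw [Real.le_arcsin_iff_sin_le ⟨by linarith, by linarith⟩ ⟨by linarith [hy.1], by linarith [hy.2]⟩,
          Real.sin_neg]
        exact hy.1
      linarith
    · have : Real.arcsin y < δ := by
        rw [Real.arcsin_lt_iff_lt_sin ⟨by linarith [hy.1], by linarith [hy.2]⟩
          ⟨by linarith, by linarith⟩]
        exact hy.2
      linarith
    · simp only [P, circleMap_zero, Complex.ofReal_one, one_mul]
      rw [← Complex.exp_add]
      have : -(φ : ℂ) * Complex.I + ((φ + Real.arcsin y : ℝ) : ℂ) * Complex.I
          = (Real.arcsin y : ℝ) * Complex.I := by push_cast; ring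
      rw [this, Complex.exp_ofReal_mul_I_im, Real.sin_arcsin (by linarith [hy.1]) (by linarith [hy.2])]
  have h2 := (measure_mono (μ := μH[1]) hsub).trans (hP.hausdorffMeasure_image_le zero_le_one _)
  rw [hausdorffMeasure_real, Real.volume_Ico] at h2
  rw [two_mul]
  simpa using h2

theorem pi_le_hausdorffMeasure_upper_sphere :
    ENNReal.ofReal Real.pi ≤ μH[1] (sphere (0 : ℂ) 1 ∩ {z | 0 ≤ z.im}) := by
  have hpi := Real.pi_pos
  have hstep : ∀ n : ℕ, 1 ≤ n → ENNReal.ofReal (n * (2 * Real.sin (Real.pi / (2 * n))))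
      ≤ μH[1] (sphere (0 : ℂ) 1 ∩ {z | 0 ≤ z.im}) := by
    intro n hn
    have hn' : (1 : ℝ) ≤ n := by exact_mod_cast hn
    set δ := Real.pi / (2 * n) with hδ
    have hδ0 : 0 ≤ δ := by positivity
    have hδn : 2 * n * δ = Real.pi := by rw [hδ]; field_simp
    set J : ℕ → Set ℝ := fun i => Ico ((2 * i + 1) * δ - δ) ((2 * i + 1) * δ + δ) with hJ
    have hJsub : ∀ i < n, J i ⊆ Ico 0 Real.pi := by
      intro i hi t ht
      have hi' : (i : ℝ) + 1 ≤ n := by exact_mod_cast hi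
      refine ⟨le_trans ?_ ht.1, ht.2.trans_le ?_⟩
      · have : (0 : ℝ) ≤ i * δ := by positivity
        linarith
      · nlinarith
    have hinj : InjOn (circleMap 0 1) (Ico 0 Real.pi) :=
      (injOn_circleMap_of_abs_sub_le' one_ne_zero (by simpa using by linarith))
    have hdis : Set.PairwiseDisjoint (Finset.range n : Set ℕ) fun i => circleMap 0 1 '' J i := by
      intro i hi j hj hij
      refine Disjoint.image ?_ hinj (hJsub i (by simpa using hi)) (hJsub j (by simpa using hj))
      rw [Ico_disjoint_Ico]
      rcases lt_or_gt_of_ne hij with h | h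
      · have h' : (i : ℝ) + 1 ≤ j := by exact_mod_cast h
        exact (min_le_left _ _).trans (le_trans (by nlinarith) (le_max_right _ _))
      · have h' : (j : ℝ) + 1 ≤ i := by exact_mod_cast h
        exact (min_le_right _ _).trans (le_trans (by nlinarith) (le_max_left _ _))
    have hmeas : ∀ i ∈ Finset.range n, MeasurableSet (circleMap 0 1 '' J i) := fun i hi =>
      measurableSet_Ico.image_of_continuousOn_injOn (continuous_circleMap 0 1).continuousOn
        (hinj.mono (hJsub i (by simpa using hi)))
    have hsub : ⋃ i ∈ Finset.range n, circleMap 0 1 '' J i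
        ⊆ sphere (0 : ℂ) 1 ∩ {z | 0 ≤ z.im} := by
      refine iUnion₂_subset fun i hi => ?_
      rintro _ ⟨t, ht, rfl⟩
      exact circleMap_mem_upper (Ico_subset_Icc_self (hJsub i (by simpa using hi) ht))
    calc ENNReal.ofReal (n * (2 * Real.sin δ))
        = ∑ i ∈ Finset.range n, ENNReal.ofReal (2 * Real.sin δ) := by
          rw [Finset.sum_const, Finset.card_range, nsmul_eq_mul, ENNReal.ofReal_mul (by positivity),
            ENNReal.ofReal_natCast]
      _ ≤ ∑ i ∈ Finset.range n, μH[1] (circleMap 0 1 '' J i) :=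
          Finset.sum_le_sum fun i _ => ofReal_two_mul_sin_le_hausdorffMeasure _ hδ0 (by nlinarith)
      _ = μH[1] (⋃ i ∈ Finset.range n, circleMap 0 1 '' J i) :=
          (measure_biUnion_finset hdis hmeas).symm
      _ ≤ _ := measure_mono hsub
  have hlim : Tendsto (fun n : ℕ => ENNReal.ofReal (Real.pi - 2 / n)) atTop
      (𝓝 (ENNReal.ofReal Real.pi)) := by
    refine ENNReal.tendsto_ofReal ?_
    simpa using tendsto_const_nhds.sub (tendsto_const_div_atTop_nhds_zero_nat (2 : ℝ))
  refine le_of_tendsto hlim ?_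
  filter_upwards [eventually_ge_atTop 2] with n hn
  refine le_trans (ENNReal.ofReal_le_ofReal ?_) (hstep n (by omega))
  have hn' : (2 : ℝ) ≤ n := by exact_mod_cast hn
  have h4 : Real.pi ≤ 4 := Real.pi_le_four
  have h3 : Real.pi ≤ 3.15 := Real.pi_lt_d2.le
  set x := Real.pi / (2 * n) with hx
  have hx0 : 0 < x := by positivity
  have hxn : 2 * n * x = Real.pi := by rw [hx]; field_simp
  have hx1 : x ≤ 1 := by nlinarith
  have hs := Real.sin_gt_sub_cube hx0
  have e1 : 2 / (n : ℝ) = 4 * x / Real.pi := by rw [← hxn]; field_simp; norm_num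
  rw [e1]
  have e2 : Real.pi * x ^ 2 / 4 ≤ 4 * x / Real.pi := by
    rw [div_le_div_iff₀ (by norm_num) hpi]
    have : Real.pi ^ 2 ≤ 16 := by nlinarith
    have : x * x ≤ x := by nlinarith
    nlinarith
  have e3 : n * (2 * (x - x ^ 3 / 6)) = Real.pi - Real.pi * x ^ 2 / 6 := by
    linear_combination (1 - x ^ 2 / 6) * hxn
  have e4 : n * (2 * (x - x ^ 3 / 6)) ≤ n * (2 * Real.sin x) := by gcongr
  have e5 : 0 ≤ Real.pi * x ^ 2 := by positivity
  linarith

theorem integral_cos_int_mul {m : ℤ} (hm : m ≠ 0) : ∫ θ in (0 : ℝ)..Real.pi, Real.cos (m * θ) = 0 := by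
  have hm' : (m : ℝ) ≠ 0 := Int.cast_ne_zero.2 hm
  rw [intervalIntegral.integral_comp_mul_left _ hm', integral_cos]
  simp [Real.sin_int_mul_pi]

theorem integral_cos_mul_cos {i j : ℕ} (hij : i ≠ j) :
    ∫ θ in (0 : ℝ)..Real.pi, Real.cos (i * θ) * Real.cos (j * θ) = 0 := by
  have h : ∀ θ : ℝ, Real.cos (i * θ) * Real.cos (j * θ)
      = 1 / 2 * (Real.cos (((i - j : ℤ) : ℝ) * θ) + Real.cos (((i + j : ℤ) : ℝ) * θ)) := fun θ => by
    push_cast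
    rw [sub_mul, add_mul, Real.cos_sub, Real.cos_add]; ring
  simp_rw [h]
  rw [intervalIntegral.integral_const_mul, intervalIntegral.integral_add
    (by apply Continuous.intervalIntegrable; fun_prop) (by apply Continuous.intervalIntegrable; fun_prop),
    integral_cos_int_mul (by omega), integral_cos_int_mul (by omega)]
  simp

theorem integral_sin_mul_sin {i j : ℕ} (hij : i ≠ j) :
    ∫ θ in (0 : ℝ)..Real.pi, Real.sin (i * θ) * Real.sin (j * θ) = 0 := by
  have h : ∀ θ : ℝ, Real.sin (i * θ) * Real.sin (j * θ)
      = 1 / 2 * (Real.cos (((i - j : ℤ) : ℝ) * θ) - Real.cos (((i + j : ℤ) : ℝ) * θ)) := fun θ => by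
    push_cast
    rw [sub_mul, add_mul, Real.cos_sub, Real.cos_add]; ring
  simp_rw [h]
  rw [intervalIntegral.integral_const_mul, intervalIntegral.integral_sub
    (by apply Continuous.intervalIntegrable; fun_prop) (by apply Continuous.intervalIntegrable; fun_prop),
    integral_cos_int_mul (by omega), integral_cos_int_mul (by omega)]
  simp

theorem integral_cos_mul_self {j : ℕ} (hj : j ≠ 0) :
    ∫ θ in (0 : ℝ)..Real.pi, Real.cos (j * θ) * Real.cos (j * θ) = Real.pi / 2 := by
  have h : ∀ θ : ℝ, Real.cos (j * θ) * Real.cos (j * θ)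
      = 1 / 2 * (1 + Real.cos (((2 * j : ℤ) : ℝ) * θ)) := fun θ => by
    push_cast
    rw [mul_assoc, Real.cos_two_mul]; ring
  simp_rw [h]
  rw [intervalIntegral.integral_const_mul, intervalIntegral.integral_add
    (by simp) (by apply Continuous.intervalIntegrable; fun_prop),
    integral_cos_int_mul (by omega)]
  simp; ring

theorem integral_sin_mul_self {j : ℕ} (hj : j ≠ 0) :
    ∫ θ in (0 : ℝ)..Real.pi, Real.sin (j * θ) * Real.sin (j * θ) = Real.pi / 2 := by
  have h : ∀ θ : ℝ, Real.sin (j * θ) * Real.sin (j * θ)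
      = 1 / 2 * (1 - Real.cos (((2 * j : ℤ) : ℝ) * θ)) := fun θ => by
    push_cast
    rw [mul_assoc, Real.cos_two_mul, Real.cos_sq']; ring
  simp_rw [h]
  rw [intervalIntegral.integral_const_mul, intervalIntegral.integral_sub
    (by simp) (by apply Continuous.intervalIntegrable; fun_prop),
    integral_cos_int_mul (by omega)]
  simp; ring

theorem integral_sub_sum_sq {u : ℝ → ℝ} (hu : Continuous u) {e : ℕ → ℝ → ℝ}
    (he : ∀ j, Continuous (e j)) {a b : ℝ}
    (horth : ∀ i j, i ≠ j → ∫ θ in a..b, e i θ * e j θ = 0) (s : Finset ℕ) (c : ℕ → ℝ) :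
    ∫ θ in a..b, (u θ - ∑ j ∈ s, c j * e j θ) ^ 2
      = (∫ θ in a..b, u θ ^ 2)
        + ∑ j ∈ s, (c j ^ 2 * (∫ θ in a..b, e j θ * e j θ) - 2 * c j * ∫ θ in a..b, u θ * e j θ) := by
  have h : ∀ θ, (u θ - ∑ j ∈ s, c j * e j θ) ^ 2 = u θ ^ 2 +
      ((∑ i ∈ s, ∑ j ∈ s, c i * c j * (e i θ * e j θ)) - ∑ j ∈ s, 2 * c j * (u θ * e j θ)) := by
    intro θ
    have h1 : ∑ i ∈ s, ∑ j ∈ s, c i * c j * (e i θ * e j θ)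
        = (∑ j ∈ s, c j * e j θ) * ∑ j ∈ s, c j * e j θ := by
      rw [Finset.sum_mul_sum]
      exact Finset.sum_congr rfl fun i _ => Finset.sum_congr rfl fun j _ => by ring
    have h2 : ∑ j ∈ s, 2 * c j * (u θ * e j θ) = 2 * u θ * ∑ j ∈ s, c j * e j θ := by
      rw [Finset.mul_sum]
      exact Finset.sum_congr rfl fun i _ => by ring
    rw [h1, h2]; ring
  simp_rw [h]
  have hi : ∀ f : ℝ → ℝ, Continuous f → IntervalIntegrable f volume a b :=
    fun f hf => hf.intervalIntegrable _ _
  rw [intervalIntegral.integral_add (hi _ (by fun_prop)) (hi _ (by fun_prop)),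
    intervalIntegral.integral_sub (hi _ (by fun_prop)) (hi _ (by fun_prop)),
    intervalIntegral.integral_finsetSum (fun i _ => hi _ (by fun_prop)),
    intervalIntegral.integral_finsetSum (fun i _ => hi _ (by fun_prop)), Finset.sum_sub_distrib]
  congr 2
  · refine Finset.sum_congr rfl fun i his => ?_
    rw [intervalIntegral.integral_finsetSum (fun i _ => hi _ (by fun_prop))]
    simp_rw [intervalIntegral.integral_const_mul]
    rw [Finset.sum_eq_single i (fun j _ hj => by rw [horth i j hj.symm, mul_zero])
      (fun h => absurd his h)]
    ring
  · refine Finset.sum_congr rfl fun i _ => ?_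
    rw [intervalIntegral.integral_const_mul]

theorem bessel_le {u : ℝ → ℝ} (hu : Continuous u) {e : ℕ → ℝ → ℝ} (he : ∀ j, Continuous (e j))
    (horth : ∀ i j, i ≠ j → ∫ θ in (0 : ℝ)..Real.pi, e i θ * e j θ = 0) (s : Finset ℕ)
    (hs : ∀ j ∈ s, ∫ θ in (0 : ℝ)..Real.pi, e j θ * e j θ = Real.pi / 2) :
    2 / Real.pi * ∑ j ∈ s, (∫ θ in (0 : ℝ)..Real.pi, u θ * e j θ) ^ 2
      ≤ ∫ θ in (0 : ℝ)..Real.pi, u θ ^ 2 := by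
  have hpi := Real.pi_pos
  have h := integral_sub_sum_sq hu he horth s
    (fun j => 2 / Real.pi * ∫ θ in (0 : ℝ)..Real.pi, u θ * e j θ)
  have h0 : 0 ≤ ∫ θ in (0 : ℝ)..Real.pi,
      (u θ - ∑ j ∈ s, (2 / Real.pi * ∫ θ in (0 : ℝ)..Real.pi, u θ * e j θ) * e j θ) ^ 2 :=
    intervalIntegral.integral_nonneg hpi.le fun θ _ => sq_nonneg _
  rw [h] at h0
  rw [Finset.mul_sum]
  have h1 : ∀ j ∈ s, ((2 / Real.pi * ∫ θ in (0 : ℝ)..Real.pi, u θ * e j θ) ^ 2 *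
      (∫ θ in (0 : ℝ)..Real.pi, e j θ * e j θ) - 2 * (2 / Real.pi * ∫ θ in (0 : ℝ)..Real.pi, u θ * e j θ) *
      ∫ θ in (0 : ℝ)..Real.pi, u θ * e j θ) = -(2 / Real.pi * (∫ θ in (0 : ℝ)..Real.pi, u θ * e j θ) ^ 2) := by
    intro j hj
    rw [hs j hj]
    field_simp
    ring
  rw [Finset.sum_congr rfl h1, Finset.sum_neg_distrib] at h0
  linarith

theorem exists_cos_expansion (q : Polynomial ℝ) :
    ∃ (N : ℕ) (c : ℕ → ℝ), ∀ θ : ℝ,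
      q.eval (Real.cos θ) = ∑ j ∈ Finset.range N, c j * Real.cos (j * θ) := by
  set W : Submodule ℝ (ℝ → ℝ) := Submodule.span ℝ (range fun (j : ℕ) (θ : ℝ) => Real.cos (j * θ))
    with hW
  have hmul : ∀ f ∈ W, (fun θ => f θ * Real.cos θ) ∈ W := by
    intro f hf
    induction hf using Submodule.span_induction with
    | mem f hf =>
      obtain ⟨j, rfl⟩ := hf
      rcases j with _ | j
      · have : (fun θ => (fun (j : ℕ) (θ : ℝ) => Real.cos (j * θ)) 0 θ * Real.cos θ)
            = fun θ => Real.cos ((1 : ℕ) * θ) := by ext θ; simp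
        rw [this]
        exact Submodule.subset_span ⟨1, rfl⟩
      · have : (fun θ => (fun (j : ℕ) (θ : ℝ) => Real.cos (j * θ)) (j + 1) θ * Real.cos θ)
            = (1 / 2 : ℝ) • (fun θ : ℝ => Real.cos ((j + 2 : ℕ) * θ))
              + (1 / 2 : ℝ) • (fun θ : ℝ => Real.cos (j * θ)) := by
          ext θ
          have e1 : ((j + 2 : ℕ) : ℝ) * θ = (j + 1 : ℕ) * θ + θ := by push_cast; ring
          have e2 : (j : ℝ) * θ = (j + 1 : ℕ) * θ - θ := by push_cast; ring
          simp only [Pi.add_apply, Pi.smul_apply, smul_eq_mul]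
          rw [e1, e2, Real.cos_add, Real.cos_sub]; ring
        rw [this]
        exact W.add_mem (W.smul_mem _ (Submodule.subset_span ⟨_, rfl⟩))
          (W.smul_mem _ (Submodule.subset_span ⟨_, rfl⟩))
    | zero =>
      have : (fun θ : ℝ => (0 : ℝ → ℝ) θ * Real.cos θ) = 0 := by ext; simp
      rw [this]
      exact W.zero_mem
    | add f g _ _ hf hg =>
      have := W.add_mem hf hg
      simpa [Pi.add_def, add_mul] using this
    | smul a f _ hf =>
      have := W.smul_mem a hf
      simpa [Pi.smul_def, mul_assoc] using this
  have hpow : ∀ n : ℕ, (fun θ => Real.cos θ ^ n) ∈ W := by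
    intro n
    induction n with
    | zero => exact Submodule.subset_span ⟨0, by ext θ; simp⟩
    | succ n ih => simpa only [pow_succ] using hmul _ ih
  have hq : (fun θ => q.eval (Real.cos θ)) ∈ W := by
    simp_rw [Polynomial.eval_eq_sum_range]
    have := W.sum_mem (t := Finset.range (q.natDegree + 1))
      (f := fun i => q.coeff i • fun θ => Real.cos θ ^ i) fun i _ => W.smul_mem _ (hpow i)
    convert this using 1
    ext θ; simp
  obtain ⟨c, hc⟩ := Finsupp.mem_span_range_iff_exists_finsupp.1 hq
  obtain ⟨N, hN⟩ := c.support.exists_nat_subset_range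
  refine ⟨N, c, fun θ => ?_⟩
  have := congrFun hc θ
  rw [← this, Finsupp.sum, Finset.sum_apply]
  refine Finset.sum_subset hN fun j _ hj => ?_
  simp [Finsupp.notMem_support_iff.1 hj]

theorem exists_le_parseval {u : ℝ → ℝ} (hu : Continuous u)
    (h0 : ∫ θ in (0 : ℝ)..Real.pi, u θ = 0) {ε : ℝ} (hε : 0 < ε) :
    ∃ N : ℕ, (∫ θ in (0 : ℝ)..Real.pi, u θ ^ 2) ≤ ε +
      2 / Real.pi * ∑ j ∈ (Finset.range N).erase 0,
        (∫ θ in (0 : ℝ)..Real.pi, u θ * Real.cos (j * θ)) ^ 2 := by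
  have hpi := Real.pi_pos
  set δ := √(ε / Real.pi) with hδ
  have hδ0 : 0 < δ := Real.sqrt_pos.2 (by positivity)
  obtain ⟨q, hq⟩ := exists_polynomial_near_of_continuousOn (-1) 1 (fun x => u (Real.arccos x))
    (hu.comp Real.continuous_arccos).continuousOn δ hδ0
  obtain ⟨N, c, hc⟩ := exists_cos_expansion q
  refine ⟨N, ?_⟩
  have hle : ∫ θ in (0 : ℝ)..Real.pi, (u θ - ∑ j ∈ Finset.range N, c j * Real.cos (j * θ)) ^ 2 ≤ ε := by
    have h1 : ∀ θ ∈ Icc 0 Real.pi,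
        (u θ - ∑ j ∈ Finset.range N, c j * Real.cos (j * θ)) ^ 2 ≤ δ ^ 2 := by
      intro θ hθ
      have := hq (Real.cos θ) ⟨Real.neg_one_le_cos θ, Real.cos_le_one θ⟩
      rw [Real.arccos_cos hθ.1 hθ.2, hc, abs_sub_comm] at this
      exact sq_le_sq' (by linarith [(abs_lt.1 this).1]) (abs_lt.1 this).2.le
    have h2 := intervalIntegral.integral_mono_on (μ := volume) hpi.le
      (by apply Continuous.intervalIntegrable; fun_prop)
      (intervalIntegrable_const (c := δ ^ 2)) h1
    refine h2.trans (le_of_eq ?_)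
    rw [intervalIntegral.integral_const, hδ, Real.sq_sqrt (by positivity), smul_eq_mul]
    field_simp
    ring
  rw [integral_sub_sum_sq hu (e := fun j θ => Real.cos (j * θ)) (fun j => by fun_prop)
    (fun i j hij => integral_cos_mul_cos hij)] at hle
  set T : ℕ → ℝ := fun j => c j ^ 2 * (∫ θ in (0 : ℝ)..Real.pi, Real.cos (j * θ) * Real.cos (j * θ)) -
    2 * c j * ∫ θ in (0 : ℝ)..Real.pi, u θ * Real.cos (j * θ) with hT
  have h3 : ∑ j ∈ (Finset.range N).erase 0, T j ≤ ∑ j ∈ Finset.range N, T j := by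
    refine Finset.sum_le_sum_of_subset_of_nonneg (Finset.erase_subset _ _) fun j hj hj' => ?_
    have : j = 0 := by simpa [Finset.mem_erase, hj] using fun h => hj' (Finset.mem_erase.2 ⟨h, hj⟩)
    subst this
    simp only [hT, Nat.cast_zero, zero_mul, Real.cos_zero, mul_one, h0, mul_zero, sub_zero]
    refine mul_nonneg (sq_nonneg _) ?_
    simpa using hpi.le
  have h4 : ∀ j ∈ (Finset.range N).erase 0,
      -(2 / Real.pi * (∫ θ in (0 : ℝ)..Real.pi, u θ * Real.cos (j * θ)) ^ 2) ≤ T j := by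
    intro j hj
    simp only [hT]
    rw [integral_cos_mul_self (Finset.ne_of_mem_erase hj)]
    generalize (∫ θ in (0 : ℝ)..Real.pi, u θ * Real.cos (j * θ)) = a
    have : c j ^ 2 * (Real.pi / 2) - 2 * c j * a + 2 / Real.pi * a ^ 2
        = Real.pi / 2 * (c j - 2 / Real.pi * a) ^ 2 := by field_simp; ring
    have : 0 ≤ Real.pi / 2 * (c j - 2 / Real.pi * a) ^ 2 := by positivity
    linarith
  have h5 := Finset.sum_le_sum h4
  rw [Finset.sum_neg_distrib, ← Finset.mul_sum] at h5
  linarith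

theorem circleMap_im_pos {r θ : ℝ} (hr : 0 < r) (h : θ ∈ Ioo 0 Real.pi) : 0 < (circleMap 0 r θ).im := by
  rw [circleMap_zero, Complex.im_ofReal_mul, Complex.exp_ofReal_mul_I_im]
  exact mul_pos hr (Real.sin_pos_of_mem_Ioo h)

theorem le_setLIntegral_upper_ball {H : ℂ → ℝ≥0∞} (hH : Measurable H) :
    ∫⁻ r in Ioo (0 : ℝ) 1, ∫⁻ θ in Ioo 0 Real.pi, ENNReal.ofReal r * H (circleMap 0 r θ)
      ≤ ∫⁻ z in ball 0 1 ∩ {z | 0 < z.im}, H z := by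
  have hs : MeasurableSet (ball (0 : ℂ) 1 ∩ {z | 0 < z.im}) :=
    measurableSet_ball.inter (measurableSet_lt measurable_const Complex.measurable_im)
  have hm : Measurable fun q : ℝ × ℝ => ENNReal.ofReal q.1 * H (circleMap 0 q.1 q.2) := by
    have : Measurable fun q : ℝ × ℝ => circleMap 0 q.1 q.2 := by
      simp only [circleMap]; fun_prop
    exact (by fun_prop : Measurable fun q : ℝ × ℝ => ENNReal.ofReal q.1).mul (hH.comp this)
  rw [← lintegral_indicator hs, ← Complex.lintegral_comp_polarCoord_symm,
    show polarCoord.target = Ioi (0 : ℝ) ×ˢ Ioo (-Real.pi) Real.pi from rfl,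
    ← lintegral_prod (fun q : ℝ × ℝ => ENNReal.ofReal q.1 * H (circleMap 0 q.1 q.2)) hm.aemeasurable,
    Measure.prod_restrict, ← Measure.volume_eq_prod]
  refine le_trans (le_of_eq (setLIntegral_congr_fun (measurableSet_Ioo.prod measurableSet_Ioo) ?_))
    (lintegral_mono_set (prod_mono Ioo_subset_Ioi_self
      (Ioo_subset_Ioo_left (by linarith [Real.pi_pos]))))
  rintro ⟨r, θ⟩ ⟨hr, hθ⟩
  have hr : r ∈ Ioo (0 : ℝ) 1 := hr
  have hθ : θ ∈ Ioo 0 Real.pi := hθ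
  have h1 : Complex.polarCoord.symm (r, θ) = circleMap 0 r θ := by
    rw [Complex.polarCoord_symm_apply, circleMap_zero, Complex.exp_mul_I]
    simp
  have h2 : circleMap 0 r θ ∈ ball (0 : ℂ) 1 ∩ {z | 0 < z.im} :=
    ⟨by simpa [abs_of_pos hr.1] using hr.2, circleMap_im_pos hr.1 hθ⟩
  simp only [h1, indicator_of_mem h2, smul_eq_mul]

theorem sq_add_sq_le_norm_sq (L : ℂ →L[ℝ] ℝ) {e : ℂ} (he : ‖e‖ = 1) :
    L e ^ 2 + L (Complex.I * e) ^ 2 ≤ ‖L‖ ^ 2 := by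
  set v : ℂ := (L e : ℝ) * e + (L (Complex.I * e) : ℝ) * (Complex.I * e) with hv
  have h1 : L v = L e ^ 2 + L (Complex.I * e) ^ 2 := by
    rw [hv, ← Complex.real_smul, ← Complex.real_smul, map_add, map_smul, map_smul]
    simp only [smul_eq_mul]; ring
  have h2 : ‖v‖ ^ 2 = L e ^ 2 + L (Complex.I * e) ^ 2 := by
    have : v = ((L e : ℝ) + (L (Complex.I * e) : ℝ) * Complex.I) * e := by rw [hv]; ring
    rw [this, norm_mul, he, mul_one, ← Complex.normSq_eq_norm_sq, Complex.normSq_add_mul_I]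
  have h3 : L v ≤ ‖L‖ * ‖v‖ := (le_abs_self _).trans (L.le_opNorm v)
  rw [h1, ← h2] at h3
  rw [← h2]
  rcases (norm_nonneg v).eq_or_lt with h | h
  · rw [← h, zero_pow two_ne_zero]; positivity
  · have : ‖v‖ ≤ ‖L‖ := le_of_mul_le_mul_right (by linarith [sq ‖v‖]) h
    gcongr

theorem hasDerivAt_intervalIntegral {F F' : ℝ → ℝ → ℝ} (hF : Continuous F.uncurry)
    (hF' : Continuous F'.uncurry) (hd : ∀ r θ, HasDerivAt (fun r => F r θ) (F' r θ) r) (a b r : ℝ) :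
    HasDerivAt (fun r => ∫ θ in a..b, F r θ) (∫ θ in a..b, F' r θ) r := by
  have hFc : ∀ r, Continuous (F r) := fun r => hF.comp (Continuous.prodMk_right r)
  have hFc' : ∀ r, Continuous (F' r) := fun r => hF'.comp (Continuous.prodMk_right r)
  obtain ⟨C, hC⟩ := ((isCompact_closedBall r 1).prod (isCompact_uIcc (a := a) (b := b))).exists_bound_of_continuousOn
    hF'.continuousOn
  refine (intervalIntegral.hasDerivAt_integral_of_dominated_loc_of_deriv_le (bound := fun _ => C)
    (closedBall_mem_nhds r one_pos) (Eventually.of_forall fun r => (hFc r).aestronglyMeasurable)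
    ((hFc r).intervalIntegrable _ _) (hFc' r).aestronglyMeasurable ?_ intervalIntegrable_const ?_).2
  · exact Eventually.of_forall fun t ht x hx => hC (x, t) ⟨hx, uIoc_subset_uIcc ht⟩
  · exact Eventually.of_forall fun t _ x _ => hd x t

theorem continuous_fderiv_circleMap {G : ℂ → ℝ} (hG : ContDiff ℝ 1 G) (w : ℂ) :
    Continuous fun q : ℝ × ℝ => fderiv ℝ G (circleMap 0 q.1 q.2) (w * circleMap 0 1 q.2) := by
  have h := hG.continuous_fderiv one_ne_zero
  have h1 : Continuous fun q : ℝ × ℝ => circleMap 0 q.1 q.2 := by simp only [circleMap]; fun_prop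
  have h2 : Continuous fun q : ℝ × ℝ => w * circleMap 0 1 q.2 := by fun_prop
  exact (h.comp h1).clm_apply h2

theorem hasDerivAt_comp_circleMap_radius {G : ℂ → ℝ} (hG : ContDiff ℝ 1 G) (r θ : ℝ) :
    HasDerivAt (fun r => G (circleMap 0 r θ))
      (fderiv ℝ G (circleMap 0 r θ) (1 * circleMap 0 1 θ)) r := by
  have h1 : HasDerivAt (fun r : ℝ => circleMap 0 r θ) (1 * circleMap 0 1 θ) r := by
    simp only [circleMap_zero, Complex.ofReal_one, one_mul]
    simpa using Complex.ofRealCLM.hasDerivAt.mul_const (Complex.exp (θ * Complex.I))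
  exact (hG.differentiable one_ne_zero _).hasFDerivAt.comp_hasDerivAt r h1

theorem hasDerivAt_comp_circleMap_angle {G : ℂ → ℝ} (hG : ContDiff ℝ 1 G) (r θ : ℝ) :
    HasDerivAt (fun θ => G (circleMap 0 r θ))
      (r * fderiv ℝ G (circleMap 0 r θ) (Complex.I * circleMap 0 1 θ)) θ := by
  have h := (hG.differentiable one_ne_zero _).hasFDerivAt.comp_hasDerivAt θ
    (hasDerivAt_circleMap 0 r θ)
  have e : circleMap 0 r θ * Complex.I = r • (Complex.I * circleMap 0 1 θ) := by
    simp only [circleMap_zero, Complex.real_smul, Complex.ofReal_one]; ring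
  rwa [e, map_smul, smul_eq_mul] at h

theorem ofReal_integral_le_energy {G : ℂ → ℝ} (hG : ContDiff ℝ 1 G) :
    ENNReal.ofReal (∫ r in (0 : ℝ)..1, ∫ θ in (0 : ℝ)..Real.pi,
      r * (fderiv ℝ G (circleMap 0 r θ) (1 * circleMap 0 1 θ) ^ 2
        + fderiv ℝ G (circleMap 0 r θ) (Complex.I * circleMap 0 1 θ) ^ 2))
      ≤ ∫⁻ z in ball 0 1 ∩ {z | 0 < z.im}, ‖fderiv ℝ G z‖ₑ ^ 2 := by
  have hm : Measurable fun z => ‖fderiv ℝ G z‖ₑ ^ 2 :=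
    ((hG.continuous_fderiv one_ne_zero).enorm.measurable).pow_const 2
  refine le_trans ?_ (le_setLIntegral_upper_ball hm)
  set f : ℝ → ℝ → ℝ := fun r θ => r * (fderiv ℝ G (circleMap 0 r θ) (1 * circleMap 0 1 θ) ^ 2
        + fderiv ℝ G (circleMap 0 r θ) (Complex.I * circleMap 0 1 θ) ^ 2) with hf
  have hfc : Continuous f.uncurry := continuous_fst.mul
    (((continuous_fderiv_circleMap hG 1).pow 2).add ((continuous_fderiv_circleMap hG Complex.I).pow 2))
  have hf0 : ∀ r θ, 0 ≤ r → 0 ≤ f r θ := fun r θ hr => by positivity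
  have key : ∀ {a b : ℝ}, a ≤ b → ∀ g : ℝ → ℝ, Continuous g → (∀ x ∈ Ioo a b, 0 ≤ g x) →
      ENNReal.ofReal (∫ x in a..b, g x) = ∫⁻ x in Ioo a b, ENNReal.ofReal (g x) := by
    intro a b hab g hg hg0
    rw [intervalIntegral.integral_of_le hab, integral_Ioc_eq_integral_Ioo,
      ofReal_integral_eq_lintegral_ofReal]
    · exact hg.integrableOn_Icc.mono_set Ioo_subset_Icc_self
    · filter_upwards [ae_restrict_mem measurableSet_Ioo] with x hx using hg0 x hx
  rw [key zero_le_one _ (by fun_prop) fun r hr =>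
    intervalIntegral.integral_nonneg Real.pi_pos.le fun θ _ => hf0 r θ hr.1.le]
  refine setLIntegral_mono' measurableSet_Ioo fun r hr => ?_
  rw [key Real.pi_pos.le (f r) (hfc.comp (Continuous.prodMk_right r)) fun θ _ => hf0 r θ hr.1.le]
  refine lintegral_mono fun θ => ?_
  simp only [hf]
  rw [ENNReal.ofReal_mul hr.1.le]
  gcongr
  rw [← ofReal_norm, ← ENNReal.ofReal_pow (norm_nonneg _), one_mul]
  exact ENNReal.ofReal_le_ofReal (sq_add_sq_le_norm_sq _ (by simp))

theorem mul_integral_sin {G : ℂ → ℝ} (hG : ContDiff ℝ 1 G) (j : ℕ) (r : ℝ) :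
    r * ∫ θ in (0 : ℝ)..Real.pi,
      fderiv ℝ G (circleMap 0 r θ) (Complex.I * circleMap 0 1 θ) * Real.sin (j * θ)
      = -(j * ∫ θ in (0 : ℝ)..Real.pi, G (circleMap 0 r θ) * Real.cos (j * θ)) := by
  have hQ := (continuous_fderiv_circleMap hG Complex.I).comp (Continuous.prodMk_right r)
  have h := intervalIntegral.integral_mul_deriv_eq_deriv_mul (a := 0) (b := Real.pi)
    (u := fun θ => Real.sin (j * θ)) (u' := fun θ => Real.cos (j * θ) * j)
    (fun θ _ => by simpa using ((hasDerivAt_id θ).const_mul (j : ℝ)).sin)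
    (fun θ _ => hasDerivAt_comp_circleMap_angle hG r θ)
    (by apply Continuous.intervalIntegrable; fun_prop)
    ((continuous_const.mul hQ).intervalIntegrable _ _)
  simp only [Real.sin_nat_mul_pi, zero_mul, mul_zero, Real.sin_zero, sub_zero, zero_sub] at h
  rw [← intervalIntegral.integral_const_mul, ← intervalIntegral.integral_const_mul]
  refine Eq.trans ?_ (h.trans ?_)
  · exact intervalIntegral.integral_congr fun θ _ => by ring
  · exact congrArg Neg.neg (intervalIntegral.integral_congr fun θ _ => by ring)

theorem ofReal_sum_le_energy {G : ℂ → ℝ} (hG : ContDiff ℝ 1 G) (s : Finset ℕ) (hs : 0 ∉ s) :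
    ENNReal.ofReal (2 / Real.pi * ∑ j ∈ s,
      j * (∫ θ in (0 : ℝ)..Real.pi, G (circleMap 0 1 θ) * Real.cos (j * θ)) ^ 2)
      ≤ ∫⁻ z in ball 0 1 ∩ {z | 0 < z.im}, ‖fderiv ℝ G z‖ₑ ^ 2 := by
  refine le_trans (ENNReal.ofReal_le_ofReal ?_) (ofReal_integral_le_energy hG)
  have hs0 : ∀ j ∈ s, j ≠ 0 := fun j hj h => hs (h ▸ hj)
  set P : ℝ → ℝ → ℝ := fun r θ => fderiv ℝ G (circleMap 0 r θ) (1 * circleMap 0 1 θ) with hP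
  set Q : ℝ → ℝ → ℝ := fun r θ => fderiv ℝ G (circleMap 0 r θ) (Complex.I * circleMap 0 1 θ) with hQ
  have hPc : Continuous P.uncurry := continuous_fderiv_circleMap hG 1
  have hQc : Continuous Q.uncurry := continuous_fderiv_circleMap hG Complex.I
  have hPr : ∀ r, Continuous (P r) := fun r => hPc.comp (Continuous.prodMk_right r)
  have hQr : ∀ r, Continuous (Q r) := fun r => hQc.comp (Continuous.prodMk_right r)
  set a : ℕ → ℝ → ℝ := fun j r => ∫ θ in (0 : ℝ)..Real.pi, G (circleMap 0 r θ) * Real.cos (j * θ)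
    with ha
  set A : ℕ → ℝ → ℝ := fun j r => ∫ θ in (0 : ℝ)..Real.pi, P r θ * Real.cos (j * θ) with hA
  have hAc : ∀ j, Continuous (A j) := fun j =>
    intervalIntegral.continuous_parametric_intervalIntegral_of_continuous'
      (f := fun r θ => P r θ * Real.cos (j * θ)) (hPc.mul (by fun_prop)) _ _
  have hcirc : Continuous fun q : ℝ × ℝ => circleMap 0 q.1 q.2 := by
    simp only [circleMap]; fun_prop
  have hda : ∀ j r, HasDerivAt (a j) (A j r) r := fun j r =>
    hasDerivAt_intervalIntegral (F := fun r θ => G (circleMap 0 r θ) * Real.cos (j * θ))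
      (F' := fun r θ => P r θ * Real.cos (j * θ))
      ((hG.continuous.comp hcirc).mul (by fun_prop)) (hPc.mul (by fun_prop))
      (fun r θ => (hasDerivAt_comp_circleMap_radius hG r θ).mul_const _) _ _ _
  have hac : ∀ j, Continuous (a j) := fun j =>
    continuous_iff_continuousAt.2 fun r => (hda j r).continuousAt
  have hΦ : ∀ r ∈ uIcc (0 : ℝ) 1, HasDerivAt (fun r => 2 / Real.pi * ∑ j ∈ s, j * a j r ^ 2)
      (2 / Real.pi * ∑ j ∈ s, j * (2 * a j r * A j r)) r := fun r _ => by
    refine (HasDerivAt.fun_sum fun j _ => ?_).const_mul _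
    simpa using ((hda j r).pow 2).const_mul (j : ℝ)
  have hftc := intervalIntegral.integral_eq_sub_of_hasDerivAt hΦ
    (Continuous.intervalIntegrable (by fun_prop) _ _)
  have ha0 : ∀ j ∈ s, a j 0 = 0 := fun j hj => by
    have h1 := integral_cos_int_mul (m := j) (by exact_mod_cast hs0 j hj)
    simp only [ha, circleMap_zero_radius, Function.const_apply]
    rw [intervalIntegral.integral_const_mul]
    rw [Int.cast_natCast] at h1
    rw [h1, mul_zero]
  have h0 : ∑ j ∈ s, (j : ℝ) * a j 0 ^ 2 = 0 := Finset.sum_eq_zero fun j hj => by simp [ha0 j hj]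
  rw [h0, mul_zero, sub_zero] at hftc
  rw [← hftc]
  refine intervalIntegral.integral_mono_on zero_le_one
    (Continuous.intervalIntegrable (by fun_prop) _ _) (Continuous.intervalIntegrable ?_ _ _) ?_
  · refine intervalIntegral.continuous_parametric_intervalIntegral_of_continuous'
      (f := fun r θ => r * (P r θ ^ 2 + Q r θ ^ 2)) ?_ _ _
    exact continuous_fst.mul ((hPc.pow 2).add (hQc.pow 2))
  · intro r hr
    have b1 := bessel_le (hPr r) (e := fun j θ => Real.cos (j * θ)) (fun j => by fun_prop)
      (fun i j hij => integral_cos_mul_cos hij) s fun j hj => integral_cos_mul_self (hs0 j hj)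
    have b2 := bessel_le (hQr r) (e := fun j θ => Real.sin (j * θ)) (fun j => by fun_prop)
      (fun i j hij => integral_sin_mul_sin hij) s fun j hj => integral_sin_mul_self (hs0 j hj)
    rw [intervalIntegral.integral_const_mul, intervalIntegral.integral_add
      (f := fun θ => P r θ ^ 2) (g := fun θ => Q r θ ^ 2) (((hPr r).pow 2).intervalIntegrable _ _) (((hQr r).pow 2).intervalIntegrable _ _)]
    refine le_trans ?_ (mul_le_mul_of_nonneg_left (add_le_add b1 b2) hr.1)
    rw [← mul_add, ← Finset.sum_add_distrib, mul_left_comm, Finset.mul_sum _ _ r]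
    refine mul_le_mul_of_nonneg_left (Finset.sum_le_sum fun j _ => ?_) (by positivity)
    have h1 := mul_integral_sin hG j r
    change r * (∫ θ in (0 : ℝ)..Real.pi, Q r θ * Real.sin (j * θ)) = -(j * a j r) at h1
    change (j : ℝ) * (2 * a j r * A j r) ≤ r * (A j r ^ 2 + _)
    generalize (∫ θ in (0 : ℝ)..Real.pi, Q r θ * Real.sin (j * θ)) = b at h1 ⊢
    have h2 : 0 ≤ r * (A j r + b) ^ 2 := mul_nonneg hr.1 (sq_nonneg _)
    have h3 : (j : ℝ) * (2 * a j r * A j r) = -(2 * (r * b) * A j r) := by rw [h1]; ring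
    rw [h3]
    linarith

theorem setLIntegral_sq_le {G : ℂ → ℝ} (hG : Continuous G) :
    ∫⁻ z in sphere 0 1 ∩ {z | 0 ≤ z.im}, ENNReal.ofReal (G z ^ 2) ∂μH[1]
      ≤ ENNReal.ofReal (∫ θ in (0 : ℝ)..Real.pi, G (circleMap 0 1 θ) ^ 2) := by
  refine (setLIntegral_upper_sphere_le (by fun_prop)).trans (le_of_eq ?_)
  rw [intervalIntegral.integral_of_le Real.pi_pos.le, ← integral_Icc_eq_integral_Ioc,
    ofReal_integral_eq_lintegral_ofReal]
  · exact ((by fun_prop : Continuous fun θ => G (circleMap 0 1 θ) ^ 2)).integrableOn_Icc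
  · exact Eventually.of_forall fun θ => sq_nonneg _

theorem mul_setLIntegral_sq_le_energy {G : ℂ → ℝ} (hG : ContDiff ℝ 1 G) {k : ℕ} (hk : k ≠ 0)
    (ha : ∀ j < k, ∫ θ in (0 : ℝ)..Real.pi, G (circleMap 0 1 θ) * Real.cos (j * θ) = 0) :
    (k : ℝ≥0∞) * ∫⁻ z in sphere 0 1 ∩ {z | 0 ≤ z.im}, ENNReal.ofReal (G z ^ 2) ∂μH[1]
      ≤ ∫⁻ z in ball 0 1 ∩ {z | 0 < z.im}, ‖fderiv ℝ G z‖ₑ ^ 2 := by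
  have hpi := Real.pi_pos
  have hu : Continuous fun θ => G (circleMap 0 1 θ) :=
    hG.continuous.comp (continuous_circleMap 0 1)
  have hk0 : (0 : ℝ) < k := by exact_mod_cast Nat.pos_of_ne_zero hk
  refine (mul_le_mul_right (setLIntegral_sq_le hG.continuous) _).trans ?_
  refine ENNReal.le_of_forall_pos_le_add fun ε hε _ => ?_
  obtain ⟨N, hN⟩ := exists_le_parseval hu (by simpa using ha 0 (Nat.pos_of_ne_zero hk))
    (show (0 : ℝ) < ε / k by positivity)
  refine le_trans ?_ (add_le_add_left (ofReal_sum_le_energy hG _ (Finset.notMem_erase 0 (Finset.range N))) _)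
  rw [← ENNReal.ofReal_natCast, ← ENNReal.ofReal_mul hk0.le, ← ENNReal.ofReal_coe_nnreal,
    ← ENNReal.ofReal_add (by positivity) ε.coe_nonneg]
  refine ENNReal.ofReal_le_ofReal ((mul_le_mul_of_nonneg_left hN hk0.le).trans ?_)
  rw [mul_add, mul_div_cancel₀ _ hk0.ne', add_comm, mul_left_comm, Finset.mul_sum _ _ (k : ℝ)]
  gcongr 2 / Real.pi * ?_ + _
  refine Finset.sum_le_sum fun j _ => ?_
  rcases lt_or_ge j k with h | h
  · simp [ha j h]
  · gcongr

theorem isOpen_upper_ball : IsOpen (ball (0 : ℂ) 1 ∩ {z | 0 < z.im}) :=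
  isOpen_ball.inter (isOpen_lt continuous_const Complex.continuous_im)

theorem exists_eqOn_const_of_energy_eq_zero {G : ℂ → ℝ} (hG : ContDiff ℝ 1 G)
    (h : ∫⁻ z in ball 0 1 ∩ {z | 0 < z.im}, ‖fderiv ℝ G z‖ₑ ^ 2 = 0) :
    ∃ c, EqOn G (fun _ => c) (ball (0 : ℂ) 1 ∩ {z | 0 < z.im}) := by
  have hc := hG.continuous_fderiv one_ne_zero
  rw [lintegral_eq_zero_iff (hc.enorm.measurable.pow_const 2)] at h
  have h1 : fderiv ℝ G =ᵐ[volume.restrict (ball 0 1 ∩ {z | 0 < z.im})] 0 := by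
    filter_upwards [h] with z hz
    have hz' : ‖fderiv ℝ G z‖ₑ = 0 := by simpa using hz
    rw [← ofReal_norm, ENNReal.ofReal_eq_zero] at hz'
    exact norm_le_zero_iff.1 hz'
  have h2 := Measure.eqOn_open_of_ae_eq h1 isOpen_upper_ball hc.continuousOn continuousOn_const
  have hconv : Convex ℝ (ball (0 : ℂ) 1 ∩ {z | 0 < z.im}) :=
    (convex_ball _ _).inter (convex_halfSpace_im_gt 0)
  exact isOpen_upper_ball.exists_is_const_of_fderiv_eq_zero hconv.isPreconnected
    (hG.differentiable one_ne_zero).differentiableOn h2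

theorem eq_zero_of_energy_eq_zero {G : ℂ → ℝ} (hG : ContDiff ℝ 1 G)
    (h : ∫⁻ z in ball 0 1 ∩ {z | 0 < z.im}, ‖fderiv ℝ G z‖ₑ ^ 2 = 0)
    (h0 : ∫ θ in (0 : ℝ)..Real.pi, G (circleMap 0 1 θ) = 0) :
    EqOn G 0 (closure (ball (0 : ℂ) 1 ∩ {z | 0 < z.im})) := by
  obtain ⟨c, hc⟩ := exists_eqOn_const_of_energy_eq_zero hG h
  have hcl := hc.closure hG.continuous continuous_const
  have h1 : EqOn (fun θ => G (circleMap 0 1 θ)) (fun _ => c) (Ioo 0 Real.pi) := by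
    intro θ hθ
    refine hcl (mem_closure_of_tendsto (f := fun r : ℝ => circleMap 0 r θ) (b := 𝓝[<] 1) ?_ ?_)
    · have : Continuous fun r : ℝ => circleMap 0 r θ := by simp only [circleMap]; fun_prop
      exact this.continuousAt.tendsto.mono_left nhdsWithin_le_nhds
    · filter_upwards [Ioo_mem_nhdsLT (zero_lt_one (α := ℝ))] with r hr
      exact ⟨by simpa [abs_of_pos hr.1] using hr.2, circleMap_im_pos hr.1 hθ⟩
  have h2 := h1.closure (hG.continuous.comp (continuous_circleMap 0 1)) continuous_const
  rw [closure_Ioo Real.pi_pos.ne] at h2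
  have h3 : ∫ θ in (0 : ℝ)..Real.pi, G (circleMap 0 1 θ) = ∫ θ in (0 : ℝ)..Real.pi, c :=
    intervalIntegral.integral_congr (by rwa [uIcc_of_le Real.pi_pos.le])
  rw [h0, intervalIntegral.integral_const, sub_zero, smul_eq_mul, eq_comm, mul_eq_zero] at h3
  have h4 : c = 0 := h3.resolve_left Real.pi_pos.ne'
  subst h4
  exact hcl

theorem le_steklovN_halfDisk (k : ℕ) : (k : ℝ≥0∞) ≤ steklovN upperHalfDisk upperSemicircle k := by
  rcases eq_or_ne k 0 with rfl | hk
  · simp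
  refine le_iInf fun V => le_iInf fun hV => le_iInf fun hsm => le_iInf fun _ => le_iInf fun hinj => ?_
  have hG : ∀ f ∈ V, ContDiff ℝ 1 (f ∘ toC.symm) := fun f hf =>
    ((hsm f hf).of_le (by exact_mod_cast le_top)).comp toC.symm.contDiff
  have hint : ∀ f ∈ V, ∀ j : ℕ, IntervalIntegrable
      (fun θ => f (toC.symm (circleMap 0 1 θ)) * Real.cos (j * θ)) volume 0 Real.pi := fun f hf j => by
    have := (hG f hf).continuous.comp (continuous_circleMap 0 1)
    exact (this.mul (by fun_prop : Continuous fun θ : ℝ => Real.cos (j * θ))).intervalIntegrable _ _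
  set Λ : V →ₗ[ℝ] (Fin k → ℝ) :=
    { toFun := fun f j => ∫ θ in (0 : ℝ)..Real.pi, f.1 (toC.symm (circleMap 0 1 θ)) * Real.cos (j * θ)
      map_add' := fun f g => by
        ext j
        simp only [Submodule.coe_add, Pi.add_apply, add_mul]
        exact intervalIntegral.integral_add (hint _ f.2 j) (hint _ g.2 j)
      map_smul' := fun a f => by
        ext j
        simp only [Submodule.coe_smul, Pi.smul_apply, smul_eq_mul, mul_assoc, RingHom.id_apply]
        exact intervalIntegral.integral_const_mul _ _ } with hΛ
  have : FiniteDimensional ℝ V := Module.finite_of_finrank_pos (by omega)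
  have hker := LinearMap.ker_ne_bot_of_finrank_lt (f := Λ) (by rw [hV]; simp)
  obtain ⟨f, hf, hf0⟩ := (Submodule.ne_bot_iff _).1 hker
  have ha : ∀ j < k, ∫ θ in (0 : ℝ)..Real.pi,
      (f.1 ∘ toC.symm) (circleMap 0 1 θ) * Real.cos (j * θ) = 0 := fun j hj =>
    congrFun (LinearMap.mem_ker.1 hf) ⟨j, hj⟩
  have hfz : ¬ EqOn f.1 0 (closure upperHalfDisk) := fun h => hf0 (Subtype.ext (hinj f.1 f.2 h))
  have hGf := hG f.1 f.2
  have hcomp : f.1 = (f.1 ∘ toC.symm) ∘ toC := by ext x; simp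
  have hE : dirEnergy upperHalfDisk f.1
      = ∫⁻ z in ball 0 1 ∩ {z | 0 < z.im}, ‖fderiv ℝ (f.1 ∘ toC.symm) z‖ₑ ^ 2 := by
    rw [← dirEnergy_comp_toC, ← upperHalfDisk_eq, ← hcomp]
  have hB : bdryInt upperSemicircle (fun _ => 1) f.1
      = ∫⁻ z in sphere 0 1 ∩ {z | 0 ≤ z.im}, ENNReal.ofReal ((f.1 ∘ toC.symm) z ^ 2) ∂μH[1] := by
    rw [← bdryInt_comp_toC, ← upperSemicircle_eq, ← hcomp]
  refine le_iSup₂_of_le f.1 f.2 (le_iSup_of_le hfz ?_)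
  rw [rayleigh, hE, hB, ENNReal.le_div_iff_mul_le]
  · exact mul_setLIntegral_sq_le_energy hGf hk ha
  · right
    intro h
    refine hfz ?_
    have h1 := eq_zero_of_energy_eq_zero hGf h (by simpa using ha 0 (Nat.pos_of_ne_zero hk))
    have h2 : EqOn f.1 0 upperHalfDisk := fun x hx => by
      rw [upperHalfDisk_eq] at hx
      simpa using h1 (subset_closure hx)
    exact h2.closure (hsm f.1 f.2).continuous continuous_const
  · left
    exact ((setLIntegral_sq_le hGf.continuous).trans_lt ENNReal.ofReal_lt_top).ne

theorem le_halfDisk (k : ℕ) : ENNReal.ofReal (k * Real.pi)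
    ≤ steklovN upperHalfDisk upperSemicircle k * μH[1] upperSemicircle := by
  rw [ENNReal.ofReal_mul (by positivity), ENNReal.ofReal_natCast, upperSemicircle_eq,
    hausdorffMeasure_preimage_toC, ← upperSemicircle_eq]
  exact mul_le_mul' (le_steklovN_halfDisk k) pi_le_hausdorffMeasure_upper_sphere

theorem statement13 (p k : ℕ) (hp : 2 ≤ p) (hk : k ≤ (p + 1) / 2 - 1) :
    SfrakP p k = ENNReal.ofReal ((k : ℝ) * Real.pi)
    ∧ steklovN upperHalfDisk upperSemicircle k * μH[1] upperSemicircle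
        = ENNReal.ofReal ((k : ℝ) * Real.pi) := by
  have h1 := SfrakP_le hp hk
  have h2 := le_SfrakP_halfDisk p k
  have h3 := le_halfDisk k
  exact ⟨le_antisymm h1 (h3.trans h2), le_antisymm (h2.trans h1) h3⟩

end
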